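/- Let p be a prime, k a finite field of characteristic p, V a finite-dimensional k-vector space, and H a subgroup of GL(V). Assume that at least one of the following holds: (a) p does not divide the order of H; (b) V is a direct sum of simple k[H]-modules each of k-dimension at most (p+1)/2. Then: (1) End_k(V), with the conjugation action of H, is a semisimple k[H]-module; (2) End_k(V) is a semisimple 𝔽_p[H]-module; (3) every 𝔽_p[H]-submodule W ⊆ End_k(V) is a direct summand of End_k(V) as an 𝔽_p[H]-module; (4) if Hom_{𝔽_p}(End_k(V), V)^H = 0, then Hom_{𝔽_p}(W, V)^H = 0 for every 𝔽_p[H]-submodule W ⊆ End_k(V). -/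

import Mathlib

/-- The conjugation action `A ↦ h A h⁻¹` of a linear automorphism `h` on endomorphisms. -/
def conjEnd {k V : Type} [Field k] [AddCommGroup V] [Module k V]
    (h : V ≃ₗ[k] V) (A : Module.End k V) : Module.End k V :=
  (h : V →ₗ[k] V) ∘ₗ A ∘ₗ (h.symm : V →ₗ[k] V)

open Module

/-- A homogeneous `sl₂`-pair `e`, `f` on a family of subspaces `M` indexed by a group `A`: the
operator `[e, f]` acts on `M ζ` by the residue of the integer `deg ζ`, and `M` lives in degrees
smaller than `p` in absolute value. -/
structure IsGradedSl2 {K X A : Type*} [Field K] [AddCommGroup X] [Module K X] [AddCommGroup A]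
    (p : ℕ) (deg : A →+ ℤ) (ι : A) (M : A → Submodule K X) (e f : Module.End K X) : Prop where
  deg_ι : deg ι = 2
  e_mem : ∀ ζ, ∀ x ∈ M ζ, e x ∈ M (ζ + ι)
  f_mem : ∀ ζ, ∀ x ∈ M ζ, f x ∈ M (ζ - ι)
  comm : ∀ ζ, ∀ x ∈ M ζ, e (f x) - f (e x) = (deg ζ : K) • x
  bound : ∀ ζ, (p : ℤ) ≤ |deg ζ| → M ζ = ⊥

namespace IsGradedSl2

variable {K X A : Type*} [Field K] [AddCommGroup X] [Module K X] [AddCommGroup A]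
  {p : ℕ} {deg : A →+ ℤ} {ι : A} {M : A → Submodule K X} {e f : Module.End K X}

theorem symm (h : IsGradedSl2 p deg ι M e f) : IsGradedSl2 p (-deg) (-ι) M f e where
  deg_ι := by simp [h.deg_ι]
  e_mem ζ x hx := by simpa [sub_eq_add_neg] using h.f_mem ζ x hx
  f_mem ζ x hx := by simpa using h.e_mem ζ x hx
  comm ζ x hx := by
    rw [← neg_sub, h.comm ζ x hx]
    simp
  bound ζ hζ := h.bound ζ (by simpa using hζ)

theorem intCast_ne_zero [CharP K p] {d : ℤ} (h0 : 0 < d) (hd : d < p) : (d : K) ≠ 0 := by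
  rw [Ne, CharP.intCast_eq_zero_iff K p]
  intro hdvd
  exact absurd (Int.le_of_dvd h0 hdvd) (by omega)

theorem lt_of_ne_zero (h : IsGradedSl2 p deg ι M e f) {ζ : A} {x : X} (hx : x ∈ M ζ)
    (h0 : x ≠ 0) : |deg ζ| < p := by
  by_contra hlt
  rw [h.bound ζ (by omega)] at hx
  exact h0 (by simpa using hx)

theorem e_pow_mem (h : IsGradedSl2 p deg ι M e f) {ζ : A} {x : X} (hx : x ∈ M ζ) (j : ℕ) :
    (e ^ j) x ∈ M (ζ + j • ι) := by
  induction j with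
  | zero => simpa using hx
  | succ j ih =>
    rw [pow_succ', Module.End.mul_apply, succ_nsmul, ← add_assoc]
    exact h.e_mem _ _ ih

theorem f_pow_mem (h : IsGradedSl2 p deg ι M e f) {ζ : A} {x : X} (hx : x ∈ M ζ) (j : ℕ) :
    (f ^ j) x ∈ M (ζ - j • ι) := by
  have := h.symm.e_pow_mem hx j
  simpa [sub_eq_add_neg] using this

theorem _root_.Module.End.apply_pow_apply (g : Module.End K X) (j : ℕ) (x : X) :
    g ((g ^ j) x) = (g ^ (j + 1)) x := by
  rw [pow_succ', Module.End.mul_apply]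

theorem e_f_pow (h : IsGradedSl2 p deg ι M e f) {ζ : A} {x : X} (hx : x ∈ M ζ) (j : ℕ) :
    e ((f ^ (j + 1)) x) =
      (f ^ (j + 1)) (e x) + (((j + 1 : ℤ) * (deg ζ - j) : ℤ) : K) • (f ^ j) x := by
  induction j with
  | zero =>
    have := h.comm ζ x hx
    simp only [zero_add, pow_one, pow_zero, Module.End.one_apply]
    rw [sub_eq_iff_eq_add'] at this
    simp [this]
  | succ j ih =>
    have h1 := h.comm _ _ (h.f_pow_mem hx (j + 1))
    rw [sub_eq_iff_eq_add'] at h1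
    rw [← f.apply_pow_apply, h1, ih, map_add, map_smul, f.apply_pow_apply, f.apply_pow_apply,
      add_assoc, ← add_smul, ← Int.cast_add]
    congr 2
    rw [map_sub, map_nsmul, h.deg_ι]
    rw [nsmul_eq_mul]
    push_cast
    ring

/-- On a vector of degree `d ≥ 0`, the powers `f ^ j` with `j ≤ d` are injective. -/
theorem eq_zero_of_f_pow [CharP K p] (h : IsGradedSl2 p deg ι M e f) {ζ : A} {x : X}
    (hx : x ∈ M ζ) {j : ℕ} (hj : (j : ℤ) ≤ deg ζ) (h0 : (f ^ j) x = 0) : x = 0 := by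
  obtain ⟨n, hn⟩ : ∃ n : ℕ, (p : ℤ) - deg ζ ≤ n := ⟨((p : ℤ) - deg ζ).toNat, by omega⟩
  induction n using Nat.strong_induction_on generalizing ζ x j with
  | _ n ihn =>
    by_contra hne
    have hlt := h.lt_of_ne_zero hx hne
    rw [abs_lt] at hlt
    have hex : e x = 0 := by
      have hd : deg (ζ + ι) = deg ζ + 2 := by rw [map_add, h.deg_ι]
      cases j with
      | zero => simp_all
      | succ j =>
        refine ihn (n - 1) (by omega) (h.e_mem _ _ hx) (j := j + 2) (by push_cast at *; omega)
          ?_ (by omega)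
        have h1 := congrArg f (h.e_f_pow hx j)
        rw [h0, map_zero, map_zero, map_add, map_smul, f.apply_pow_apply, f.apply_pow_apply, h0,
          smul_zero, add_zero] at h1
        exact h1.symm
    induction j with
    | zero => exact hne (by simpa using h0)
    | succ j ihj =>
      have h1 := h.e_f_pow hx j
      rw [h0, hex, map_zero, map_zero, zero_add] at h1
      refine ihj (by push_cast at *; omega) ?_
      refine (smul_eq_zero.mp h1.symm).resolve_left ?_
      push_cast at hj
      rw [Int.cast_mul]
      exact mul_ne_zero (intCast_ne_zero (p := p) (by omega) (by omega))
        (intCast_ne_zero (p := p) (by omega) (by omega))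

theorem eq_zero_of_e_pow [CharP K p] (h : IsGradedSl2 p deg ι M e f) {ζ : A} {x : X}
    (hx : x ∈ M ζ) {j : ℕ} (hj : (j : ℤ) ≤ -deg ζ) (h0 : (e ^ j) x = 0) : x = 0 :=
  h.symm.eq_zero_of_f_pow hx (by simpa using hj) h0

/-- A nonzero vector killed by `e` has nonnegative degree. -/
theorem deg_nonneg_of_e_eq_zero [CharP K p] (h : IsGradedSl2 p deg ι M e f) {ζ : A} {x : X}
    (hx : x ∈ M ζ) (hne : x ≠ 0) (h0 : e x = 0) : 0 ≤ deg ζ := by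
  by_contra hlt
  exact hne (h.eq_zero_of_e_pow hx (j := 1) (by push_cast; omega) (by simpa using h0))

/-- In degrees at least two, `e ∘ f` is injective. -/
theorem eq_zero_of_e_f [CharP K p] (h : IsGradedSl2 p deg ι M e f) {ζ : A} {y : X}
    (hy : y ∈ M ζ) (hd : 2 ≤ deg ζ) (h0 : e (f y) = 0) : y = 0 := by
  by_contra hne
  have hfe : ∀ i : ℕ, f ((e ^ (i + 1)) y) =
      -((((i + 1 : ℤ) * (deg ζ + i) : ℤ) : K) • (e ^ i) y) := by
    intro i
    induction i with
    | zero =>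
      have := h.comm ζ y hy
      rw [h0, zero_sub] at this
      simp [← this]
    | succ i ih =>
      have h1 := h.comm _ _ (h.e_pow_mem hy (i + 1))
      rw [ih, map_neg, map_smul, e.apply_pow_apply, e.apply_pow_apply] at h1
      have h2 : f ((e ^ (i + 1 + 1)) y) = -((((i + 1 : ℤ) * (deg ζ + i) : ℤ) : K) +
          (deg (ζ + (i + 1) • ι) : K)) • (e ^ (i + 1)) y := by
        rw [neg_smul, add_smul, ← h1]
        abel
      rw [h2, ← neg_smul, ← Int.cast_add]
      congr 3
      rw [map_add, map_nsmul, h.deg_ι, nsmul_eq_mul]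
      push_cast
      ring
  have hall : ∀ i : ℕ, (e ^ i) y ≠ 0 := by
    intro i
    induction i with
    | zero => simpa using hne
    | succ i ih =>
      intro h1
      have h2 := hfe i
      have h3 := h.lt_of_ne_zero (h.e_pow_mem hy i) ih
      rw [map_add, map_nsmul, h.deg_ι, abs_lt, nsmul_eq_mul] at h3
      rw [h1, map_zero, eq_comm, neg_eq_zero, Int.cast_mul] at h2
      refine (smul_ne_zero (mul_ne_zero ?_ ?_) ih) h2
      · exact intCast_ne_zero (p := p) (by omega) (by omega)
      · exact intCast_ne_zero (p := p) (by omega) (by omega)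
  have h3 := h.lt_of_ne_zero (h.e_pow_mem hy p) (hall p)
  rw [map_add, map_nsmul, h.deg_ι, abs_lt, nsmul_eq_mul] at h3
  omega

/-- In degrees at least zero, every vector is the sum of a vector killed by `e` and a vector
in the image of `f`. -/
theorem exists_eq_add_f [CharP K p] (h : IsGradedSl2 p deg ι M e f)
    {ζ : A} [FiniteDimensional K (M (ζ + ι))] (hd : 0 ≤ deg ζ) {x : X} (hx : x ∈ M ζ) :
    ∃ u ∈ M ζ, ∃ y ∈ M (ζ + ι), e u = 0 ∧ x = u + f y := by
  have hmaps : ∀ y ∈ M (ζ + ι), (e * f) y ∈ M (ζ + ι) := fun y hy => by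
    simpa using h.e_mem _ _ (h.f_mem _ _ hy)
  have hinj : Function.Injective ((e * f).restrict hmaps) := by
    rw [← LinearMap.ker_eq_bot, LinearMap.ker_eq_bot']
    rintro ⟨y, hy⟩ h0
    have := h.eq_zero_of_e_f hy (by rw [map_add, h.deg_ι]; omega)
      (by simpa [Subtype.ext_iff] using h0)
    simpa [Subtype.ext_iff] using this
  obtain ⟨⟨y, hy⟩, hyx⟩ := LinearMap.surjective_of_injective hinj ⟨e x, h.e_mem _ _ hx⟩
  have hfy : f y ∈ M ζ := by simpa using h.f_mem _ _ hy
  refine ⟨x - f y, sub_mem hx hfy, y, hy, ?_, by simp⟩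
  have : e (f y) = e x := by simpa [Subtype.ext_iff] using hyx
  rw [map_sub, this, sub_self]

end IsGradedSl2

section Norms

/-- A nonarchimedean norm on a vector space, written additively, with finitely many values. -/
structure IsAddNorm (K : Type*) {W : Type*} [Field K] [AddCommGroup W] [Module K W]
    (N : W → WithTop ℝ) : Prop where
  eq_top : ∀ x, N x = ⊤ ↔ x = 0
  add : ∀ x y t, t ≤ N x → t ≤ N y → t ≤ N (x + y)
  smul : ∀ (a : K) x, N x ≤ N (a • x)
  finite : (Set.range N).Finite

namespace IsAddNorm

variable {K W : Type*} [Field K] [AddCommGroup W] [Module K W] {N : W → WithTop ℝ}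

theorem restrict (h : IsAddNorm K N) (Z : Submodule K W) : IsAddNorm K fun z : Z => N z where
  eq_top x := by simp [h.eq_top]
  add x y t := h.add x y t
  smul a x := h.smul a x
  finite := h.finite.subset (by rintro _ ⟨x, rfl⟩; exact ⟨x, rfl⟩)

theorem exists_isMax [Nontrivial W] (h : IsAddNorm K N) : ∃ v ≠ 0, ∀ x ≠ 0, N x ≤ N v := by
  obtain ⟨y, hy⟩ := exists_ne (0 : W)
  obtain ⟨_, ⟨v, hv, rfl⟩, hmax⟩ := Set.exists_max_image (N '' {x | x ≠ 0}) id
    (h.finite.subset (Set.image_subset_range _ _)) ⟨_, y, hy, rfl⟩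
  exact ⟨v, hv, fun x hx => hmax _ ⟨x, hx, rfl⟩⟩

/-- A linear form equal to `1` at `v` and killing the vectors of larger norm. -/
theorem exists_dual (h : IsAddNorm K N) {v : W} (hv : v ≠ 0) :
    ∃ φ : W →ₗ[K] K, φ v = 1 ∧ ∀ x, φ x ≠ 0 → N x ≤ N v := by
  let Z : Submodule K W :=
    { carrier := {y | N v < N y}
      add_mem' := fun {y z} hy hz => by
        simp only [Set.mem_ofPred_eq] at *
        exact (lt_min hy hz).trans_le (h.add y z _ (min_le_left _ _) (min_le_right _ _))
      zero_mem' := by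
        rw [Set.mem_ofPred_eq, (h.eq_top 0).mpr rfl, lt_top_iff_ne_top]
        simpa [h.eq_top] using hv
      smul_mem' := fun a y hy => lt_of_lt_of_le hy (h.smul a y) }
  have hvZ : v ∉ Z := lt_irrefl (N v)
  obtain ⟨φ, hφ, hZ⟩ := Submodule.exists_le_ker_of_notMem hvZ
  refine ⟨(φ v)⁻¹ • φ, by simp [hφ], fun x hx => ?_⟩
  by_contra hlt
  have : φ x = 0 := hZ (show x ∈ Z from not_le.mp hlt)
  simp [this] at hx

/-- Two norms have a common orthogonal basis. -/
theorem exists_basis {N' : W → WithTop ℝ} [FiniteDimensional K W] (h : IsAddNorm K N)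
    (h' : IsAddNorm K N') {d : ℕ} (hd : Module.finrank K W = d) :
    ∃ β : Module.Basis (Fin d) K W, ∀ (a : Fin d → K) (s : Fin d), a s ≠ 0 →
      N (∑ i, a i • β i) ≤ N (β s) ∧ N' (∑ i, a i • β i) ≤ N' (β s) := by
  induction d generalizing W with
  | zero => exact ⟨Module.finBasisOfFinrankEq K W hd, fun _ s => s.elim0⟩
  | succ d ih =>
    have : Nontrivial W := Module.nontrivial_of_finrank_pos (R := K) (by omega)
    obtain ⟨v, hv, hmax⟩ := h.exists_isMax
    obtain ⟨φ, hφv, hφ⟩ := h'.exists_dual hv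
    have hker : Module.finrank K (LinearMap.ker φ) = d := by
      have h1 := φ.finrank_range_add_finrank_ker
      rw [LinearMap.range_eq_top.mpr (LinearMap.surjective (by rintro rfl; simp at hφv)),
        finrank_top, Module.finrank_self] at h1
      omega
    obtain ⟨β, hβ⟩ := ih (h.restrict (LinearMap.ker φ)) (h'.restrict (LinearMap.ker φ)) hker
    have key : ∀ {M : W → WithTop ℝ}, IsAddNorm K M → (∀ x, φ x ≠ 0 → M x ≤ M v) →
        ∀ (a : K) (y : LinearMap.ker φ),
          M (a • v + y) ≤ M y ∧ (a ≠ 0 → M (a • v + y) ≤ M v) := by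
      intro M hM hle a y
      have hy : φ y = 0 := y.2
      have h2 : a ≠ 0 → M (a • v + y) ≤ M v := fun ha => hle _ (by simp [hy, hφv, ha])
      refine ⟨?_, h2⟩
      by_cases ha : a = 0
      · simp [ha]
      · have := hM.add (a • v + y) (-a • v) (M (a • v + y)) le_rfl
          ((h2 ha).trans (hM.smul _ _))
        simpa using this
    refine ⟨Module.Basis.mkFinCons v β ?_ ?_, ?_⟩
    · intro c x hx h0
      have := congrArg φ h0
      rw [LinearMap.mem_ker] at hx
      simpa [hx, hφv] using this
    · intro z
      exact ⟨-φ z, by simp [hφv]⟩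
    · intro a s hs
      have hk := key h (fun x hx => hmax x (by rintro rfl; simp at hx)) (a 0)
        (∑ i, a i.succ • β i)
      have hk' := key h' hφ (a 0) (∑ i, a i.succ • β i)
      simp only [Module.Basis.coe_mkFinCons, Fin.sum_univ_succ, Fin.cons_zero, Fin.cons_succ,
        Function.comp_apply]
      simp only [AddSubmonoidClass.coe_finsetSum, Submodule.coe_smul] at hk hk'
      refine Fin.cases (fun hs => ?_) (fun s hs => ?_) s hs
      · exact ⟨hk.2 hs, hk'.2 hs⟩
      · have := hβ (fun i => a i.succ) s hs
        simp only [AddSubmonoidClass.coe_finsetSum, Submodule.coe_smul] at this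
        exact ⟨hk.1.trans this.1, hk'.1.trans this.2⟩

/-- The norm for which the basis `b` is orthogonal with weights `w`. -/
theorem of_basis {n : Type*} [Fintype n] (b : Module.Basis n K W) (w : n → ℝ) :
    ∃ N : W → WithTop ℝ, IsAddNorm K N ∧
      ∀ x (t : WithTop ℝ), t ≤ N x ↔ ∀ s, b.repr x s ≠ 0 → t ≤ w s := by
  classical
  let N : W → WithTop ℝ := fun x =>
    Finset.univ.inf fun s => if b.repr x s = 0 then ⊤ else (w s : WithTop ℝ)
  have hN : ∀ x (t : WithTop ℝ), t ≤ N x ↔ ∀ s, b.repr x s ≠ 0 → t ≤ w s := by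
    intro x t
    simp only [N, Finset.le_inf_iff, Finset.mem_univ, true_implies]
    refine forall_congr' fun s => ?_
    split_ifs with h <;> simp [h]
  refine ⟨N, ⟨?_, ?_, ?_, ?_⟩, hN⟩
  · intro x
    rw [← top_le_iff, hN]
    constructor
    · intro h
      refine b.repr.map_eq_zero_iff.mp (Finsupp.ext fun s => ?_)
      by_contra h0
      simpa using h s h0
    · rintro rfl s hs
      simp at hs
  · intro x y t hx hy
    rw [hN] at *
    intro s hs
    by_cases h : b.repr x s = 0
    · exact hy s fun h' => hs (by simp [h, h'])
    · exact hx s h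
  · intro a x
    rw [hN]
    intro s hs
    exact (hN x _).mp le_rfl s fun h => hs (by simp [h])
  · refine (Set.finite_range fun J : Finset n => J.inf fun s => (w s : WithTop ℝ)).subset ?_
    rintro _ ⟨x, rfl⟩
    refine ⟨Finset.univ.filter fun s => b.repr x s ≠ 0, ?_⟩
    refine le_antisymm ?_ ?_
    · rw [hN]
      intro s hs
      exact Finset.inf_le (by simpa using hs)
    · rw [Finset.le_inf_iff]
      intro s hs
      exact (hN x _).mp le_rfl s (by simpa using hs)

end IsAddNorm
end Norms

section Weights

variable {K V I n : Type*} [Field K] [AddCommGroup V] [Module K V]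
  {W : I → Submodule K V} {c : n → I}

/-- The basis `b`, whose elements are distributed among the summands `W i` by `c`. -/
def IsAdapted (W : I → Submodule K V) (c : n → I) (b : Basis n K V) : Prop :=
  ∀ s, b s ∈ W (c s)

/-- The weighted basis `(b', w')` defines a norm at least as large as `(b, w)`. -/
def WeightLE (b : Basis n K V) (w : n → ℝ) (b' : Basis n K V) (w' : n → ℝ) : Prop :=
  ∀ s s', b'.repr (b s) s' ≠ 0 → w s ≤ w' s'

theorem IsAdapted.mem {b : Basis n K V} (hb : IsAdapted W c b) {i : I} (s : {s // c s = i}) :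
    b s ∈ W i := by
  obtain ⟨s, rfl⟩ := s
  exact hb s

theorem IsAdapted.linearIndependent_fiber {b : Basis n K V} (hb : IsAdapted W c b) (i : I) :
    LinearIndependent K fun s : {s // c s = i} => (⟨b s, hb.mem s⟩ : W i) :=
  LinearIndependent.of_comp (W i).subtype
    (b.linearIndependent.comp (fun s : {s // c s = i} => s.1) Subtype.val_injective)

variable [Fintype n]

theorem IsAdapted.eq_of_repr_ne_zero {b : Basis n K V} (hb : IsAdapted W c b)
    (hW : iSupIndep W) {i : I} {x : V} (hx : x ∈ W i) {s : n} (hs : b.repr x s ≠ 0) :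
    c s = i := by
  classical
  by_contra hne
  have hsum := b.sum_repr x
  rw [← Finset.sum_filter_add_sum_filter_not Finset.univ (fun s => c s = i)] at hsum
  have h1 : ∑ s with c s = i, b.repr x s • b s ∈ W i :=
    sum_mem fun s hs => by
      have := hb s
      rw [(Finset.mem_filter.mp hs).2] at this
      exact Submodule.smul_mem _ _ this
  have h2 : ∑ s with ¬ c s = i, b.repr x s • b s ∈ ⨆ j, ⨆ (_ : j ≠ i), W j :=
    sum_mem fun s hs => Submodule.smul_mem _ _
      ((le_iSup₂ (f := fun j (_ : j ≠ i) => W j) (c s) (Finset.mem_filter.mp hs).2) (hb s))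
  have h3 : ∑ s with ¬ c s = i, b.repr x s • b s ∈ W i := by
    rw [← sub_eq_iff_eq_add'.mpr hsum.symm]
    exact sub_mem hx h1
  have h4 := (Submodule.disjoint_def.mp (hW i)) _ h3 h2
  have h5 : b.repr (∑ s with ¬ c s = i, b.repr x s • b s) s = b.repr x s := by
    rw [map_sum, Finsupp.finsetSum_apply]
    simp only [map_smul, Basis.repr_self, Finsupp.smul_apply, Finsupp.single_apply]
    rw [Finset.sum_eq_single s]
    · simp
    · intro j _ hj
      simp [hj]
    · simp [hne]
  rw [h4] at h5
  simp at h5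
  exact hs h5.symm

theorem IsAdapted.span_fiber {b : Basis n K V} (hb : IsAdapted W c b) (hW : iSupIndep W)
    (i : I) :
    ⊤ ≤ Submodule.span K (Set.range fun s : {s // c s = i} => (⟨b s, hb.mem s⟩ : W i)) := by
  classical
  rintro ⟨x, hx⟩ -
  have : (⟨x, hx⟩ : W i) =
      ∑ s, if h : c s = i then b.repr x s • (⟨b s, hb.mem ⟨s, h⟩⟩ : W i) else 0 := by
    apply Subtype.ext
    rw [AddSubmonoidClass.coe_finsetSum]
    refine (b.sum_repr x).symm.trans ?_
    refine Finset.sum_congr rfl fun s _ => ?_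
    split_ifs with h
    · rfl
    · by_cases h0 : b.repr x s = 0
      · simp [h0]
      · exact absurd (hb.eq_of_repr_ne_zero hW hx h0) h
  rw [this]
  refine sum_mem fun s _ => ?_
  split_ifs with h
  · exact Submodule.smul_mem _ _ (Submodule.subset_span ⟨⟨s, h⟩, rfl⟩)
  · exact zero_mem _

theorem IsAdapted.finrank_eq {b : Basis n K V} (hb : IsAdapted W c b) (hW : iSupIndep W)
    [DecidableEq I] (i : I) : finrank K (W i) = Fintype.card {s // c s = i} :=
  finrank_eq_card_basis (Basis.mk (hb.linearIndependent_fiber i) (hb.span_fiber hW i))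

theorem exists_common_basis [DecidableEq I] (hW : iSupIndep W) (hW' : iSup W = ⊤)
    {b b' : Basis n K V} (hb : IsAdapted W c b) (hb' : IsAdapted W c b') (w w' : n → ℝ) :
    ∃ b'' : Basis n K V, IsAdapted W c b'' ∧ ∃ w₁ w₂ : n → ℝ,
      WeightLE b w b'' w₁ ∧ WeightLE b'' w₁ b w ∧
      WeightLE b' w' b'' w₂ ∧ WeightLE b'' w₂ b' w' := by
  classical
  obtain ⟨N, hN, hN1⟩ := IsAddNorm.of_basis b w
  obtain ⟨N', hN', hN1'⟩ := IsAddNorm.of_basis b' w'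
  have hfd : FiniteDimensional K V := .of_basis b
  have key : ∀ i, ∃ β : Basis {s // c s = i} K (W i), ∀ (x : W i) s, β.repr x s ≠ 0 →
      N x ≤ N (β s) ∧ N' x ≤ N' (β s) := by
    intro i
    obtain ⟨β, hβ⟩ := (hN.restrict (W i)).exists_basis (hN'.restrict (W i)) rfl
    refine ⟨β.reindex (finCongr (hb.finrank_eq hW i) |>.trans (Fintype.equivFin _).symm), ?_⟩
    intro x s hs
    have := hβ (fun j => β.repr x j)
      ((finCongr (hb.finrank_eq hW i) |>.trans (Fintype.equivFin _).symm).symm s)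
      (by rwa [Basis.repr_reindex_apply] at hs)
    rw [β.sum_repr] at this
    simpa using this
  choose β hβ using key
  have hint : DirectSum.IsInternal W :=
    (DirectSum.isInternal_submodule_iff_iSupIndep_and_iSup_eq_top W).mpr ⟨hW, hW'⟩
  let b'' : Basis n K V := (hint.collectedBasis β).reindex (Equiv.sigmaFiberEquiv c)
  have hb''s : ∀ s, b'' s = β (c s) ⟨s, rfl⟩ := by
    intro s
    simp only [b'', Basis.reindex_apply, DirectSum.IsInternal.collectedBasis_coe]
    rfl
  have hb'' : IsAdapted W c b'' := fun s => by
    rw [hb''s]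
    exact Subtype.property _
  have hrep : ∀ i (x : W i) s, b''.repr x s ≠ 0 → N x ≤ N (b'' s) ∧ N' x ≤ N' (b'' s) := by
    intro i x s hs
    obtain rfl := hb''.eq_of_repr_ne_zero hW x.2 hs
    rw [hb''s]
    refine hβ _ x _ ?_
    have h1 := hint.collectedBasis_repr_of_mem β x.2 (a := ⟨s, rfl⟩)
    simp only [Subtype.coe_eta] at h1
    rw [← h1]
    rwa [Basis.repr_reindex_apply] at hs
  have hfin : ∀ {M : V → WithTop ℝ}, IsAddNorm K M → ∀ s, ∃ t : ℝ, M (b'' s) = t := by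
    intro M hM s
    obtain ⟨t, ht⟩ := WithTop.ne_top_iff_exists.mp
      (fun h => b''.ne_zero s ((hM.eq_top _).mp h) : M (b'' s) ≠ ⊤)
    exact ⟨t, ht.symm⟩
  choose w₁ hw₁ using hfin hN
  choose w₂ hw₂ using hfin hN'
  refine ⟨b'', hb'', w₁, w₂, ?_, ?_, ?_, ?_⟩
  · intro s s' hs
    have h1 := (hrep _ ⟨b s, hb s⟩ s' hs).1
    rw [hw₁] at h1
    have h2 : (w s : WithTop ℝ) ≤ N (b s) := (hN1 _ _).mpr fun j hj => by
      rw [Basis.repr_self, Finsupp.single_apply_ne_zero] at hj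
      rw [hj.1]
    exact_mod_cast h2.trans h1
  · intro s s' hs
    have := (hN1 _ _).mp (hw₁ s).ge s' hs
    exact_mod_cast this
  · intro s s' hs
    have h1 := (hrep _ ⟨b' s, hb' s⟩ s' hs).2
    rw [hw₂] at h1
    have h2 : (w' s : WithTop ℝ) ≤ N' (b' s) := (hN1' _ _).mpr fun j hj => by
      rw [Basis.repr_self, Finsupp.single_apply_ne_zero] at hj
      rw [hj.1]
    exact_mod_cast h2.trans h1
  · intro s s' hs
    have := (hN1' _ _).mp (hw₂ s).ge s' hs
    exact_mod_cast this

theorem exists_perm_of_basis [DecidableEq n] (b b' : Basis n K V) :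
    ∃ σ : Equiv.Perm n, ∀ s, b'.repr (b s) (σ s) ≠ 0 := by
  by_contra! h
  have hdet : (b'.toMatrix b).det = 0 := by
    rw [Matrix.det_apply]
    refine Finset.sum_eq_zero fun σ _ => ?_
    obtain ⟨s, hs⟩ := h σ
    rw [Finset.prod_eq_zero (Finset.mem_univ s) (by simpa [Basis.toMatrix_apply] using hs),
      smul_zero]
  have : (b'.toMatrix b * b.toMatrix b').det = 0 := by rw [Matrix.det_mul, hdet, zero_mul]
  simp at this

theorem WeightLE.exists_perm (hW : iSupIndep W) {b b' : Basis n K V} {w w' : n → ℝ}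
    (hb : IsAdapted W c b) (h : WeightLE b w b' w') (h' : WeightLE b' w' b w)
    (hb' : IsAdapted W c b') :
    ∃ σ : Equiv.Perm n, (∀ s, c (σ s) = c s) ∧ ∀ s, w' (σ s) = w s := by
  classical
  obtain ⟨σ, hσ⟩ := exists_perm_of_basis b b'
  obtain ⟨τ, hτ⟩ := exists_perm_of_basis b' b
  have h1 : ∀ s, w s ≤ w' (σ s) := fun s => h s _ (hσ s)
  have h2 : ∀ s, w' s ≤ w (τ s) := fun s => h' s _ (hτ s)
  have h3 : ∑ s, w s = ∑ s, w' (σ s) := by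
    refine le_antisymm (Finset.sum_le_sum fun s _ => h1 s) ?_
    rw [Equiv.sum_comp σ w', ← Equiv.sum_comp τ w]
    exact Finset.sum_le_sum fun s _ => h2 s
  refine ⟨σ, fun s => hb'.eq_of_repr_ne_zero hW (hb s) (hσ s), fun s => ?_⟩
  exact (((Finset.sum_eq_sum_iff_of_le fun s _ => h1 s).mp h3) s (Finset.mem_univ s)).symm

end Weights

section Kempf

theorem Matrix.exists_submatrix_det_ne_zero {K J : Type*} [Field K] [Fintype J] {d : ℕ}
    (a : Matrix (Fin d) J K) (Q : Matrix J (Fin d) K) (h : (a * Q).det ≠ 0) :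
    ∃ r : Fin d → J, (∀ j, a j (r j) ≠ 0) ∧ (Q.submatrix r id).det ≠ 0 := by
  classical
  by_contra! h0
  apply h
  have h1 : (a * Q).det =
      Matrix.detRowAlternating.toMultilinearMap fun j => ∑ i, a j i • Q i := by
    change Matrix.det _ = Matrix.det _
    congr 1
    ext j k
    simp [Matrix.mul_apply]
  rw [h1, MultilinearMap.map_sum]
  refine Finset.sum_eq_zero fun r _ => ?_
  rw [MultilinearMap.map_smul_univ]
  by_cases hr : ∀ j, a j (r j) ≠ 0
  · have : Matrix.detRowAlternating.toMultilinearMap (fun j => Q (r j)) = 0 := h0 r hr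
    rw [this, smul_zero]
  · push Not at hr
    obtain ⟨j, hj⟩ := hr
    rw [Finset.prod_eq_zero (Finset.mem_univ j) hj, zero_smul]

variable {K V I n : Type} [Field K] [AddCommGroup V] [Module K V] {d : ℕ}
  {W : I → Submodule K V} {c : n → I}

/-- The coordinates of the endomorphisms `u k` in the basis `b`. -/
noncomputable def coordMatrix (b : Basis n K V) (u : Fin d → End K V) : Matrix (n × n) (Fin d) K :=
  fun J k => b.repr (u k (b J.2)) J.1

/-- The sets of coordinates for which the Plücker coordinate of the span of `u` is nonzero. -/
def admissible (b : Basis n K V) (u : Fin d → End K V) : Set (Fin d → n × n) :=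
  {r | ((coordMatrix b u).submatrix r id).det ≠ 0}

/-- The weight of a set of coordinates. -/
def coordWeight (w : n → ℝ) (r : Fin d → n × n) : ℝ :=
  ∑ j, (w (r j).1 - w (r j).2)

theorem continuous_coordWeight (r : Fin d → n × n) :
    Continuous fun w : n → ℝ => coordWeight w r := by
  unfold coordWeight
  fun_prop

theorem coordWeight_add (w w' : n → ℝ) (r : Fin d → n × n) :
    coordWeight (w + w') r = coordWeight w r + coordWeight w' r := by
  simp only [coordWeight, ← Finset.sum_add_distrib, Pi.add_apply]
  exact Finset.sum_congr rfl fun _ _ => by ring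

theorem coordWeight_smul (a : ℝ) (w : n → ℝ) (r : Fin d → n × n) :
    coordWeight (a • w) r = a * coordWeight w r := by
  simp only [coordWeight, Finset.mul_sum, Pi.smul_apply, smul_eq_mul]
  exact Finset.sum_congr rfl fun _ _ => by ring

theorem admissible_nonempty [Fintype n] (b : Basis n K V) {u : Fin d → End K V}
    (hu : LinearIndependent K u) : (admissible b u).Nonempty := by
  classical
  have hfd : FiniteDimensional K V := .of_basis b
  obtain ⟨g, hg⟩ := LinearMap.exists_leftInverse_of_injective
    (Finsupp.linearCombination K u) (LinearMap.ker_eq_bot.mpr hu)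
  have hg' : ∀ k, g (u k) = Finsupp.single k 1 := fun k => by
    simpa using LinearMap.congr_fun hg (Finsupp.single k 1)
  have hB : ∀ x J, (b.linearMap b).repr x J = b.repr (x (b J.2)) J.1 := fun x J => by
    rw [Basis.linearMap_repr_apply]
    exact LinearMap.toMatrix_apply b b x J.1 J.2
  obtain ⟨r, -, hr⟩ := Matrix.exists_submatrix_det_ne_zero
    (Matrix.of fun j J => g (b.linearMap b J) j) (coordMatrix b u) (by
      have : (Matrix.of fun j J => g (b.linearMap b J) j) * coordMatrix b u =
        (1 : Matrix (Fin d) (Fin d) K) := by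
        ext j k
        rw [Matrix.mul_apply]
        have h1 := congrArg (fun x => g x j) ((b.linearMap b).sum_repr (u k))
        simp only [map_sum, map_smul, hg', Finsupp.finsetSum_apply, Finsupp.smul_apply,
          smul_eq_mul, hB] at h1
        rw [Finsupp.single_apply] at h1
        rw [Matrix.one_apply, if_congr eq_comm rfl rfl, ← h1]
        exact Finset.sum_congr rfl fun J _ => mul_comm _ _
      rw [this]
      simp)
  exact ⟨r, hr⟩

/-- Lower bounds for the weights of the admissible sets of coordinates only depend on the norm
defined by the weighted basis. -/
theorem WeightLE.exists_admissible [Fintype n] {b b' : Basis n K V} {w w' : n → ℝ}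
    (h : WeightLE b w b' w')
    (h' : WeightLE b' w' b w) (u : Fin d → End K V) {r' : Fin d → n × n}
    (hr' : r' ∈ admissible b' u) :
    ∃ r ∈ admissible b u, coordWeight w r ≤ coordWeight w' r' := by
  have hmul : (coordMatrix b' u).submatrix r' id =
      (Matrix.of fun j (J : n × n) => b'.repr (b J.1) (r' j).1 * b.repr (b' (r' j).2) J.2) *
        coordMatrix b u := by
    ext j k
    simp only [Matrix.submatrix_apply, id, coordMatrix, Matrix.mul_apply, Matrix.of_apply]
    rw [Fintype.sum_prod_type]
    conv_lhs => rw [← b.sum_repr (b' (r' j).2), map_sum]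
    simp only [map_smul, map_sum, Finsupp.finsetSum_apply, Finsupp.smul_apply, smul_eq_mul]
    rw [Finset.sum_comm]
    refine Finset.sum_congr rfl fun t _ => ?_
    conv_lhs => rw [← b.sum_repr (u k (b t))]
    simp only [map_smul, map_sum, Finsupp.finsetSum_apply, Finsupp.smul_apply, smul_eq_mul,
      Finset.mul_sum]
    exact Finset.sum_congr rfl fun s _ => by ring
  have hdet : ((coordMatrix b' u).submatrix r' id).det ≠ 0 := hr'
  rw [hmul] at hdet
  obtain ⟨r, hr, hr1⟩ := Matrix.exists_submatrix_det_ne_zero _ _ hdet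
  refine ⟨r, hr1, Finset.sum_le_sum fun j _ => ?_⟩
  have := mul_ne_zero_iff.mp (hr j)
  have h1 := h _ _ this.1
  have h2 := h' _ _ this.2
  linarith

theorem admissible_map_subset (b : Basis n K V) {u : Fin d → End K V} (h : V ≃ₗ[K] V)
    (hu : ∀ k, conjEnd h.symm (u k) ∈ Submodule.span K (Set.range u)) :
    admissible (b.map h) u ⊆ admissible b u := by
  have hC : ∀ k, ∃ C : Fin d → K, ∑ l, C l • u l = conjEnd h.symm (u k) := fun k =>
    Submodule.mem_span_range_iff_exists_fun K |>.mp (hu k)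
  choose C hC using hC
  intro r hr hr0
  apply hr
  have : (coordMatrix (b.map h) u).submatrix r id =
      (coordMatrix b u).submatrix r id * Matrix.of fun l k => C k l := by
    ext j k
    simp only [Matrix.submatrix_apply, id, coordMatrix, Matrix.mul_apply, Matrix.of_apply,
      Basis.map_apply, Basis.map_repr, LinearEquiv.trans_apply]
    have h1 := congrArg (fun x => b.repr (x (b (r j).2)) (r j).1) (hC k)
    simp only [LinearMap.sum_apply, LinearMap.smul_apply, map_sum, map_smul,
      Finsupp.finsetSum_apply, Finsupp.smul_apply, smul_eq_mul] at h1
    have h2 : conjEnd h.symm (u k) (b (r j).2) = h.symm (u k (h (b (r j).2))) := rfl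
    rw [h2] at h1
    rw [← h1]
    exact Finset.sum_congr rfl fun _ _ => mul_comm _ _
  rw [this, Matrix.det_mul, hr0, zero_mul]

end Kempf

section Kempf

variable {K V I n : Type} [Field K] [AddCommGroup V] [Module K V] [Fintype n] {d : ℕ}
  {W : I → Submodule K V} {c : n → I}

theorem WeightLE.trans {b b' b'' : Basis n K V} {w w' w'' : n → ℝ} (h : WeightLE b w b' w')
    (h' : WeightLE b' w' b'' w'') : WeightLE b w b'' w'' := by
  intro s s' hs
  rw [← b'.sum_repr (b s), map_sum, Finsupp.finsetSum_apply] at hs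
  obtain ⟨t, -, ht⟩ := Finset.exists_ne_zero_of_sum_ne_zero hs
  rw [map_smul, Finsupp.smul_apply, smul_eq_mul] at ht
  exact (h _ _ (left_ne_zero_of_mul ht)).trans (h' _ _ (right_ne_zero_of_mul ht))

/-- The weight vectors of norm one with vanishing sum on every block. -/
def unitWeights (c : n → I) [DecidableEq I] : Set (n → ℝ) :=
  {w | ∑ s, w s ^ 2 = 1 ∧ ∀ i, ∑ s with c s = i, w s = 0}

theorem isCompact_unitWeights [DecidableEq I] (c : n → I) : IsCompact (unitWeights c) := by
  refine IsCompact.of_isClosed_subset (isCompact_closedBall (0 : n → ℝ) 1) ?_ ?_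
  · refine (isClosed_eq (by fun_prop) continuous_const).and ?_
    simp only [Set.ofPred_forall]
    exact isClosed_iInter fun i => isClosed_eq (by fun_prop) continuous_const
  · rintro w ⟨hw, -⟩
    rw [mem_closedBall_zero_iff, pi_norm_le_iff_of_nonneg zero_le_one]
    intro s
    have : w s ^ 2 ≤ 1 := hw ▸ Finset.single_le_sum (f := fun s => w s ^ 2)
      (fun _ _ => sq_nonneg _) (Finset.mem_univ s)
    rw [Real.norm_eq_abs]
    exact (sq_le_one_iff_abs_le_one _).mp this

theorem exists_max_lowerBound [DecidableEq I] {u : Fin d → End K V} (hu : LinearIndependent K u)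
    {b : Basis n K V} (hb : IsAdapted W c b) (hne : (unitWeights c).Nonempty) :
    ∃ b₀ : Basis n K V, IsAdapted W c b₀ ∧ ∃ w₀ ∈ unitWeights c, ∃ m₀ : ℝ,
      (∀ r ∈ admissible b₀ u, m₀ ≤ coordWeight w₀ r) ∧
      ∀ b : Basis n K V, IsAdapted W c b → ∀ w ∈ unitWeights c, ∀ m : ℝ,
        (∀ r ∈ admissible b u, m ≤ coordWeight w r) → m ≤ m₀ := by
  classical
  have key : ∀ a : Set (Fin d → n × n), ∃ w ∈ unitWeights c, ∃ m : ℝ, a.Nonempty →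
      (∀ r ∈ a, m ≤ coordWeight w r) ∧ ∀ w' ∈ unitWeights c, ∀ m',
        (∀ r ∈ a, m' ≤ coordWeight w' r) → m' ≤ m := by
    intro a
    rcases a.eq_empty_or_nonempty with ha | ha
    · exact ⟨_, hne.some_mem, 0, fun h => by simp [ha] at h⟩
    · have ha' : a.toFinite.toFinset.Nonempty := by simpa using ha
      obtain ⟨w, hw, hmax⟩ := (isCompact_unitWeights c).exists_isMaxOn hne
        (f := fun w => a.toFinite.toFinset.inf' ha' (coordWeight w))
        (Continuous.finset_inf'_apply ha' fun r _ => continuous_coordWeight r).continuousOn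
      refine ⟨w, hw, a.toFinite.toFinset.inf' ha' (coordWeight w),
        fun _ => ⟨fun r hr => Finset.inf'_le _ (a.toFinite.mem_toFinset.mpr hr), ?_⟩⟩
      intro w' hw' m' hm'
      refine le_trans ?_ (hmax hw')
      simp only [Finset.le_inf'_iff, Set.Finite.mem_toFinset]
      exact hm'
  choose w hw m hm using key
  obtain ⟨_, ⟨b₀, hb₀, rfl⟩, hmax⟩ := Set.exists_max_image
    ((fun b => admissible b u) '' {b : Basis n K V | IsAdapted W c b}) m (Set.toFinite _)
    ⟨_, b, hb, rfl⟩
  refine ⟨b₀, hb₀, _, hw _, _, (hm _ (admissible_nonempty b₀ hu)).1, ?_⟩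
  intro b hb w' hw' m' hm'
  exact ((hm _ (admissible_nonempty b hu)).2 w' hw' m' hm').trans (hmax _ ⟨b, hb, rfl⟩)

theorem unitWeights_of_perm [DecidableEq I] {w w' : n → ℝ} (hw : w ∈ unitWeights c)
    (σ : Equiv.Perm n) (hσ : ∀ s, c (σ s) = c s) (h : ∀ s, w' (σ s) = w s) :
    w' ∈ unitWeights c := by
  refine ⟨?_, fun i => ?_⟩
  · rw [← Equiv.sum_comp σ]
    simpa [h] using hw.1
  · rw [← hw.2 i, Finset.sum_filter, Finset.sum_filter, ← Equiv.sum_comp σ]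
    simp [h, hσ]

theorem eq_of_max_lowerBound {w₁ w₂ : n → ℝ} (h₁ : ∑ s, w₁ s ^ 2 = 1) (h₂ : ∑ s, w₂ s ^ 2 = 1)
    (h : 4 ≤ ∑ s, (w₁ s + w₂ s) ^ 2) : w₁ = w₂ := by
  have h3 : ∑ s, (w₁ s - w₂ s) ^ 2 = 0 := by
    refine le_antisymm ?_ (Finset.sum_nonneg fun _ _ => sq_nonneg _)
    have : ∑ s, (w₁ s - w₂ s) ^ 2 + ∑ s, (w₁ s + w₂ s) ^ 2 =
        2 * ∑ s, w₁ s ^ 2 + 2 * ∑ s, w₂ s ^ 2 := by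
      simp only [Finset.mul_sum, ← Finset.sum_add_distrib]
      exact Finset.sum_congr rfl fun _ _ => by ring
    linarith
  rw [Finset.sum_eq_zero_iff_of_nonneg fun _ _ => sq_nonneg _] at h3
  funext s
  have := pow_eq_zero_iff (two_ne_zero) |>.mp (h3 s (Finset.mem_univ s))
  linarith

theorem smul_mem_unitWeights [DecidableEq I] {w : n → ℝ}
    (hw : ∀ i, ∑ s with c s = i, w s = 0) (h0 : 0 < ∑ s, w s ^ 2) :
    (√(∑ s, w s ^ 2))⁻¹ • w ∈ unitWeights c := by
  refine ⟨?_, fun i => ?_⟩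
  · simp only [Pi.smul_apply, smul_eq_mul, mul_pow, inv_pow, ← Finset.mul_sum, Real.sq_sqrt h0.le]
    exact inv_mul_cancel₀ h0.ne'
  · simp only [Pi.smul_apply, smul_eq_mul, ← Finset.mul_sum, hw, mul_zero]

/-- The optimal weighted basis is unique as a norm. -/
theorem weightLE_of_max_lowerBound [DecidableEq I] (hW : iSupIndep W) (hW' : iSup W = ⊤)
    {u : Fin d → End K V} (hu : LinearIndependent K u) {m₀ : ℝ} (hm₀ : 0 < m₀)
    (hmax : ∀ b : Basis n K V, IsAdapted W c b → ∀ w ∈ unitWeights c, ∀ m : ℝ,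
        (∀ r ∈ admissible b u, m ≤ coordWeight w r) → m ≤ m₀)
    {b b' : Basis n K V} (hb : IsAdapted W c b) (hb' : IsAdapted W c b') {w w' : n → ℝ}
    (hw : w ∈ unitWeights c) (hw' : w' ∈ unitWeights c)
    (h : ∀ r ∈ admissible b u, m₀ ≤ coordWeight w r)
    (h' : ∀ r ∈ admissible b' u, m₀ ≤ coordWeight w' r) : WeightLE b w b' w' := by
  obtain ⟨b'', hb'', w₁, w₂, h1, h2, h3, h4⟩ := exists_common_basis hW hW' hb hb' w w'
  obtain ⟨σ, hσ, hσ'⟩ := h1.exists_perm hW hb h2 hb''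
  obtain ⟨τ, hτ, hτ'⟩ := h3.exists_perm hW hb' h4 hb''
  have hw₁ := unitWeights_of_perm hw σ hσ hσ'
  have hw₂ := unitWeights_of_perm hw' τ hτ hτ'
  have hlow : ∀ r ∈ admissible b'' u, 2 * m₀ ≤ coordWeight (w₁ + w₂) r := by
    intro r hr
    obtain ⟨r₁, hr₁, hle₁⟩ := h1.exists_admissible h2 u hr
    obtain ⟨r₂, hr₂, hle₂⟩ := h3.exists_admissible h4 u hr
    rw [coordWeight_add]
    linarith [h _ hr₁, h' _ hr₂]
  have hpos : 0 < ∑ s, (w₁ + w₂) s ^ 2 := by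
    refine (Finset.sum_nonneg fun _ _ => sq_nonneg _).lt_of_ne' fun h0 => ?_
    rw [Finset.sum_eq_zero_iff_of_nonneg fun _ _ => sq_nonneg _] at h0
    have h0' : w₁ + w₂ = (0 : ℝ) • w₁ := by
      funext s
      simpa using h0 s (Finset.mem_univ s)
    obtain ⟨r, hr⟩ := admissible_nonempty b'' hu
    have := hlow r hr
    rw [h0', coordWeight_smul] at this
    linarith
  have hsq := Real.sqrt_pos.mpr hpos
  have hle := hmax b'' hb'' _ (smul_mem_unitWeights (fun i => by
    simp only [Pi.add_apply, Finset.sum_add_distrib, hw₁.2, hw₂.2, add_zero]) hpos)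
    ((√(∑ s, (w₁ + w₂) s ^ 2))⁻¹ * (2 * m₀)) fun r hr => by
      rw [coordWeight_smul]
      exact mul_le_mul_of_nonneg_left (hlow r hr) (inv_nonneg.mpr hsq.le)
  rw [inv_mul_le_iff₀ hsq] at hle
  have h2s : 2 ≤ √(∑ s, (w₁ + w₂) s ^ 2) := le_of_mul_le_mul_right hle hm₀
  have heq := eq_of_max_lowerBound hw₁.1 hw₂.1 (by
    have := (Real.le_sqrt' two_pos).mp h2s
    simp only [Pi.add_apply] at this
    linarith)
  exact (heq ▸ h1).trans h4

/-- A subspace of endomorphisms stable under a group acting irreducibly on the blocks has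
nonpositive degree for the filtration defined by any weighted basis adapted to the blocks. -/
theorem sum_degree_nonpos (hW : iSupIndep W) (hW' : iSup W = ⊤)
    (H : Subgroup (V ≃ₗ[K] V)) (hH : ∀ i, ∀ h ∈ H, ∀ v ∈ W i, h v ∈ W i)
    (hirr : ∀ i, ∀ Z ≤ W i, (∀ h ∈ H, ∀ v ∈ Z, h v ∈ Z) → Z = ⊥ ∨ Z = W i)
    {u : Fin d → End K V} (hu : LinearIndependent K u)
    (hU : ∀ h ∈ H, ∀ k, conjEnd h (u k) ∈ Submodule.span K (Set.range u))
    {b : Basis n K V} (hb : IsAdapted W c b) (w : n → ℝ) [DecidableEq I]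
    (hw : ∀ i, ∑ s with c s = i, w s = 0) (t : Fin d → ℝ)
    (ht : ∀ j s s', b.repr (u j (b s')) s ≠ 0 → t j ≤ w s - w s') : ∑ j, t j ≤ 0 := by
  classical
  by_contra! hpos
  have hlow : ∀ r ∈ admissible b u, ∑ j, t j ≤ coordWeight w r := by
    intro r hr
    have hr' : ((coordMatrix b u).submatrix r id).det ≠ 0 := hr
    rw [Matrix.det_apply] at hr'
    obtain ⟨σ, -, hσ⟩ := Finset.exists_ne_zero_of_sum_ne_zero hr'
    have hσ' : ∏ j, (coordMatrix b u).submatrix r id (σ j) j ≠ 0 := fun h0 => hσ (by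
      rw [h0, smul_zero])
    rw [Finset.prod_ne_zero_iff] at hσ'
    rw [coordWeight, ← Equiv.sum_comp σ fun j => w (r j).1 - w (r j).2]
    exact Finset.sum_le_sum fun j _ => ht j _ _ (hσ' j (Finset.mem_univ j))
  have hw0 : 0 < ∑ s, w s ^ 2 := by
    refine (Finset.sum_nonneg fun _ _ => sq_nonneg _).lt_of_ne' fun h0 => ?_
    rw [Finset.sum_eq_zero_iff_of_nonneg fun _ _ => sq_nonneg _] at h0
    obtain ⟨r, hr⟩ := admissible_nonempty b hu
    have := hlow r hr
    have hw0 : ∀ s, w s = 0 := fun s => by simpa using h0 s (Finset.mem_univ s)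
    simp only [coordWeight, hw0, sub_zero, Finset.sum_const_zero] at this
    linarith
  obtain ⟨b₀, hb₀, w₀, hw₀, m₀, hlow₀, hmax⟩ :=
    exists_max_lowerBound hu hb ⟨_, smul_mem_unitWeights hw hw0⟩
  have hm₀ : 0 < m₀ := by
    have hs := Real.sqrt_pos.mpr hw0
    refine (mul_pos (inv_pos.mpr hs) hpos).trans_le
      (hmax b hb _ (smul_mem_unitWeights hw hw0) _ fun r hr => ?_)
    rw [coordWeight_smul]
    exact mul_le_mul_of_nonneg_left (hlow r hr) (inv_nonneg.mpr hs.le)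
  have hstab : ∀ h ∈ H, ∀ s s', b₀.repr (h (b₀ s)) s' ≠ 0 → w₀ s ≤ w₀ s' := by
    intro h hh s s' hs
    have hle := weightLE_of_max_lowerBound hW hW' hu hm₀ hmax hb₀
      (b' := b₀.map h⁻¹) (fun s => hH _ _ (H.inv_mem hh) _ (hb₀ s)) hw₀ hw₀ hlow₀
      fun r hr => hlow₀ r (admissible_map_subset b₀ h⁻¹ (fun k => hU _ hh k) hr)
    exact hle s s' hs
  have hconst : ∀ s, w₀ s = 0 := by
    intro s₀
    obtain ⟨s₁, hs₁, hs₁'⟩ := Finset.exists_max_image (Finset.univ.filter fun s => c s = c s₀) w₀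
      ⟨s₀, by simp⟩
    simp only [Finset.mem_filter, Finset.mem_univ, true_and] at hs₁ hs₁'
    have hZ := hirr (c s₀) (Submodule.span K (b₀ '' {s | c s = c s₀ ∧ w₀ s = w₀ s₁}))
      (Submodule.span_le.mpr (by
        rintro _ ⟨s, ⟨hs, -⟩, rfl⟩
        exact hs ▸ hb₀ s)) (by
        intro h hh v hv
        induction hv using Submodule.span_induction with
        | zero => simp
        | add x y _ _ hx hy => rw [map_add]; exact add_mem hx hy
        | smul a x _ hx => rw [map_smul]; exact Submodule.smul_mem _ _ hx
        | mem x hx =>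
          obtain ⟨s, ⟨hs, hs'⟩, rfl⟩ := hx
          rw [Basis.mem_span_image]
          intro s' hs''
          rw [Finset.mem_coe, Finsupp.mem_support_iff] at hs''
          have h1 := hb₀.eq_of_repr_ne_zero hW (hH _ h hh _ (hb₀ s)) hs''
          exact ⟨h1.trans hs, le_antisymm (hs₁' s' (h1.trans hs)) (hs' ▸ hstab h hh _ _ hs'')⟩)
    have hZ1 : Submodule.span K (b₀ '' {s | c s = c s₀ ∧ w₀ s = w₀ s₁}) = W (c s₀) := by
      refine hZ.resolve_left fun h0 => b₀.ne_zero s₁ ?_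
      rw [← Submodule.mem_bot K, ← h0]
      exact Submodule.subset_span ⟨s₁, ⟨hs₁, rfl⟩, rfl⟩
    have hall : ∀ s, c s = c s₀ → w₀ s = w₀ s₁ := by
      intro s hs
      have := hb₀ s
      rw [hs, ← hZ1, Basis.mem_span_image] at this
      exact (this (by simp)).2
    have hsum := hw₀.2 (c s₀)
    rw [Finset.sum_congr rfl fun s hs => hall s (by simpa using hs), Finset.sum_const,
      nsmul_eq_mul, mul_eq_zero] at hsum
    rw [hall s₀ rfl]
    refine hsum.resolve_left ?_
    rw [Nat.cast_eq_zero, Finset.card_eq_zero, ← Ne, ← Finset.nonempty_iff_ne_empty]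
    exact ⟨s₀, by simp⟩
  have := hw₀.1
  simp [hconst] at this

end Kempf

section JordanChain

open Polynomial

variable {K V : Type} [Field K] [AddCommGroup V] [Module K V] [FiniteDimensional K V]

theorem exists_basis_quotient_X_pow (K : Type) [Field K] (k : ℕ) :
    ∃ B : Basis (Fin k) K (K[X] ⧸ Submodule.span K[X] {(X : K[X]) ^ k}),
      ∀ j, B j = Submodule.Quotient.mk (X ^ (j : ℕ)) := by
  let B : Basis (Fin k) K (AdjoinRoot ((X : K[X]) ^ k)) :=
    (AdjoinRoot.powerBasis' (monic_X_pow k)).basis.reindex (finCongr (by simp))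
  have hB : ∀ j, B j = AdjoinRoot.mk _ (X ^ (j : ℕ)) := fun j => by
    simp [B, Basis.reindex_apply]
  exact ⟨B, hB⟩

theorem exists_jordan_chains {e : End K V} (he : IsNilpotent e) :
    ∃ (d : ℕ) (k : Fin d → ℕ) (b : Basis (Σ i, Fin (k i)) K V), ∀ i (j : Fin (k i)),
      e (b ⟨i, j⟩) = if h : j.1 + 1 < k i then b ⟨i, ⟨j.1 + 1, h⟩⟩ else 0 := by
  classical
  have htors : Module.IsTorsion' (AEval' e) (Submonoid.powers (X : K[X])) := by
    obtain ⟨m, hm⟩ := he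
    intro x
    refine ⟨⟨X ^ m, m, rfl⟩, ?_⟩
    obtain ⟨x, rfl⟩ := (AEval'.of e).surjective x
    change (X ^ m : K[X]) • AEval'.of e x = _
    rw [AEval'.X_pow_smul_of, hm]
    simp
  obtain ⟨d, k, ⟨φ⟩⟩ := Module.torsion_by_prime_power_decomposition irreducible_X htors
  choose B hB using fun i => exists_basis_quotient_X_pow K (k i)
  let b := ((DFinsupp.basis B).map (φ.restrictScalars K).symm).map (AEval'.of e).symm
  refine ⟨d, k, b, fun i j => ?_⟩
  have hb : ∀ s, φ (AEval'.of e (b s)) = DFinsupp.single s.1 (B s.1 s.2) := by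
    intro s
    simp only [b, Basis.map_apply, LinearEquiv.restrictScalars_symm_apply,
      LinearEquiv.apply_symm_apply]
    apply (DFinsupp.basis B).repr.injective
    rw [Basis.repr_self]
    apply sigmaFinsuppEquivDFinsupp.injective
    simp [DFinsupp.basis]
  apply (AEval'.of e).injective
  apply φ.injective
  rw [← AEval'.X_smul_of, map_smul, hb]
  have h1 : (X : K[X]) •
      DFinsupp.single (β := fun i => K[X] ⧸ Submodule.span K[X] {(X : K[X]) ^ k i}) i (B i j) =
        DFinsupp.single i ((X : K[X]) • B i j) := (DFinsupp.single_smul ..).symm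
  refine h1.trans ?_
  rw [hB, ← Submodule.Quotient.mk_smul, smul_eq_mul, ← pow_succ']
  split_ifs with h
  · rw [hb, hB]
  · have : k i = j + 1 := by omega
    rw [map_zero, map_zero, (Submodule.Quotient.mk_eq_zero _).mpr, DFinsupp.single_zero]
    rw [← this]
    exact Submodule.mem_span_singleton_self _

theorem sum_fin_two_mul_sub (k : ℕ) : ∑ j : Fin k, (2 * (j : ℤ) - (k - 1)) = 0 := by
  have h : ∑ j : Fin k, (2 * (j : ℤ) - (k - 1)) = -∑ j : Fin k, (2 * (j : ℤ) - (k - 1)) := by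
    conv_lhs => rw [← Equiv.sum_comp Fin.revPerm]
    rw [← Finset.sum_neg_distrib]
    refine Finset.sum_congr rfl fun j _ => ?_
    rw [Fin.revPerm_apply, Fin.val_rev]
    omega
  omega

/-- The Jacobson-Morozov theorem for linear Lie algebras, block by block. -/
theorem exists_jordan_basis {I : Type} [Fintype I] [DecidableEq I] {W : I → Submodule K V}
    (hW : iSupIndep W) (hW' : iSup W = ⊤) {e : End K V} (he : IsNilpotent e)
    (heW : ∀ i, ∀ x ∈ W i, e x ∈ W i) :
    ∃ (n : Type) (_ : Fintype n) (c : n → I) (b : Basis n K V) (a : n → ℤ) (f : End K V),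
      IsAdapted W c b ∧ (∀ s s', b.repr (e (b s)) s' ≠ 0 → a s' = a s + 2) ∧
      (∀ s s', b.repr (f (b s)) s' ≠ 0 → a s' = a s - 2) ∧ (∀ i, ∀ x ∈ W i, f x ∈ W i) ∧
      (∀ s, e (f (b s)) - f (e (b s)) = (a s : K) • b s) ∧
      (∀ s, |a s| + 1 ≤ finrank K (W (c s))) ∧ ∀ i, ∑ s with c s = i, a s = 0 := by
  have hnil : ∀ i, IsNilpotent (e.restrict (heW i)) := fun i => by
    obtain ⟨m, hm⟩ := he
    refine ⟨m, ?_⟩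
    rw [Module.End.pow_restrict]
    ext x
    simp [hm]
  choose d k B hB using fun i => exists_jordan_chains (hnil i)
  have hint : DirectSum.IsInternal W :=
    (DirectSum.isInternal_submodule_iff_iSupIndep_and_iSup_eq_top W).mpr ⟨hW, hW'⟩
  let n := Σ i, Σ q : Fin (d i), Fin (k i q)
  let b : Basis n K V := hint.collectedBasis B
  have hb : ∀ s : n, b s = B s.1 s.2 := fun s => congrFun (hint.collectedBasis_coe B) s
  have heb : ∀ i q (j : Fin (k i q)), e (b ⟨i, q, j⟩) =
      if h : j.1 + 1 < k i q then b ⟨i, q, ⟨j.1 + 1, h⟩⟩ else 0 := by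
    intro i q j
    have := congrArg Subtype.val (hB i q j)
    rw [hb]
    refine Eq.trans this ?_
    split_ifs <;> simp [hb]
  let f : End K V := b.constr K fun s =>
    if h : 0 < s.2.2.1 then
      ((s.2.2.1 * (k s.1 s.2.1 - s.2.2.1) : ℤ) : K) • b ⟨s.1, s.2.1, ⟨s.2.2.1 - 1, by omega⟩⟩
    else 0
  have hfb : ∀ s : n, f (b s) = if h : 0 < s.2.2.1 then
      ((s.2.2.1 * (k s.1 s.2.1 - s.2.2.1) : ℤ) : K) • b ⟨s.1, s.2.1, ⟨s.2.2.1 - 1, by omega⟩⟩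
    else 0 := fun s => by simp only [f, Basis.constr_basis]
  have hadapt : IsAdapted W (fun s : n => s.1) b := fun s => by
    rw [hb]
    exact Subtype.mem _
  refine ⟨n, inferInstance, fun s => s.1, b, fun s => 2 * (s.2.2.1 : ℤ) - (k s.1 s.2.1 - 1), f,
    hadapt, ?_, ?_, ?_, ?_, ?_, ?_⟩
  · rintro ⟨i, q, j⟩ s' hs
    rw [heb] at hs
    split_ifs at hs with h
    · rw [Basis.repr_self, Finsupp.single_apply_ne_zero] at hs
      rw [hs.1]
      push_cast
      ring
    · simp at hs
  · rintro s s' hs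
    rw [hfb] at hs
    split_ifs at hs with h
    · rw [map_smul, Basis.repr_self, Finsupp.smul_single, Finsupp.single_apply_ne_zero] at hs
      rw [hs.1]
      push_cast [Nat.cast_sub (show 1 ≤ s.2.2.1 from h)]
      ring
    · simp at hs
  · intro i x hx
    rw [← b.sum_repr x, map_sum]
    refine sum_mem fun s _ => ?_
    rw [map_smul]
    by_cases h0 : b.repr x s = 0
    · simp [h0]
    have hsi := hadapt.eq_of_repr_ne_zero hW hx h0
    refine Submodule.smul_mem _ _ ?_
    rw [hfb]
    split_ifs with h
    · refine Submodule.smul_mem _ _ ?_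
      rw [← hsi]
      exact hadapt ⟨s.1, s.2.1, ⟨s.2.2.1 - 1, by omega⟩⟩
    · exact zero_mem _
  · rintro ⟨i, q, j⟩
    have h1 : e (f (b ⟨i, q, j⟩)) = ((j.1 * (k i q - j.1) : ℤ) : K) • b ⟨i, q, j⟩ := by
      rw [hfb]
      dsimp only
      split_ifs with h
      · rw [map_smul, heb, dif_pos (by simp only; omega)]
        have h1 : j.1 - 1 + 1 = j.1 := by omega
        simp only [h1]
      · have : j.1 = 0 := by omega
        simp [this]
    have h2 : f (e (b ⟨i, q, j⟩)) =
        (((j.1 + 1) * (k i q - (j.1 + 1)) : ℤ) : K) • b ⟨i, q, j⟩ := by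
      rw [heb]
      split_ifs with h
      · rw [hfb, dif_pos (by simp)]
        simp
      · have : (k i q : ℤ) - (j.1 + 1) = 0 := by omega
        rw [this]
        simp
    rw [h1, h2, ← sub_smul, ← Int.cast_sub]
    congr 2
    ring
  · rintro ⟨i, q, j⟩
    rw [finrank_eq_card_basis (B i), Fintype.card_sigma]
    have : k i q ≤ ∑ q, Fintype.card (Fin (k i q)) := by
      simpa using Finset.single_le_sum (f := k i) (fun _ _ => Nat.zero_le _) (Finset.mem_univ q)
    have hj := j.2
    have h1 : |2 * (j.1 : ℤ) - (k i q - 1)| ≤ k i q - 1 := by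
      rw [abs_le]
      constructor <;> omega
    dsimp only
    omega
  · intro i
    rw [Finset.sum_filter, Fintype.sum_sigma]
    refine Finset.sum_eq_zero fun i' _ => ?_
    dsimp only
    split_ifs with h
    · rw [Fintype.sum_sigma]
      exact Finset.sum_eq_zero fun q _ => sum_fin_two_mul_sub _
    · simp

end JordanChain

section GradedMatrices

attribute [local instance] LieRing.ofAssociativeRing LieAlgebra.ofAssociativeAlgebra

variable {K I n A : Type} [Field K] [AddCommGroup A]

/-- The matrices homogeneous of degree `ζ` for the weights `κ`, preserving the blocks. -/
def gradedPart (K : Type) [Field K] (c : n → I) (κ : n → A) (ζ : A) :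
    Submodule K (Matrix n n K) where
  carrier := {x | ∀ s t, x s t ≠ 0 → c s = c t ∧ κ s = κ t + ζ}
  add_mem' := fun {x y} hx hy s t h => by
    by_cases h0 : x s t = 0
    · exact hy s t (by simpa [h0] using h)
    · exact hx s t h0
  zero_mem' := fun s t h => by simp at h
  smul_mem' := fun a x hx s t h => hx s t (right_ne_zero_of_mul (by simpa using h))

variable {c : n → I} {κ : n → A}

theorem mul_mem_gradedPart [Fintype n] {ζ ζ' : A} {x y : Matrix n n K}
    (hx : x ∈ gradedPart K c κ ζ) (hy : y ∈ gradedPart K c κ ζ') :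
    x * y ∈ gradedPart K c κ (ζ + ζ') := by
  intro s t h
  rw [Matrix.mul_apply] at h
  obtain ⟨r, -, hr⟩ := Finset.exists_ne_zero_of_sum_ne_zero h
  obtain ⟨h1, h2⟩ := hx s r (left_ne_zero_of_mul hr)
  obtain ⟨h3, h4⟩ := hy r t (right_ne_zero_of_mul hr)
  exact ⟨h1.trans h3, by rw [h2, h4]; abel⟩

theorem lie_mem_gradedPart [Fintype n] {ζ ζ' : A} {x y : Matrix n n K}
    (hx : x ∈ gradedPart K c κ ζ) (hy : y ∈ gradedPart K c κ ζ') :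
    ⁅x, y⁆ ∈ gradedPart K c κ (ζ + ζ') := by
  rw [Ring.lie_def]
  exact sub_mem (mul_mem_gradedPart hx hy) (add_comm ζ ζ' ▸ mul_mem_gradedPart hy hx)

theorem isGradedSl2_gradedPart [Fintype n] [DecidableEq n] {p : ℕ} {deg : A →+ ℤ} {ι : A}
    {e f : Matrix n n K} (hι : deg ι = 2) (he : e ∈ gradedPart K c κ ι)
    (hf : f ∈ gradedPart K c κ (-ι))
    (hef : ⁅e, f⁆ = Matrix.diagonal fun s => (deg (κ s) : K))
    (hb : ∀ s t, c s = c t → deg (κ s) - deg (κ t) < p) :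
    IsGradedSl2 p deg ι (gradedPart K c κ) (LieAlgebra.ad K (Matrix n n K) e)
      (LieAlgebra.ad K (Matrix n n K) f) where
  deg_ι := hι
  e_mem ζ x hx := by
    rw [add_comm]
    exact lie_mem_gradedPart he hx
  f_mem ζ x hx := by
    rw [sub_eq_add_neg, add_comm]
    exact lie_mem_gradedPart hf hx
  comm ζ x hx := by
    simp only [LieAlgebra.ad_apply]
    rw [leibniz_lie, add_sub_cancel_right, hef, Ring.lie_def]
    ext s t
    rw [Matrix.sub_apply, Matrix.diagonal_mul, Matrix.mul_diagonal, Matrix.smul_apply, smul_eq_mul]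
    by_cases h : x s t = 0
    · simp [h]
    · rw [(hx s t h).2, map_add]
      push_cast
      ring
  bound ζ hζ := by
    rw [eq_bot_iff]
    intro x hx
    rw [Submodule.mem_bot]
    ext s t
    by_contra h
    obtain ⟨h1, h2⟩ := hx s t h
    have h3 := congrArg deg h2
    rw [map_add] at h3
    have h4 := hb s t h1
    have h5 := hb t s h1.symm
    rcases le_abs.mp hζ with h6 | h6 <;> omega

end GradedMatrices

section Purity

attribute [local instance] LieRing.ofAssociativeRing LieAlgebra.ofAssociativeAlgebra

variable {K I n : Type} [Field K] {c : n → I}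

/-- The matrices with all components of degree at least `t`. -/
def filteredPart (K : Type) [Field K] (a : n → ℤ) (t : ℤ) : Submodule K (Matrix n n K) where
  carrier := {x | ∀ s s', x s s' ≠ 0 → t ≤ a s - a s'}
  add_mem' := fun {x y} hx hy s t h => by
    by_cases h0 : x s t = 0
    · exact hy s t (by simpa [h0] using h)
    · exact hx s t h0
  zero_mem' := fun s t h => by simp at h
  smul_mem' := fun a x hx s t h => hx s t (right_ne_zero_of_mul (by simpa using h))

/-- The projection to the component of degree `t`. -/
def component (K : Type) [Field K] {A : Type} [AddCommGroup A] [DecidableEq A] (a : n → A)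
    (t : A) : Matrix n n K →ₗ[K] Matrix n n K where
  toFun x := Matrix.of fun s s' => if a s - a s' = t then x s s' else 0
  map_add' x y := by
    ext s s'
    simp only [Matrix.of_apply, Matrix.add_apply]
    split_ifs <;> simp
  map_smul' r x := by
    ext s s'
    simp [Matrix.of_apply]

theorem component_apply {A : Type} [AddCommGroup A] [DecidableEq A] (a : n → A) (t : A)
    (x : Matrix n n K) (s s' : n) :
    component K a t x s s' = if a s - a s' = t then x s s' else 0 := rfl

theorem component_eq_zero_iff {a : n → ℤ} {t : ℤ} {x : Matrix n n K}
    (hx : x ∈ filteredPart K a t) : component K a t x = 0 ↔ x ∈ filteredPart K a (t + 1) := by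
  constructor
  · intro h s s' hs
    have h1 := hx s s' hs
    by_contra h2
    have h3 := congrFun (congrFun h s) s'
    rw [component_apply, if_pos (by omega)] at h3
    exact hs h3
  · intro h
    ext s s'
    rw [component_apply]
    split_ifs with h1
    · by_contra h2
      have := h s s' h2
      omega
    · rfl

theorem filteredPart_anti {a : n → ℤ} : Antitone (filteredPart K a) :=
  fun _ _ h _ hx s s' hs => h.trans (hx s s' hs)

theorem gradedPart_le_filteredPart {a : n → ℤ} {t : ℤ} :
    gradedPart K c a t ≤ filteredPart K a t := fun x hx s s' hs => by
  have := (hx s s' hs).2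
  omega

theorem exists_filteredPart_eq [Finite n] (a : n → ℤ) :
    ∃ N : ℕ, filteredPart K a (-N) = ⊤ ∧ filteredPart K a (N + 1) = ⊥ := by
  cases nonempty_fintype n
  have hN : ∀ s s', |a s - a s'| ≤ ((∑ s, (a s).natAbs + ∑ s, (a s).natAbs : ℕ) : ℤ) := by
    intro s s'
    have h1 := Finset.single_le_sum (f := fun s => (a s).natAbs) (fun _ _ => Nat.zero_le _)
      (Finset.mem_univ s)
    have h2 := Finset.single_le_sum (f := fun s => (a s).natAbs) (fun _ _ => Nat.zero_le _)
      (Finset.mem_univ s')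
    beta_reduce at h1 h2
    rw [abs_le]
    push_cast
    zify at h1 h2
    have h3 := neg_abs_le (a s)
    have h4 := le_abs_self (a s)
    have h5 := neg_abs_le (a s')
    have h6 := le_abs_self (a s')
    constructor <;> linarith
  refine ⟨_, eq_top_iff.mpr fun x _ s s' _ => (abs_le.mp (hN s s')).1, ?_⟩
  rw [eq_bot_iff]
  intro x hx
  rw [Submodule.mem_bot]
  ext s s'
  by_contra h
  have := hx s s' h
  have := (abs_le.mp (hN s s')).2
  omega

variable [Fintype n]

theorem component_lie {A : Type} [AddCommGroup A] [DecidableEq A] {a : n → A}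
    {e : Matrix n n K} {t : A} (he : e ∈ gradedPart K c a t) (t' : A) (x : Matrix n n K) :
    component K a (t' + t) ⁅e, x⁆ = ⁅e, component K a t' x⁆ := by
  have h1 : ∀ s s' r, e s r ≠ 0 → (a s - a s' = t' + t ↔ a r - a s' = t') := by
    intro s s' r h
    rw [(he s r h).2, show a r + t - a s' = a r - a s' + t by abel, add_left_inj]
  have h2 : ∀ s s' r, e r s' ≠ 0 → (a s - a s' = t' + t ↔ a s - a r = t') := by
    intro s s' r h
    rw [show a s - a r = a s - a s' - t by rw [(he r s' h).2]; abel]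
    exact sub_eq_iff_eq_add.symm
  ext s s'
  simp only [component_apply, Ring.lie_def, Matrix.sub_apply, Matrix.mul_apply]
  split_ifs with h
  · congr 1
    · refine Finset.sum_congr rfl fun r _ => ?_
      by_cases h0 : e s r = 0
      · simp [h0]
      · rw [if_pos ((h1 s s' r h0).mp h)]
    · refine Finset.sum_congr rfl fun r _ => ?_
      by_cases h0 : e r s' = 0
      · simp [h0]
      · rw [if_pos ((h2 s s' r h0).mp h)]
  · rw [Finset.sum_eq_zero, Finset.sum_eq_zero, sub_zero]
    · intro r _
      by_cases h0 : e r s' = 0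
      · simp [h0]
      · rw [if_neg fun h' => h ((h2 s s' r h0).mpr h'), zero_mul]
    · intro r _
      by_cases h0 : e s r = 0
      · simp [h0]
      · rw [if_neg fun h' => h ((h1 s s' r h0).mpr h'), mul_zero]

theorem lie_mem_filteredPart {a : n → ℤ} {e x : Matrix n n K} {t t' : ℤ}
    (he : e ∈ gradedPart K c a t) (hx : x ∈ filteredPart K a t') :
    ⁅e, x⁆ ∈ filteredPart K a (t' + t) := by
  rw [Ring.lie_def]
  refine sub_mem ?_ ?_
  · intro s s' h
    rw [Matrix.mul_apply] at h
    obtain ⟨r, -, hr⟩ := Finset.exists_ne_zero_of_sum_ne_zero h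
    have h1 := (he s r (left_ne_zero_of_mul hr)).2
    have h2 := hx r s' (right_ne_zero_of_mul hr)
    omega
  · intro s s' h
    rw [Matrix.mul_apply] at h
    obtain ⟨r, -, hr⟩ := Finset.exists_ne_zero_of_sum_ne_zero h
    have h1 := hx s r (left_ne_zero_of_mul hr)
    have h2 := (he r s' (right_ne_zero_of_mul hr)).2
    omega

/-- A basis of a space of matrices adapted to the filtration by the degree. -/
theorem exists_filtered_basis (a : n → ℤ) (G : Submodule K (Matrix n n K)) :
    ∃ (d : ℕ) (β : Basis (Fin d) K G) (τ : Fin d → ℤ),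
      ∀ (x : G) t, x.1 ∈ filteredPart K a t ↔ ∀ j, β.repr x j ≠ 0 → t ≤ τ j := by
  classical
  obtain ⟨N, hN, hN1⟩ := IsAddNorm.of_basis (Matrix.stdBasis K n n)
    fun J => ((a J.1 - a J.2 : ℤ) : ℝ)
  have hrep : ∀ (x : Matrix n n K) s s', (Matrix.stdBasis K n n).repr x (s, s') = x s s' := by
    intro x s s'
    rfl
  have hNF : ∀ (x : Matrix n n K) (t : ℤ),
      ((t : ℝ) : WithTop ℝ) ≤ N x ↔ x ∈ filteredPart K a t := by
    intro x t
    rw [hN1]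
    constructor
    · intro h s s' hs
      exact_mod_cast h (s, s') (by rwa [hrep])
    · rintro h ⟨s, s'⟩ hs
      rw [hrep] at hs
      exact_mod_cast h s s' hs
  obtain ⟨β, hβ⟩ := (hN.restrict G).exists_basis (hN.restrict G) rfl
  obtain ⟨B, hB1, hB2⟩ := exists_filteredPart_eq (K := K) a
  have hτ : ∀ j, ∃ τ : ℤ, (β j).1 ∈ filteredPart K a τ ∧ (β j).1 ∉ filteredPart K a (τ + 1) := by
    intro j
    by_contra! h
    have h1 : ∀ m : ℕ, (β j).1 ∈ filteredPart K a (-B + m) := by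
      intro m
      induction m with
      | zero => simp [hB1]
      | succ m ih => simpa [add_assoc] using h _ ih
    have h2 := h1 (2 * B + 1)
    rw [show -(B : ℤ) + ((2 * B + 1 : ℕ) : ℤ) = B + 1 by push_cast; ring, hB2,
      Submodule.mem_bot] at h2
    exact β.ne_zero j (Subtype.ext h2)
  choose τ hτ hτ' using hτ
  refine ⟨_, β, τ, fun x t => ⟨fun hx j hj => ?_, fun h => ?_⟩⟩
  · by_contra hlt
    apply hτ' j
    refine filteredPart_anti (show τ j + 1 ≤ t by omega) ?_
    have h1 := (hβ (β.repr x) j hj).1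
    rw [β.sum_repr] at h1
    exact (hNF _ _).mp (((hNF _ _).mpr hx).trans h1)
  · rw [← β.sum_repr x, AddSubmonoidClass.coe_finsetSum]
    refine sum_mem fun j _ => ?_
    by_cases h0 : β.repr x j = 0
    · simp [h0]
    · exact Submodule.smul_mem _ _ (filteredPart_anti (h j h0) (hτ j))

end Purity

section Purity

attribute [local instance] LieRing.ofAssociativeRing LieAlgebra.ofAssociativeAlgebra

variable {K I n : Type} [Field K] {c : n → I}

theorem finrank_map_component {a : n → ℤ} {G : Submodule K (Matrix n n K)} {d : ℕ}
    {β : Basis (Fin d) K G} {τ : Fin d → ℤ}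
    (hβ : ∀ (x : G) t, x.1 ∈ filteredPart K a t ↔ ∀ j, β.repr x j ≠ 0 → t ≤ τ j) (t : ℤ) :
    finrank K ((G ⊓ filteredPart K a t).map (component K a t)) = {j | τ j = t}.ncard := by
  classical
  have hmem : ∀ j, (β j).1 ∈ filteredPart K a (τ j) := fun j => (hβ _ _).mpr fun j' h => by
    rw [β.repr_self] at h
    by_cases h' : j = j'
    · rw [h']
    · simp [h'] at h
  have hspan : (G ⊓ filteredPart K a t).map (component K a t) =
      Submodule.span K (Set.range fun j : {j | τ j = t} => component K a t (β j).1) := by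
    apply le_antisymm
    · rintro _ ⟨x, ⟨hx, hxt⟩, rfl⟩
      have h1 := (hβ ⟨x, hx⟩ t).mp hxt
      have h2 := congrArg Subtype.val (β.sum_repr ⟨x, hx⟩)
      rw [AddSubmonoidClass.coe_finsetSum] at h2
      change ∑ i, _ = x at h2
      rw [← h2, map_sum]
      refine sum_mem fun j _ => ?_
      rw [Submodule.coe_smul, map_smul]
      by_cases h0 : β.repr ⟨x, hx⟩ j = 0
      · simp [h0]
      refine Submodule.smul_mem _ _ ?_
      rcases (h1 j h0).eq_or_lt with h | h
      · exact Submodule.subset_span ⟨⟨j, h.symm⟩, rfl⟩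
      · rw [(component_eq_zero_iff (filteredPart_anti (h1 j h0) (hmem j))).mpr
          (filteredPart_anti (by omega) (hmem j))]
        exact zero_mem _
    · rw [Submodule.span_le]
      rintro _ ⟨⟨j, rfl⟩, rfl⟩
      exact ⟨_, ⟨(β j).2, hmem j⟩, rfl⟩
  have hli : LinearIndependent K fun j : {j | τ j = t} => component K a t (β j).1 := by
    rw [Fintype.linearIndependent_iff]
    intro g hg j
    set x : G := ∑ i : {j | τ j = t}, g i • β i with hx
    have hxt : x.1 ∈ filteredPart K a t := by
      rw [hx, AddSubmonoidClass.coe_finsetSum]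
      exact sum_mem fun i _ => Submodule.smul_mem _ _ (by have := hmem i; rwa [i.2] at this)
    have h1 : component K a t x.1 = 0 := by
      rw [← hg, hx, AddSubmonoidClass.coe_finsetSum, map_sum]
      simp
    have h2 := (hβ x (t + 1)).mp ((component_eq_zero_iff hxt).mp h1) j
    have h3 : β.repr x j = g j := by
      rw [hx, map_sum, Finsupp.finsetSum_apply, Finset.sum_eq_single j]
      · simp
      · intro i _ hij
        simp [Subtype.val_injective.eq_iff, hij]
      · simp
    by_contra h0
    have := h2 (by rwa [h3])
    have := j.2
    simp only [Set.mem_ofPred_eq] at this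
    omega
  rw [hspan, finrank_span_eq_card hli, ← Nat.card_eq_fintype_card, Nat.card_coe_set_eq]

variable [Fintype n]

theorem eq_of_sum_nonpos {d : ℕ} {τ : Fin d → ℤ} (hτ : ∑ j, τ j ≤ 0)
    (h : ∀ i : ℕ, {j | τ j = -i}.ncard ≤ {j | τ j = i}.ncard) (i : ℕ) :
    {j | τ j = -i}.ncard = {j | τ j = i}.ncard := by
  classical
  have hc : ∀ t : ℤ, {j | τ j = t}.ncard = (Finset.univ.filter fun j => τ j = t).card := by
    intro t
    rw [← Set.ncard_coe_finset]
    simp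
  simp only [hc] at h ⊢
  set ν : ℤ → ℕ := fun t => (Finset.univ.filter fun j => τ j = t).card with hν
  set N := i + ∑ j, (τ j).natAbs
  have hN : ∀ j, τ j ∈ Finset.Icc (-N : ℤ) N := by
    intro j
    have h1 := Finset.single_le_sum (f := fun s => (τ s).natAbs) (fun _ _ => Nat.zero_le _)
      (Finset.mem_univ j)
    beta_reduce at h1
    rw [Finset.mem_Icc]
    omega
  have h1 : ∑ j, τ j = ∑ t ∈ Finset.Icc (-N : ℤ) N, t * ν t := by
    rw [← Finset.sum_fiberwise_of_maps_to (s := Finset.univ) (fun j _ => hN j)]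
    refine Finset.sum_congr rfl fun t _ => ?_
    rw [Finset.sum_congr rfl fun j hj => (Finset.mem_filter.mp hj).2, Finset.sum_const,
      nsmul_eq_mul, mul_comm]
  have h2 : ∑ t ∈ Finset.Icc (-N : ℤ) N, t * ν t = ∑ t ∈ Finset.Icc (-N : ℤ) N, (-t) * ν (-t) := by
    refine Finset.sum_nbij' (fun t => -t) (fun t => -t) ?_ ?_ ?_ ?_ ?_ <;> simp +contextual
    · intros; omega
    · intros; omega
  have h3 : ∑ t ∈ Finset.Icc (-N : ℤ) N, t * ((ν t : ℤ) - ν (-t)) ≤ 0 := by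
    have : ∑ t ∈ Finset.Icc (-N : ℤ) N, t * ((ν t : ℤ) - ν (-t)) =
        ∑ t ∈ Finset.Icc (-N : ℤ) N, t * ν t + ∑ t ∈ Finset.Icc (-N : ℤ) N, (-t) * ν (-t) := by
      rw [← Finset.sum_add_distrib]
      exact Finset.sum_congr rfl fun t _ => by ring
    rw [this, ← h2, ← h1]
    omega
  have h4 : ∀ t ∈ Finset.Icc (-N : ℤ) N, 0 ≤ t * ((ν t : ℤ) - ν (-t)) := by
    intro t _
    rcases le_total 0 t with h0 | h0
    · obtain ⟨m, rfl⟩ := Int.eq_ofNat_of_zero_le h0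
      have := h m
      exact mul_nonneg h0 (by simp only [hν]; omega)
    · obtain ⟨m, hm⟩ := Int.eq_ofNat_of_zero_le (neg_nonneg.mpr h0)
      have := h m
      rw [← neg_neg t, hm]
      refine mul_nonneg_of_nonpos_of_nonpos (by omega) ?_
      simp only [hν, neg_neg]
      omega
  have h5 := (Finset.sum_eq_zero_iff_of_nonneg h4).mp (le_antisymm h3 (Finset.sum_nonneg h4)) i
    (by rw [Finset.mem_Icc]; omega)
  rcases mul_eq_zero.mp h5 with h6 | h6
  · rw [h6, neg_zero]
  · simp only [hν] at h6
    omega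

variable [DecidableEq n]

/-- A nilpotent element of a Lie algebra `G` of matrices all of whose filtered bases have
nonpositive total degree is in the image of the square of its adjoint action on `G`. -/
theorem exists_lie_lie_eq_of_graded {p : ℕ} [CharP K p] {a : n → ℤ} {e f : Matrix n n K}
    (he : e ∈ gradedPart K c a 2) (hf : f ∈ gradedPart K c a (-2))
    (hef : ⁅e, f⁆ = Matrix.diagonal fun s => (a s : K))
    (hb : ∀ s t, c s = c t → a s - a t < p) {G : Submodule K (Matrix n n K)}
    (hG : ∀ x ∈ G, ∀ s t, x s t ≠ 0 → c s = c t) (heG : e ∈ G) (hlie : ∀ x ∈ G, ⁅e, x⁆ ∈ G)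
    (hdeg : ∀ (d : ℕ) (u : Fin d → Matrix n n K), LinearIndependent K u →
      Submodule.span K (Set.range u) = G → ∀ t : Fin d → ℤ,
      (∀ j s s', u j s s' ≠ 0 → t j ≤ a s - a s') → ∑ j, t j ≤ 0) :
    ∃ y ∈ G, ⁅e, ⁅e, y⁆⁆ = e := by
  obtain ⟨d, β, τ, hβ⟩ := exists_filtered_basis a G
  have hsl := isGradedSl2_gradedPart (K := K) (p := p) (deg := AddMonoidHom.id ℤ) (ι := 2) rfl
    he hf hef hb
  set E := LieAlgebra.ad K (Matrix n n K) e with hE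
  have hEpow : ∀ (i : ℕ) (t : ℤ) x, component K a (t + 2 * i) ((E ^ i) x) =
      (E ^ i) (component K a t x) := by
    intro i
    induction i with
    | zero => simp
    | succ i ih =>
      intro t x
      rw [← Module.End.apply_pow_apply, ← Module.End.apply_pow_apply, ← ih, hE,
        LieAlgebra.ad_apply, LieAlgebra.ad_apply, ← component_lie he]
      congr 2
      push_cast
      ring
  have hEF : ∀ (i : ℕ) (t : ℤ), ∀ x ∈ filteredPart K a t,
      (E ^ i) x ∈ filteredPart K a (t + 2 * i) := by
    intro i
    induction i with
    | zero => simp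
    | succ i ih =>
      intro t x hx
      rw [← Module.End.apply_pow_apply]
      have := lie_mem_filteredPart he (ih t x hx)
      rw [show t + 2 * ((i + 1 : ℕ) : ℤ) = t + 2 * i + 2 by push_cast; ring]
      exact this
  have hEG : ∀ (i : ℕ), ∀ x ∈ G, (E ^ i) x ∈ G := by
    intro i
    induction i with
    | zero => simp
    | succ i ih =>
      intro x hx
      rw [← Module.End.apply_pow_apply]
      exact hlie _ (ih x hx)
  set U : ℤ → Submodule K (Matrix n n K) := fun t =>
    (G ⊓ filteredPart K a t).map (component K a t) with hU
  have hUg : ∀ t, U t ≤ gradedPart K c a t := by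
    rintro t _ ⟨x, ⟨hx, hxt⟩, rfl⟩ s s' hs
    rw [component_apply] at hs
    by_cases h : a s - a s' = t
    · rw [if_pos h] at hs
      exact ⟨hG x hx s s' hs, by omega⟩
    · simp [h] at hs
  have hmap : ∀ i : ℕ, (U (-i)).map (E ^ i) ≤ U i := by
    rintro i _ ⟨_, ⟨x, ⟨hx, hxt⟩, rfl⟩, rfl⟩
    have h1 := hEF i _ x hxt
    have h2 := hEpow i (-i) x
    rw [show -(i : ℤ) + 2 * i = i by ring] at h1 h2
    rw [← h2]
    exact ⟨_, ⟨hEG i x hx, h1⟩, rfl⟩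
  have hrank : ∀ i : ℕ, finrank K ((U (-i)).map (E ^ i)) = finrank K (U (-i)) := by
    intro i
    rw [← LinearMap.range_domRestrict]
    refine LinearMap.finrank_range_of_inj ((injective_iff_map_eq_zero _).mpr fun x hx => ?_)
    exact Subtype.ext (hsl.eq_zero_of_e_pow (hUg _ x.2) (by simp) hx)
  have hle : ∀ i : ℕ, {j | τ j = -i}.ncard ≤ {j | τ j = i}.ncard := by
    intro i
    rw [← finrank_map_component hβ, ← finrank_map_component hβ]
    exact (hrank i).symm.le.trans (Submodule.finrank_mono (hmap i))
  have hsum : ∑ j, τ j ≤ 0 := by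
    refine hdeg d (fun j => (β j).1) ?_ ?_ τ ?_
    · exact β.linearIndependent.map' G.subtype (Submodule.ker_subtype G)
    · have := congrArg (Submodule.map G.subtype) β.span_eq
      rw [Submodule.map_span, ← Set.range_comp, Submodule.map_top, Submodule.range_subtype] at this
      exact this
    · intro j s s' hs
      refine (hβ (β j) (τ j)).mpr (fun j' h => ?_) s s' hs
      rw [β.repr_self] at h
      by_cases h' : j = j'
      · rw [h']
      · simp [h'] at h
  have heq : ∀ i : ℕ, (U (-i)).map (E ^ i) = U i := by
    intro i
    refine Submodule.eq_of_le_of_finrank_eq (hmap i) ?_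
    rw [hrank, hU, finrank_map_component hβ, finrank_map_component hβ, eq_of_sum_nonpos hsum hle]
  obtain ⟨N, -, hN⟩ := exists_filteredPart_eq (K := K) a
  have key : ∀ m t : ℕ, N + 1 ≤ t + 2 + m → ∀ x ∈ G, x ∈ filteredPart K a ((t + 2 : ℕ) : ℤ) →
      ∃ y ∈ G, ⁅e, ⁅e, y⁆⁆ = x := by
    intro m
    induction m with
    | zero =>
      intro t ht x _ hxt
      have := filteredPart_anti (show (N : ℤ) + 1 ≤ ((t + 2 : ℕ) : ℤ) by exact_mod_cast ht) hxt
      rw [hN, Submodule.mem_bot] at this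
      exact ⟨0, zero_mem _, by simp [this]⟩
    | succ m ih =>
      intro t ht x hx hxt
      have h1 : component K a ((t + 2 : ℕ) : ℤ) x ∈ U ((t + 2 : ℕ) : ℤ) := ⟨x, ⟨hx, hxt⟩, rfl⟩
      rw [← heq] at h1
      obtain ⟨_, ⟨y, ⟨hy, hyt⟩, rfl⟩, hyx⟩ := h1
      have h2 := hEF (t + 2) _ y hyt
      have h3 := hEpow (t + 2) (-((t + 2 : ℕ) : ℤ)) y
      rw [show -((t + 2 : ℕ) : ℤ) + 2 * ((t + 2 : ℕ) : ℤ) = ((t + 2 : ℕ) : ℤ) by ring] at h2 h3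
      have h4 : x - (E ^ (t + 2)) y ∈ filteredPart K a ((t + 1 + 2 : ℕ) : ℤ) := by
        have := (component_eq_zero_iff (sub_mem hxt h2)).mp (by rw [map_sub, h3, hyx, sub_self])
        rwa [show ((t + 1 + 2 : ℕ) : ℤ) = ((t + 2 : ℕ) : ℤ) + 1 by push_cast; ring]
      obtain ⟨z, hz, hzx⟩ := ih (t + 1) (by omega) _ (sub_mem hx (hEG _ y hy)) h4
      refine ⟨z + (E ^ t) y, add_mem hz (hEG _ y hy), ?_⟩
      rw [lie_add, lie_add, hzx, sub_add_eq_add_sub, add_sub_assoc, add_eq_left, sub_eq_zero]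
      rw [← LieAlgebra.ad_apply K, ← LieAlgebra.ad_apply K, Module.End.apply_pow_apply,
        Module.End.apply_pow_apply]
  exact key (N + 1) 0 (by omega) e heG (gradedPart_le_filteredPart he)

end Purity

section Stabilizer

attribute [local instance] LieRing.ofAssociativeRing LieAlgebra.ofAssociativeAlgebra

variable {K V I : Type} [Field K] [AddCommGroup V] [Module K V]

/-- The endomorphisms preserving the blocks `W i` and, under the bracket, the space `U`. -/
def lieStabilizer (W : I → Submodule K V) (U : Submodule K (End K V)) :
    Submodule K (End K V) where
  carrier := {x | (∀ i, ∀ v ∈ W i, x v ∈ W i) ∧ ∀ u ∈ U, ⁅x, u⁆ ∈ U}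
  add_mem' := fun hx hy => ⟨fun i v hv => add_mem (hx.1 i v hv) (hy.1 i v hv),
    fun u hu => by
      rw [add_lie]
      exact add_mem (hx.2 u hu) (hy.2 u hu)⟩
  zero_mem' := ⟨fun i v _ => zero_mem _, fun u _ => by
    rw [zero_lie]
    exact zero_mem _⟩
  smul_mem' := fun a x hx => ⟨fun i v hv => Submodule.smul_mem _ _ (hx.1 i v hv),
    fun u hu => by
      rw [smul_lie]
      exact Submodule.smul_mem _ _ (hx.2 u hu)⟩

theorem lie_mem_lieStabilizer {W : I → Submodule K V} {U : Submodule K (End K V)}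
    {x y : End K V} (hx : x ∈ lieStabilizer W U) (hy : y ∈ lieStabilizer W U) :
    ⁅x, y⁆ ∈ lieStabilizer W U := by
  refine ⟨fun i v hv => ?_, fun u hu => ?_⟩
  · rw [Ring.lie_def]
    exact sub_mem (hx.1 i _ (hy.1 i v hv)) (hy.1 i _ (hx.1 i v hv))
  · rw [lie_lie]
    exact sub_mem (hx.2 _ (hy.2 u hu)) (hy.2 _ (hx.2 u hu))

theorem conjEnd_apply (h : V ≃ₗ[K] V) (x : End K V) (v : V) :
    conjEnd h x v = h (x (h.symm v)) := rfl

theorem conjEnd_lie (h : V ≃ₗ[K] V) (x y : End K V) :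
    conjEnd h ⁅x, y⁆ = ⁅conjEnd h x, conjEnd h y⁆ := by
  ext v
  simp [conjEnd_apply, Ring.lie_def]

theorem conjEnd_inv_conjEnd (h : V ≃ₗ[K] V) (x : End K V) : conjEnd h (conjEnd h⁻¹ x) = x := by
  ext v
  simp only [conjEnd_apply]
  change h (h.symm (x (h (h.symm v)))) = x v
  simp

theorem conjEnd_mem_lieStabilizer {W : I → Submodule K V} {U : Submodule K (End K V)}
    {H : Subgroup (V ≃ₗ[K] V)} (hH : ∀ i, ∀ h ∈ H, ∀ v ∈ W i, h v ∈ W i)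
    (hU : ∀ h ∈ H, ∀ u ∈ U, conjEnd h u ∈ U) {h : V ≃ₗ[K] V} (hh : h ∈ H) {x : End K V}
    (hx : x ∈ lieStabilizer W U) : conjEnd h x ∈ lieStabilizer W U := by
  refine ⟨fun i v hv => hH i h hh _ (hx.1 i _ (hH i h⁻¹ (inv_mem hh) v hv)), fun u hu => ?_⟩
  have := hU h hh _ (hx.2 _ (hU h⁻¹ (inv_mem hh) u hu))
  rwa [conjEnd_lie, conjEnd_inv_conjEnd] at this

/-- Purity: a nilpotent element of the stabilizer of an `H`-stable space of endomorphisms lies in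
the image of the square of its adjoint action on the stabilizer. -/
theorem exists_lie_lie_eq [FiniteDimensional K V] [Finite I] {p : ℕ} [CharP K p]
    {W : I → Submodule K V}
    (hW : iSupIndep W) (hW' : iSup W = ⊤) (hdim : ∀ i, 2 * finrank K (W i) ≤ p + 1)
    {H : Subgroup (V ≃ₗ[K] V)} (hH : ∀ i, ∀ h ∈ H, ∀ v ∈ W i, h v ∈ W i)
    (hirr : ∀ i, ∀ Z ≤ W i, (∀ h ∈ H, ∀ v ∈ Z, h v ∈ Z) → Z = ⊥ ∨ Z = W i)
    {U : Submodule K (End K V)} (hU : ∀ h ∈ H, ∀ u ∈ U, conjEnd h u ∈ U)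
    {e : End K V} (he : e ∈ lieStabilizer W U) (hnil : IsNilpotent e) :
    ∃ y ∈ lieStabilizer W U, ⁅e, ⁅e, y⁆⁆ = e := by
  classical
  cases nonempty_fintype I
  obtain ⟨n, _, c, b, a, f, hb, hea, hfa, hfW, hef, ha, hsum⟩ :=
    exists_jordan_basis hW hW' hnil he.1
  set M := LinearMap.toMatrixAlgEquiv b with hM
  have hMlie : ∀ x y, M ⁅x, y⁆ = ⁅M x, M y⁆ := fun x y => by simp [Ring.lie_def]
  have hMap : ∀ x s s', M x s s' = b.repr (x (b s')) s := fun x s s' =>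
    LinearMap.toMatrixAlgEquiv_apply b x s s'
  have hblock : ∀ x : End K V, (∀ i, ∀ v ∈ W i, x v ∈ W i) → ∀ s s', M x s s' ≠ 0 → c s = c s' := by
    intro x hx s s' hs
    rw [hMap] at hs
    exact hb.eq_of_repr_ne_zero hW (hx _ _ (hb s')) hs
  set G := (lieStabilizer W U).map M.toLinearMap with hGdef
  have hGmem : ∀ x ∈ lieStabilizer W U, M x ∈ G := fun x hx => ⟨x, hx, rfl⟩
  obtain ⟨_, ⟨y, hy, rfl⟩, hy'⟩ := exists_lie_lie_eq_of_graded (p := p) (e := M e) (f := M f)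
    (c := c) (a := a) (G := G)
    (fun s s' hs => ⟨hblock e he.1 s s' hs, hea _ _ (by rwa [hMap] at hs)⟩)
    (fun s s' hs => ⟨hblock f hfW s s' hs, hfa _ _ (by rwa [hMap] at hs)⟩)
    (by
      rw [← hMlie]
      ext s s'
      rw [hMap, Ring.lie_def]
      have : (e * f - f * e) (b s') = (a s' : K) • b s' := hef s'
      rw [this, map_smul, b.repr_self]
      by_cases h : s = s'
      · simp [h]
      · simp [h])
    (fun s s' hs => by
      have h1 := ha s
      have h2 := ha s'
      rw [← hs] at h2
      have h3 := hdim (c s)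
      have := le_abs_self (a s)
      have := neg_abs_le (a s')
      zify at h3
      linarith)
    (by
      rintro _ ⟨x, hx, rfl⟩
      exact hblock x hx.1)
    (hGmem e he)
    (by
      rintro _ ⟨x, hx, rfl⟩
      have := hGmem _ (lie_mem_lieStabilizer he hx)
      rwa [hMlie] at this)
    (by
      intro d u hu hspan t ht
      have huM : ∀ j, M (M.symm (u j)) = u j := fun j => M.apply_symm_apply _
      have hmem : ∀ j, M.symm (u j) ∈ lieStabilizer W U := by
        intro j
        have : u j ∈ G := hspan ▸ Submodule.subset_span ⟨j, rfl⟩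
        obtain ⟨x, hx, hxu⟩ := this
        rw [← hxu]
        simpa using hx
      have hspan' : Submodule.span K (Set.range fun j => M.symm (u j)) = lieStabilizer W U := by
        have h1 := congrArg (Submodule.map M.symm.toLinearMap) hspan
        rw [Submodule.map_span, ← Set.range_comp, hGdef, ← Submodule.map_comp] at h1
        refine h1.trans ?_
        convert Submodule.map_id _
        ext x : 1
        simp
      have := sum_degree_nonpos hW hW' H hH hirr (u := fun j => M.symm (u j))
        (hu.map' M.symm.toLinearMap (LinearMap.ker_eq_bot.mpr M.symm.injective))
        (fun h hh k => by
          rw [hspan']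
          exact conjEnd_mem_lieStabilizer hH hU hh (hmem k))
        hb (fun s => (a s : ℝ)) (fun i => by exact_mod_cast hsum i) (fun j => (t j : ℝ))
        (fun j s s' hs => by
          have := ht j s s' (by rwa [← huM, hMap])
          exact_mod_cast this)
      exact_mod_cast this)
  refine ⟨y, hy, M.injective ?_⟩
  rw [hMlie, hMlie]
  exact hy'

end Stabilizer

section Toral

attribute [local instance] LieRing.ofAssociativeRing LieAlgebra.ofAssociativeAlgebra

variable {K V I : Type} [Field K] [AddCommGroup V] [Module K V]

theorem mem_lieStabilizer_iff_ad {W : I → Submodule K V} {U : Submodule K (End K V)} {x : End K V} :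
    x ∈ lieStabilizer W U ↔
      (∀ i, W i ∈ x.invtSubmodule) ∧ U ∈ (LieAlgebra.ad K (End K V) x).invtSubmodule :=
  Iff.rfl

theorem mem_invtSubmodule_of_mem_adjoin {x s : End K V} (hs : s ∈ Algebra.adjoin K {x})
    {U : Submodule K V} (hU : U ∈ x.invtSubmodule) : U ∈ s.invtSubmodule := by
  induction hs using Algebra.adjoin_induction with
  | mem y hy => rwa [Set.mem_singleton_iff.mp hy]
  | algebraMap r => exact fun v hv => Submodule.smul_mem _ _ hv
  | add y z _ _ hy hz => exact fun v hv => U.add_mem (hy hv) (hz hv)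
  | mul y z _ _ hy hz => exact fun v hv => hy (hz hv)

/-- The Jordan components of an element of the stabilizer are in the stabilizer. -/
theorem exists_jordan_mem_lieStabilizer [PerfectField K] [FiniteDimensional K V]
    {W : I → Submodule K V} {U : Submodule K (End K V)} {x : End K V}
    (hx : x ∈ lieStabilizer W U) :
    ∃ m ∈ lieStabilizer W U, ∃ s ∈ lieStabilizer W U, m ∈ Algebra.adjoin K {x} ∧
      s ∈ Algebra.adjoin K {x} ∧ IsNilpotent m ∧ s.IsSemisimple ∧ x = m + s := by
  obtain ⟨m, hm, s, hs, hmn, hss, rfl⟩ := x.exists_isNilpotent_isSemisimple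
  have hc : Commute m s := Algebra.commute_of_mem_adjoin_singleton_of_commute hs
    (Algebra.commute_of_mem_adjoin_self hm).symm
  rw [mem_lieStabilizer_iff_ad] at hx
  refine ⟨m, ?_, s, ?_, hm, hs, hmn, hss, rfl⟩
  · exact mem_lieStabilizer_iff_ad.mpr ⟨fun i => mem_invtSubmodule_of_mem_adjoin hm (hx.1 i),
      mem_invtSubmodule_of_mem_adjoin (LieAlgebra.ad_mem_adjoin_of_isNilpotent hc hmn hss) hx.2⟩
  · exact mem_lieStabilizer_iff_ad.mpr ⟨fun i => mem_invtSubmodule_of_mem_adjoin hs (hx.1 i),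
      mem_invtSubmodule_of_mem_adjoin (LieAlgebra.ad_mem_adjoin_of_isSemisimple hc hmn hss) hx.2⟩

theorem exists_simultaneous_eigenbasis [IsAlgClosed K] [FiniteDimensional K V] {J : Type}
    (f : J → End K V) (hf : ∀ i j, Commute (f i) (f j)) (hs : ∀ j, (f j).IsSemisimple) :
    ∃ (n : Type) (_ : Fintype n) (b : Basis n K V) (χ : n → J → K),
      ∀ s j, f j (b s) = χ s j • b s := by
  classical
  have hint : DirectSum.IsInternal fun χ : J → K => ⨅ j, (f j).maxGenEigenspace (χ j) := by
    rw [DirectSum.isInternal_submodule_iff_iSupIndep_and_iSup_eq_top]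
    refine ⟨Module.End.independent_iInf_maxGenEigenspace_of_forall_mapsTo _ fun i j φ =>
      Module.End.mapsTo_maxGenEigenspace_of_comm (hf j i) φ, ?_⟩
    exact Module.End.iSup_iInf_maxGenEigenspace_eq_top_of_iSup_maxGenEigenspace_eq_top_of_commute
      f (fun i j _ => hf i j) fun j => Module.End.iSup_maxGenEigenspace_eq_top (f j)
  let b := hint.collectedBasis fun χ => finBasis K _
  have := Module.Finite.finite_basis b
  refine ⟨_, Fintype.ofFinite _, b, fun s => s.1, fun s j => ?_⟩
  have h1 := (Submodule.mem_iInf _).mp (hint.collectedBasis_mem (fun χ => finBasis K _) s) j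
  rwa [(hs j).isFinitelySemisimple.maxGenEigenspace_eq_eigenspace,
    Module.End.mem_eigenspace_iff] at h1

theorem exists_adapted_eigenbasis [Fintype I] [DecidableEq I] [IsAlgClosed K]
    [FiniteDimensional K V] {W : I → Submodule K V} (hW : iSupIndep W) (hW' : iSup W = ⊤)
    {J : Type} (f : J → End K V) (hfW : ∀ j i, W i ∈ (f j).invtSubmodule)
    (hf : ∀ i j, Commute (f i) (f j)) (hs : ∀ j, (f j).IsSemisimple) :
    ∃ (n : Type) (_ : Fintype n) (c : n → I) (b : Basis n K V) (χ : n → J → K),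
      IsAdapted W c b ∧ ∀ s j, f j (b s) = χ s j • b s := by
  have hex := fun i => exists_simultaneous_eigenbasis (fun j => (f j).restrict (hfW j i))
    (fun j j' => by
      ext x
      exact congrArg (fun g : End K V => g x) (hf j j').eq)
    (fun j => (hs j).restrict (hfW j i))
  choose n _ b χ hχ using hex
  have hint : DirectSum.IsInternal W :=
    (DirectSum.isInternal_submodule_iff_iSupIndep_and_iSup_eq_top W).mpr ⟨hW, hW'⟩
  have hb : ∀ s, hint.collectedBasis b s = b s.1 s.2 :=
    fun s => congrFun (hint.collectedBasis_coe b) s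
  refine ⟨Σ i, n i, inferInstance, fun s => s.1, hint.collectedBasis b, fun s => χ s.1 s.2, ?_, ?_⟩
  · intro s
    rw [hb]
    exact Subtype.mem _
  · intro s j
    rw [hb]
    exact congrArg Subtype.val (hχ s.1 s.2 j)

/-- An adapted basis diagonalizing a maximal toral subalgebra of the stabilizer. -/
theorem exists_toral_basis [Fintype I] [DecidableEq I] [IsAlgClosed K]
    [FiniteDimensional K V] {W : I → Submodule K V} (hW : iSupIndep W) (hW' : iSup W = ⊤)
    (U : Submodule K (End K V)) :
    ∃ (n : Type) (_ : Fintype n) (c : n → I) (b : Basis n K V), IsAdapted W c b ∧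
      ∀ x ∈ lieStabilizer W U,
        (∀ y ∈ lieStabilizer W U, (∃ d : n → K, ∀ s, y (b s) = d s • b s) → Commute x y) →
        ∃ m ∈ lieStabilizer W U, ∃ y ∈ lieStabilizer W U,
          (∃ d : n → K, ∀ s, y (b s) = d s • b s) ∧ IsNilpotent m ∧
          m ∈ Algebra.adjoin K {x} ∧ x = m + y := by
  obtain ⟨T, ⟨hT𝔤, hTs, hTc⟩, hmax⟩ := WellFounded.has_min
    (wellFounded_gt (α := Submodule K (End K V)))
    {T | T ≤ lieStabilizer W U ∧ (∀ x ∈ T, x.IsSemisimple) ∧ ∀ x ∈ T, ∀ y ∈ T, Commute x y}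
    ⟨⊥, bot_le, by simp, by simp⟩
  have hmaximal : ∀ y ∈ lieStabilizer W U, y.IsSemisimple → (∀ x ∈ T, Commute x y) → y ∈ T := by
    intro y hy hys hyc
    by_contra hyT
    have hsup : ∀ z ∈ T ⊔ Submodule.span K {y}, ∃ t ∈ T, ∃ r : K, t + r • y = z := by
      intro z hz
      obtain ⟨t, ht, w, hw, rfl⟩ := Submodule.mem_sup.mp hz
      obtain ⟨r, rfl⟩ := Submodule.mem_span_singleton.mp hw
      exact ⟨t, ht, r, rfl⟩
    refine hmax (T ⊔ Submodule.span K {y}) ⟨?_, ?_, ?_⟩ ?_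
    · exact sup_le hT𝔤 (by simpa using hy)
    · intro z hz
      obtain ⟨t, ht, r, rfl⟩ := hsup _ hz
      exact (hTs t ht).add_of_commute ((hyc t ht).smul_right r) (Module.End.IsSemisimple_smul r hys)
    · intro z hz z' hz'
      obtain ⟨t, ht, r, rfl⟩ := hsup _ hz
      obtain ⟨t', ht', r', rfl⟩ := hsup _ hz'
      refine .add_left (.add_right (hTc t ht t' ht') ((hyc t ht).smul_right _))
        (.add_right ((hyc t' ht').symm.smul_left _) ?_)
      exact ((Commute.refl y).smul_left _).smul_right _
    · refine lt_of_le_of_ne le_sup_left fun h => hyT ?_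
      rw [h]
      exact Submodule.mem_sup_right (Submodule.mem_span_singleton_self y)
  obtain ⟨n, _, c, b, χ, hb, hχ⟩ := exists_adapted_eigenbasis hW hW' (fun t : T => t.1)
    (fun t i => (hT𝔤 t.2).1 i) (fun t t' => hTc _ t.2 _ t'.2) (fun t => hTs _ t.2)
  refine ⟨n, ‹_›, c, b, hb, fun x hx hxc => ?_⟩
  obtain ⟨m, hm, s, hs, hmx, hsx, hmn, hss, hxms⟩ := exists_jordan_mem_lieStabilizer hx
  have hsT : s ∈ T := hmaximal s hs hss fun t ht =>
    Algebra.commute_of_mem_adjoin_singleton_of_commute hsx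
      (hxc t (hT𝔤 ht) ⟨fun i => χ i ⟨t, ht⟩, fun i => hχ i ⟨t, ht⟩⟩).symm
  exact ⟨m, hm, s, hs, ⟨fun i => χ i ⟨s, hsT⟩, fun i => hχ i ⟨s, hsT⟩⟩, hmn, hmx, hxms⟩

end Toral

section Gradings

attribute [local instance] LieRing.ofAssociativeRing LieAlgebra.ofAssociativeAlgebra

variable {K I n A : Type} [Field K] [AddCommGroup A] [DecidableEq A]

theorem component_mem_gradedPart (κ : n → A) (z : A) (x : Matrix n n K) :
    component K κ z x ∈ gradedPart K (fun _ => ()) κ z := by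
  intro s t h
  rw [component_apply, ite_ne_right_iff] at h
  exact ⟨rfl, by rw [← h.1]; abel⟩

theorem component_mem_gradedPart_of_block {c : n → I} (κ : n → A) (z : A) {x : Matrix n n K}
    (hx : ∀ s t, x s t ≠ 0 → c s = c t) : component K κ z x ∈ gradedPart K c κ z := by
  intro s t h
  rw [component_apply, ite_ne_right_iff] at h
  exact ⟨hx s t h.2, by rw [← h.1]; abel⟩

theorem component_eq_self {c : n → I} {κ : n → A} {z : A} {x : Matrix n n K}
    (hx : x ∈ gradedPart K c κ z) : component K κ z x = x := by
  ext s t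
  rw [component_apply, ite_eq_left_iff]
  intro h
  by_contra h0
  exact h (by rw [(hx s t (Ne.symm h0)).2]; abel)

theorem component_component_of_ne {κ : n → A} {z w : A} (h : z ≠ w) (x : Matrix n n K) :
    component K κ z (component K κ w x) = 0 := by
  ext s t
  rw [component_apply, component_apply]
  split_ifs with h1 h2
  · exact absurd (h1.symm.trans h2) h
  · rfl
  · rfl

variable [Fintype n]

theorem sum_component (κ : n → A) (x : Matrix n n K) :
    ∑ z ∈ Finset.univ.image (fun J : n × n => κ J.1 - κ J.2), component K κ z x = x := by
  ext s t
  rw [Matrix.sum_apply, Finset.sum_eq_single (κ s - κ t)]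
  · rw [component_apply, if_pos rfl]
  · intro z _ hz
    rw [component_apply, if_neg (Ne.symm hz)]
  · intro h
    exact absurd (Finset.mem_image.mpr ⟨(s, t), Finset.mem_univ _, rfl⟩) h

open Matrix in
/-- A criterion for a space of matrices to contain the component of degree `z` of its elements:
the degree `z` can be separated from the other degrees by Hadamard multipliers. -/
theorem component_mem_of_separating {κ : n → A} {z : A} {U : Submodule K (Matrix n n K)}
    (h : ∀ s t, κ s - κ t ≠ z → ∃ φ : Matrix n n K, (∀ u ∈ U, φ ⊙ u ∈ U) ∧
      (∀ s' t', κ s' - κ t' = z → φ s' t' = 1) ∧ φ s t = 0) {u : Matrix n n K} (hu : u ∈ U) :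
    component K κ z u ∈ U := by
  have h' : ∀ J : n × n, ∃ φ : Matrix n n K, (∀ u ∈ U, φ ⊙ u ∈ U) ∧
      (∀ s' t', κ s' - κ t' = z → φ s' t' = 1) ∧ (κ J.1 - κ J.2 ≠ z → φ J.1 J.2 = 0) := by
    intro J
    by_cases hJ : κ J.1 - κ J.2 = z
    · refine ⟨Matrix.of fun _ _ => 1, fun u hu => ?_, fun _ _ _ => rfl, fun h0 => absurd hJ h0⟩
      convert hu
      ext
      simp [Matrix.hadamard_apply]
    · obtain ⟨φ, h1, h2, h3⟩ := h J.1 J.2 hJ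
      exact ⟨φ, h1, h2, fun _ => h3⟩
  choose φ h1 h2 h3 using h'
  have hprod : ∀ S : Finset (n × n), Matrix.of (fun s t => (∏ J ∈ S, φ J s t) * u s t) ∈ U := by
    classical
    intro S
    induction S using Finset.induction_on with
    | empty =>
      convert hu
      ext
      simp
    | insert J S hJ ih =>
      convert h1 J _ ih using 1
      ext s t
      simp [Finset.prod_insert hJ, mul_assoc]
  convert hprod Finset.univ
  ext s t
  rw [component_apply, Matrix.of_apply]
  split_ifs with hst
  · rw [Finset.prod_eq_one fun J _ => h2 J s t hst, one_mul]
  · rw [Finset.prod_eq_zero (Finset.mem_univ (s, t)) (h3 (s, t) hst), zero_mul]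

end Gradings

section Reductive

attribute [local instance] LieRing.ofAssociativeRing LieAlgebra.ofAssociativeAlgebra

variable {K I n : Type} [Field K] [Fintype n] [DecidableEq n]

/-- The block matrices preserving, under the bracket, the space `U`. -/
def matrixStabilizer (c : n → I) (U : Submodule K (Matrix n n K)) :
    Submodule K (Matrix n n K) where
  carrier := {x | (∀ s t, x s t ≠ 0 → c s = c t) ∧ ∀ u ∈ U, ⁅x, u⁆ ∈ U}
  add_mem' := fun {x y} hx hy => ⟨fun s t h => by
      by_cases h0 : x s t = 0
      · exact hy.1 s t (by simpa [h0] using h)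
      · exact hx.1 s t h0,
    fun u hu => by
      rw [add_lie]
      exact add_mem (hx.2 u hu) (hy.2 u hu)⟩
  zero_mem' := ⟨fun s t h => by simp at h, fun u _ => by
    rw [zero_lie]
    exact zero_mem _⟩
  smul_mem' := fun a x hx =>
    ⟨fun s t h => hx.1 s t (right_ne_zero_of_mul (by simpa using h)), fun u hu => by
      rw [smul_lie]
      exact Submodule.smul_mem _ _ (hx.2 u hu)⟩

theorem lie_mem_matrixStabilizer {c : n → I} {U : Submodule K (Matrix n n K)} {x y : Matrix n n K}
    (hx : x ∈ matrixStabilizer c U) (hy : y ∈ matrixStabilizer c U) :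
    ⁅x, y⁆ ∈ matrixStabilizer c U := by
  refine ⟨?_, fun u hu => ?_⟩
  · have h1 : x ∈ gradedPart K c (fun _ => (0 : ℤ)) 0 := fun s t h => ⟨hx.1 s t h, by simp⟩
    have h2 : y ∈ gradedPart K c (fun _ => (0 : ℤ)) 0 := fun s t h => ⟨hy.1 s t h, by simp⟩
    exact fun s t h => (lie_mem_gradedPart h1 h2 s t h).1
  · rw [lie_lie]
    exact sub_mem (hx.2 _ (hy.2 u hu)) (hy.2 _ (hx.2 u hu))

theorem component_mem_matrixStabilizer {A : Type} [AddCommGroup A] [DecidableEq A]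
    {c : n → I} {U : Submodule K (Matrix n n K)} {κ : n → A}
    (hU : ∀ z, ∀ u ∈ U, component K κ z u ∈ U) {x : Matrix n n K}
    (hx : x ∈ matrixStabilizer c U) (z : A) : component K κ z x ∈ matrixStabilizer c U := by
  refine ⟨fun s t h => (component_mem_gradedPart_of_block κ z hx.1 s t h).1, fun u hu => ?_⟩
  rw [← sum_component κ u, lie_sum]
  refine sum_mem fun w _ => ?_
  have h1 := component_lie (component_mem_gradedPart κ w u) z x
  rw [← lie_skew, ← h1, ← map_neg, lie_skew]
  exact hU _ _ (hx.2 _ (hU _ _ hu))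

theorem lie_diagonal_apply (d : n → K) (x : Matrix n n K) (s t : n) :
    ⁅Matrix.diagonal d, x⁆ s t = (d s - d t) * x s t := by
  rw [Ring.lie_def, Matrix.sub_apply, Matrix.diagonal_mul, Matrix.mul_diagonal]
  ring

theorem commute_diagonal_iff {d : n → K} {x : Matrix n n K} :
    Commute x (Matrix.diagonal d) ↔ ∀ s t, x s t ≠ 0 → d s = d t := by
  rw [commute_iff_eq, eq_comm, ← sub_eq_zero, ← Ring.lie_def]
  constructor
  · intro h s t hst
    have := congrFun (congrFun h s) t
    rw [lie_diagonal_apply] at this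
    exact sub_eq_zero.mp ((mul_eq_zero.mp this).resolve_right hst)
  · intro h
    ext s t
    rw [lie_diagonal_apply]
    by_cases hst : x s t = 0
    · simp [hst]
    · simp [h s t hst]

open Matrix in
/-- The multiplier attached to a diagonal matrix stabilizing `U`. -/
theorem exists_multiplier_of_diagonal {c : n → I} {U : Submodule K (Matrix n n K)} {d : n → K}
    (hd : Matrix.diagonal d ∈ matrixStabilizer c U) {r : K} {s t : n} (hst : d s - d t ≠ r) :
    ∃ φ : Matrix n n K, (∀ u ∈ U, φ ⊙ u ∈ U) ∧
      (∀ s' t', d s' - d t' = r → φ s' t' = 1) ∧ φ s t = 0 := by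
  have h0 : r - (d s - d t) ≠ 0 := sub_ne_zero.mpr (Ne.symm hst)
  refine ⟨Matrix.of fun s' t' => (r - (d s - d t))⁻¹ * ((d s' - d t') - (d s - d t)),
    fun u hu => ?_, fun s' t' h => ?_, by simp⟩
  · convert U.smul_mem (r - (d s - d t))⁻¹ (sub_mem (hd.2 u hu) (U.smul_mem (d s - d t) hu)) using 1
    ext s' t'
    simp only [Matrix.hadamard_apply, Matrix.of_apply, Matrix.smul_apply, Matrix.sub_apply,
      lie_diagonal_apply, smul_eq_mul]
    ring
  · rw [Matrix.of_apply, h, inv_mul_cancel₀ h0]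

/-- A Lie algebra of block matrices, stabilizing `U`, with small blocks, satisfying purity, and
such that the diagonal matrices form a maximal torus. -/
structure IsReductiveStabilizer (p : ℕ) (c : n → I)
    (U : Submodule K (Matrix n n K)) : Prop where
  block_le : ∀ i, 2 * Nat.card {s // c s = i} ≤ p + 1
  pure : ∀ e ∈ matrixStabilizer c U, IsNilpotent e →
    ∃ y ∈ matrixStabilizer c U, ⁅e, ⁅e, y⁆⁆ = e
  toral : ∀ x ∈ matrixStabilizer c U,
    (∀ d : n → K, Matrix.diagonal d ∈ matrixStabilizer c U → Commute x (Matrix.diagonal d)) →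
    ∃ m ∈ matrixStabilizer c U, ∃ d : n → K, Matrix.diagonal d ∈ matrixStabilizer c U ∧
      IsNilpotent m ∧ m ∈ Algebra.adjoin K {x} ∧ x = m + Matrix.diagonal d

theorem eq_zero_of_lie_eq_self {m m' : Matrix n n K} (hm' : IsNilpotent m') (h : ⁅m, m'⁆ = m) :
    m = 0 := by
  classical
  obtain ⟨N, hN⟩ := LieAlgebra.ad_nilpotent_of_nilpotent (R := K) hm'
  have h1 : ∀ j : ℕ, (LieAlgebra.ad K (Matrix n n K) m' ^ j) m = (-1) ^ j • m := by
    intro j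
    induction j with
    | zero => simp
    | succ j ih =>
      rw [pow_succ', Module.End.mul_apply, ih, map_zsmul, LieAlgebra.ad_apply, ← lie_skew, h,
        pow_succ, smul_neg, mul_smul, neg_one_smul, smul_neg]
  have h2 := h1 N
  rw [hN, LinearMap.zero_apply] at h2
  rcases neg_one_pow_eq_or ℤ N with h3 | h3 <;> simpa [h3, eq_comm] using h2

/-- The diagonal torus is its own centralizer. -/
theorem IsReductiveStabilizer.eq_diagonal {p : ℕ} {c : n → I}
    {U : Submodule K (Matrix n n K)} (h : IsReductiveStabilizer p c U) {x : Matrix n n K}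
    (hx : x ∈ matrixStabilizer c U)
    (hxc : ∀ d : n → K, Matrix.diagonal d ∈ matrixStabilizer c U → Commute x (Matrix.diagonal d)) :
    ∃ d : n → K, x = Matrix.diagonal d := by
  classical
  obtain ⟨m, hm, d, -, hmn, hmx, hxm⟩ := h.toral x hx hxc
  suffices m = 0 from ⟨d, by rw [hxm, this, zero_add]⟩
  let T := {d : n → K // Matrix.diagonal d ∈ matrixStabilizer c U}
  let κ : n → T → K := fun s d => d.1 s
  have hmκ : m ∈ gradedPart K c κ 0 := fun s t hst => ⟨hm.1 s t hst, by
    rw [add_zero]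
    funext d
    refine commute_diagonal_iff.mp ?_ s t hst
    exact (Algebra.commute_of_mem_adjoin_singleton_of_commute hmx (hxc d.1 d.2).symm).symm⟩
  have hU : ∀ z, ∀ u ∈ U, component K κ z u ∈ U := by
    intro z u hu
    refine component_mem_of_separating (fun s t hst => ?_) hu
    obtain ⟨d, hd⟩ := Function.ne_iff.mp hst
    obtain ⟨φ, h1, h2, h3⟩ := exists_multiplier_of_diagonal d.2 (r := z d) (s := s) (t := t) hd
    exact ⟨φ, h1, fun s' t' h' => h2 s' t' (congrFun h' d), h3⟩
  obtain ⟨y, hy, hmy⟩ := h.pure m hm hmn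
  set y₀ := component K κ 0 y
  have hy₀ := component_mem_matrixStabilizer hU hy 0
  have hmy₀ : ⁅m, ⁅m, y₀⁆⁆ = m := by
    have h1 := congrArg (component K κ (0 + 0 + 0)) hmy
    rw [component_lie hmκ, component_lie hmκ] at h1
    rw [h1, add_zero, add_zero, component_eq_self hmκ]
  have hz : ⁅m, y₀⁆ ∈ gradedPart K c κ (0 + 0) :=
    lie_mem_gradedPart hmκ (component_mem_gradedPart_of_block κ 0 hy.1)
  obtain ⟨m', hm', d', hd', hmn', -, hmd'⟩ := h.toral _ (lie_mem_matrixStabilizer hm hy₀)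
    fun d hd => commute_diagonal_iff.mpr fun s t hst => by
      have := (hz s t hst).2
      rw [add_zero, add_zero] at this
      exact congrFun this ⟨d, hd⟩
  refine eq_zero_of_lie_eq_self hmn' ?_
  have h1 : ⁅m, Matrix.diagonal d'⁆ = 0 := by
    rw [← commute_iff_lie_eq]
    exact commute_diagonal_iff.mpr fun s t hst => by
      have := (hmκ s t hst).2
      rw [add_zero] at this
      exact congrFun this ⟨d', hd'⟩
  rw [hmd', lie_add, h1, add_zero] at hmy₀
  exact hmy₀

end Reductive

section IntegerLift

attribute [local instance] LieRing.ofAssociativeRing LieAlgebra.ofAssociativeAlgebra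

variable {K I n A : Type} [Field K] [AddCommGroup A]

/-- The eigenvalue of a highest weight vector is the residue of a small natural number. -/
theorem exists_eq_natCast_of_f_pow {X : Type} [AddCommGroup X] [Module K X] {p : ℕ} [CharP K p]
    {η : A →+ K} {α : A} (hη : η α = 2) {M : A → Submodule K X} {e f : End K X}
    (hf : ∀ ζ, ∀ x ∈ M ζ, f x ∈ M (ζ - α))
    (hef : ∀ ζ, ∀ x ∈ M ζ, e (f x) - f (e x) = η ζ • x) {ζ : A} {x : X} (hx : x ∈ M ζ)
    (hx0 : x ≠ 0) (hex : e x = 0) {N : ℕ} (hN : N < p) (hfN : (f ^ N) x = 0) :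
    ∃ i < N, η ζ = i := by
  classical
  have hfm : ∀ j : ℕ, (f ^ j) x ∈ M (ζ - j • α) := by
    intro j
    induction j with
    | zero => simpa using hx
    | succ j ih =>
      rw [pow_succ', Module.End.mul_apply, succ_nsmul, ← sub_sub]
      exact hf _ _ ih
  have hefp : ∀ j : ℕ, e ((f ^ (j + 1)) x) = ((j + 1 : K) * (η ζ - j)) • (f ^ j) x := by
    intro j
    induction j with
    | zero =>
      have := hef ζ x hx
      rw [hex, map_zero, sub_zero] at this
      simp [this]
    | succ j ih =>
      have h1 := hef _ _ (hfm (j + 1))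
      rw [sub_eq_iff_eq_add'] at h1
      rw [← f.apply_pow_apply, h1, ih, map_smul, f.apply_pow_apply, ← add_smul, map_sub, map_nsmul,
        hη, nsmul_eq_mul]
      congr 1
      push_cast
      ring
  have hex' : ∃ k, (f ^ k) x = 0 := ⟨N, hfN⟩
  obtain ⟨i, hi⟩ : ∃ i, Nat.find hex' = i + 1 := Nat.exists_eq_succ_of_ne_zero fun h => by
    have := Nat.find_spec hex'
    rw [h] at this
    exact hx0 (by simpa using this)
  have hiN : i < N := by
    have := Nat.find_min' hex' hfN
    omega
  refine ⟨i, hiN, ?_⟩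
  have h1 := Nat.find_spec hex'
  have h2 : (f ^ i) x ≠ 0 := Nat.find_min hex' (by omega)
  rw [hi] at h1
  have h3 := hefp i
  rw [h1, map_zero, eq_comm, smul_eq_zero] at h3
  have h4 : ((i : K) + 1) ≠ 0 := by
    have h5 := IsGradedSl2.intCast_ne_zero (K := K) (p := p) (d := i + 1) (by omega) (by omega)
    exact_mod_cast h5
  exact sub_eq_zero.mp ((mul_eq_zero.mp (h3.resolve_right h2)).resolve_left h4)

/-- Given a set of positions on a line without long runs, the distance of a position to the end of
its run. -/
theorem exists_run_length {P : A → Prop} {α : A} {m : ℕ} (hP : ∀ ζ, ∃ j ≤ m, ¬ P (ζ + j • α)) :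
    ∃ u : A → ℕ, (∀ ζ, P ζ → ∀ j ≤ u ζ, P (ζ + j • α)) ∧ (∀ ζ, ¬ P (ζ + (u ζ + 1) • α)) ∧
      ∀ ζ, P (ζ + α) → u ζ = u (ζ + α) + 1 := by
  classical
  have hex : ∀ ζ, ∃ j, ¬ P (ζ + (j + 1) • α) := fun ζ => by
    obtain ⟨j, -, hj⟩ := hP (ζ + α)
    exact ⟨j, by rwa [succ_nsmul', ← add_assoc]⟩
  refine ⟨fun ζ => Nat.find (hex ζ), fun ζ h0 j hj => ?_, fun ζ => Nat.find_spec (hex ζ), ?_⟩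
  · cases j with
    | zero => simpa using h0
    | succ j =>
      beta_reduce at hj
      exact not_not.mp (Nat.find_min (hex ζ) (by omega))
  · intro ζ h1
    rw [Nat.find_eq_iff]
    refine ⟨?_, fun j hj => not_not.mpr ?_⟩
    · have := Nat.find_spec (hex (ζ + α))
      rwa [add_assoc, ← succ_nsmul'] at this
    · cases j with
      | zero => simpa using h1
      | succ j =>
        beta_reduce at hj
        have := not_not.mp (Nat.find_min (hex (ζ + α)) (m := j) (by omega))
        rwa [add_assoc, ← succ_nsmul'] at this

/-- The vectors of weight `ζ` in the block `i`. -/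
def weightPart (K : Type) [Field K] (c : n → I) (κ : n → A) (i : I) (ζ : A) :
    Submodule K (n → K) where
  carrier := {v | ∀ t, v t ≠ 0 → c t = i ∧ κ t = ζ}
  add_mem' := fun {x y} hx hy t h => by
    by_cases h0 : x t = 0
    · exact hy t (by simpa [h0] using h)
    · exact hx t h0
  zero_mem' := fun t h => by simp at h
  smul_mem' := fun a x hx t h => hx t (right_ne_zero_of_mul (by simpa using h))

theorem weightPart_eq_bot {A : Type} {c : n → I} {κ : n → A} {i : I} {ζ : A}
    (h : ¬ ∃ t, c t = i ∧ κ t = ζ) :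
    weightPart K c κ i ζ = ⊥ := by
  rw [eq_bot_iff]
  intro v hv
  rw [Submodule.mem_bot]
  funext t
  by_contra h0
  exact h ⟨t, hv t h0⟩

variable [Fintype n] {c : n → I} {κ : n → A}

theorem mulVec_mem_weightPart {i : I} {α ζ : A} {x : Matrix n n K} {v : n → K}
    (hx : x ∈ gradedPart K c κ α) (hv : v ∈ weightPart K c κ i ζ) :
    x.mulVec v ∈ weightPart K c κ i (ζ + α) := by
  intro t h
  obtain ⟨r, -, hr⟩ := Finset.exists_ne_zero_of_sum_ne_zero h
  obtain ⟨h1, h2⟩ := hx t r (left_ne_zero_of_mul hr)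
  obtain ⟨h3, h4⟩ := hv r (right_ne_zero_of_mul hr)
  exact ⟨h1.trans h3, by rw [h2, h4]⟩

theorem exists_run_end {i : I} {α : A} {p : ℕ} (hα : ∀ j : ℕ, 0 < j → j < p → j • α ≠ 0)
    (hb : Nat.card {s // c s = i} < p) (ζ : A) :
    ∃ j ≤ Nat.card {s // c s = i}, ¬ ∃ t, c t = i ∧ κ t = ζ + j • α := by
  classical
  by_contra! h
  choose t ht using h
  have hinj : Function.Injective fun j : Fin (Nat.card {s // c s = i} + 1) =>
      (⟨t j.1 (by omega), (ht j.1 (by omega)).1⟩ : {s // c s = i}) := by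
    have key : ∀ j k : Fin (Nat.card {s // c s = i} + 1), j < k →
        t j.1 (by omega) ≠ t k.1 (by omega) := by
      intro j k hjk h
      have h1 := (ht j.1 (by omega)).2
      have h2 := (ht k.1 (by omega)).2
      rw [h, h2, add_right_inj] at h1
      refine hα (k.1 - j.1) (by omega) (by omega) ?_
      rw [sub_nsmul _ (by omega), h1, ← sub_eq_add_neg, sub_self]
    intro j k hjk
    have hjk' := congrArg Subtype.val hjk
    rcases lt_trichotomy j k with h | h | h
    · exact absurd hjk' (key j k h)
    · exact h
    · exact absurd hjk'.symm (key k j h)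
  have := Nat.card_le_card_of_injective _ hinj
  rw [Nat.card_eq_fintype_card, Fintype.card_fin] at this
  omega

/-- The eigenvalues of `[e, f]` lift to integers in such a way that `e` and `f` have degrees
`2` and `-2`. -/
theorem exists_integer_lift [DecidableEq n] {p : ℕ} [CharP K p] {α : A} {e f : Matrix n n K}
    {η : A →+ K} (he : e ∈ gradedPart K c κ α) (hf : f ∈ gradedPart K c κ (-α)) (hη : η α = 2)
    (hef : ⁅e, f⁆ = Matrix.diagonal fun s => η (κ s))
    (hα : ∀ j : ℕ, 0 < j → j < p → j • α ≠ 0)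
    (hb : ∀ i, 2 * Nat.card {s // c s = i} ≤ p + 1) (hp : 2 < p) :
    ∃ a : n → ℤ, (∀ s t, c s = c t → κ s = κ t + α → a s = a t + 2) ∧
      (∀ s, η (κ s) = a s) ∧ ∀ s, |a s| + 1 ≤ Nat.card {t // c t = c s} := by
  have hb' : ∀ i, Nat.card {s // c s = i} < p := fun i => by
    have := hb i
    omega
  have hα' : ∀ j : ℕ, 0 < j → j < p → j • (-α) ≠ 0 := fun j h1 h2 => by
    rw [smul_neg]
    exact neg_ne_zero.mpr (hα j h1 h2)
  choose u hu1 hu2 hu3 using fun i => exists_run_length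
    (P := fun ζ => ∃ t, c t = i ∧ κ t = ζ) (exists_run_end (κ := κ) hα (hb' i))
  choose d hd1 hd2 hd3 using fun i => exists_run_length
    (P := fun ζ => ∃ t, c t = i ∧ κ t = ζ) (exists_run_end (κ := κ) hα' (hb' i))
  have hcomm : ∀ i ζ, ∀ v ∈ weightPart K c κ i ζ,
      e.mulVecLin (f.mulVecLin v) - f.mulVecLin (e.mulVecLin v) = η ζ • v := by
    intro i ζ v hv
    have h1 : e.mulVec (f.mulVec v) - f.mulVec (e.mulVec v) = ⁅e, f⁆.mulVec v := by
      rw [Ring.lie_def, Matrix.sub_mulVec, Matrix.mulVec_mulVec, Matrix.mulVec_mulVec]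
    refine h1.trans ?_
    rw [hef]
    funext t
    rw [Matrix.mulVec_diagonal, Pi.smul_apply, smul_eq_mul]
    by_cases h0 : v t = 0
    · simp [h0]
    · rw [(hv t h0).2]
  have hem : ∀ i ζ, ∀ v ∈ weightPart K c κ i ζ, e.mulVecLin v ∈ weightPart K c κ i (ζ - -α) :=
    fun i ζ v hv => by
      rw [sub_neg_eq_add]
      exact mulVec_mem_weightPart he hv
  have hfm : ∀ i ζ, ∀ v ∈ weightPart K c κ i ζ, f.mulVecLin v ∈ weightPart K c κ i (ζ - α) :=
    fun i ζ v hv => by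
      rw [sub_eq_add_neg]
      exact mulVec_mem_weightPart hf hv
  have hpow : ∀ (g : End K (n → K)) i ζ (β : A)
      (_ : ∀ ζ, ∀ v ∈ weightPart K c κ i ζ, g v ∈ weightPart K c κ i (ζ + β)),
      ∀ v ∈ weightPart K c κ i ζ, ∀ j : ℕ, (g ^ j) v ∈ weightPart K c κ i (ζ + j • β) := by
    intro g i ζ β hg v hv j
    induction j with
    | zero => simpa using hv
    | succ j ih =>
      rw [pow_succ', Module.End.mul_apply, succ_nsmul, ← add_assoc]
      exact hg _ _ ih
  have hsingle : ∀ s : n, (Pi.single s 1 : n → K) ∈ weightPart K c κ (c s) (κ s) := by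
    intro s t ht
    rw [Pi.single_apply, ite_ne_right_iff] at ht
    rw [ht.1]
    exact ⟨rfl, rfl⟩
  have hlen : ∀ i ζ, (∃ t, c t = i ∧ κ t = ζ) → u i ζ + d i ζ + 1 ≤ Nat.card {t // c t = i} := by
    intro i ζ hζ
    by_contra! hlt
    obtain ⟨j, hj, hj'⟩ := exists_run_end (κ := κ) hα (hb' i) (ζ - d i ζ • α)
    apply hj'
    rcases le_total j (d i ζ) with h | h
    · have := hd1 i ζ hζ (d i ζ - j) (by omega)
      rwa [smul_neg, sub_nsmul _ h, neg_add, neg_neg, ← add_assoc, ← sub_eq_add_neg] at this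
    · have := hu1 i ζ hζ (j - d i ζ) (by omega)
      rwa [sub_nsmul _ h, add_comm (j • α), ← add_assoc, ← sub_eq_add_neg] at this
  refine ⟨fun s => d (c s) (κ s) - u (c s) (κ s), ?_, ?_, ?_⟩
  · intro s t hc hκ
    have h1 := hu3 (c t) (κ t) ⟨s, hc, hκ⟩
    have h2 := hd3 (c t) (κ s) ⟨t, rfl, by rw [hκ]; abel⟩
    rw [hκ, add_neg_cancel_right] at h2
    beta_reduce
    rw [hc, hκ, h1, h2]
    push_cast
    ring
  · intro s
    have hs := hlen (c s) (κ s) ⟨s, rfl, rfl⟩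
    set i := c s with hi
    set ζ := κ s with hζ
    have hbi := hb i
    obtain ⟨s', hs'c, hs'⟩ := hu1 i ζ ⟨s, rfl, rfl⟩ _ le_rfl
    obtain ⟨t', ht'c, ht'⟩ := hd1 i ζ ⟨s, rfl, rfl⟩ _ le_rfl
    have hpos1 : ¬ ∃ t, c t = i ∧ κ t = κ s' + α := by
      rw [hs', add_assoc, ← succ_nsmul]
      exact hu2 i ζ
    have hpos2 : ¬ ∃ t, c t = i ∧ κ t = κ t' + -α := by
      rw [ht', add_assoc, ← succ_nsmul]
      exact hd2 i ζ
    have hs's := hsingle s'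
    have ht's := hsingle t'
    rw [hs'c] at hs's
    rw [ht'c] at ht's
    obtain ⟨j, hj, hjs⟩ := exists_eq_natCast_of_f_pow (p := p) hη (hfm i) (hcomm i) hs's
      (by simp)
      (by
        have := mulVec_mem_weightPart he hs's
        rwa [weightPart_eq_bot hpos1, Submodule.mem_bot] at this)
      (N := u i ζ + d i ζ + 1) (by omega)
      (by
        have := hpow f.mulVecLin i _ (-α) (fun ζ v hv => mulVec_mem_weightPart hf hv) _ hs's
          (u i ζ + d i ζ + 1)
        rw [weightPart_eq_bot, Submodule.mem_bot] at this
        · exact this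
        · convert hd2 i ζ using 5
          rw [hs', add_assoc, add_assoc, add_nsmul (-α) (u i ζ), smul_neg (u i ζ),
            add_neg_cancel_left])
    obtain ⟨k, hk, hkt⟩ := exists_eq_natCast_of_f_pow (p := p) (η := -η) (α := -α)
      (by rw [AddMonoidHom.neg_apply, map_neg, neg_neg, hη]) (hem i)
      (fun ζ v hv => by
        rw [← neg_sub, hcomm i ζ v hv, AddMonoidHom.neg_apply, neg_smul]) ht's
      (by simp)
      (by
        have := mulVec_mem_weightPart hf ht's
        rwa [weightPart_eq_bot hpos2, Submodule.mem_bot] at this)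
      (N := u i ζ + d i ζ + 1) (by omega)
      (by
        have := hpow e.mulVecLin i _ α (fun ζ v hv => mulVec_mem_weightPart he hv) _ ht's
          (u i ζ + d i ζ + 1)
        rw [weightPart_eq_bot, Submodule.mem_bot] at this
        · exact this
        · convert hu2 i ζ using 5
          rw [ht', add_assoc, add_comm (u i ζ), add_assoc, add_nsmul α (d i ζ), smul_neg (d i ζ),
            neg_add_cancel_left])
    rw [hs', map_add, map_nsmul, hη, nsmul_eq_mul] at hjs
    rw [AddMonoidHom.neg_apply, ht', map_add, map_nsmul, map_neg, hη, nsmul_eq_mul] at hkt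
    have h1 : ((2 * (u i ζ + d i ζ) - (j + k) : ℤ) : K) = 0 := by
      push_cast
      rw [← hjs, ← hkt]
      ring
    have h2 : j = u i ζ + d i ζ := by
      by_contra h
      exact IsGradedSl2.intCast_ne_zero (K := K) (p := p) (by omega) (by omega) h1
    rw [h2] at hjs
    push_cast at hjs ⊢
    linear_combination hjs
  · intro s
    have hs := hlen (c s) (κ s) ⟨s, rfl, rfl⟩
    have : |(d (c s) (κ s) : ℤ) - u (c s) (κ s)| ≤ u (c s) (κ s) + d (c s) (κ s) := by
      rw [abs_le]
      constructor <;> omega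
    beta_reduce
    omega

end IntegerLift

section Roots

attribute [local instance] LieRing.ofAssociativeRing LieAlgebra.ofAssociativeAlgebra

variable {K I n : Type} [Field K] [Fintype n] [DecidableEq n] {c : n → I}
  {U : Submodule K (Matrix n n K)} {p : ℕ}

/-- If two operators restrict to operators of `U`, then `U` contains the component of lowest
degree of any of its elements with components in the two degrees `-q` and `p - q`. -/
theorem IsGradedSl2.mem_of_add_mem {X : Type} [AddCommGroup X] [Module K X] [CharP K p]
    {M : ℤ → Submodule K X} {e f : End K X} (h : IsGradedSl2 p (AddMonoidHom.id ℤ) 2 M e f)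
    {U : Submodule K X} [FiniteDimensional K U] (he : ∀ u ∈ U, e u ∈ U) (hf : ∀ u ∈ U, f u ∈ U)
    {q : ℕ} (hq : 0 < q) {x y : X} (hx : x ∈ M (-q)) (hy : y ∈ M (p - q)) (hxy : x + y ∈ U) :
    x ∈ U := by
  have hpow : ∀ (g : End K X) (_ : ∀ u ∈ U, g u ∈ U) (j : ℕ), ∀ u ∈ U, (g ^ j) u ∈ U := by
    intro g hg j u hu
    induction j with
    | zero => simpa using hu
    | succ j ih =>
      rw [pow_succ', Module.End.mul_apply]
      exact hg _ ih
  have hT : ∀ u ∈ U, (f ^ q * e ^ q) u ∈ U := fun u hu => hpow f hf q _ (hpow e he q u hu)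
  have hTM : ∀ u ∈ M (-q), (f ^ q * e ^ q) u ∈ M (-q) := by
    intro u hu
    have := h.f_pow_mem (h.e_pow_mem hu q) q
    rwa [add_sub_cancel_right] at this
  have hinj : ∀ u ∈ M (-q), (f ^ q * e ^ q) u = 0 → u = 0 := by
    intro u hu h0
    refine h.eq_zero_of_e_pow hu (j := q) (by simp) ?_
    refine h.eq_zero_of_f_pow (h.e_pow_mem hu q) (j := q) ?_ h0
    rw [AddMonoidHom.id_apply, nsmul_eq_mul]
    omega
  have hy0 : (e ^ q) y = 0 := by
    have := h.e_pow_mem hy q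
    rwa [h.bound, Submodule.mem_bot] at this
    rw [AddMonoidHom.id_apply, nsmul_eq_mul, le_abs]
    left
    omega
  let Z := U ⊓ M (-q)
  have hTZ : ∀ u ∈ Z, (f ^ q * e ^ q) u ∈ Z := fun u hu => ⟨hT u hu.1, hTM u hu.2⟩
  have hinjZ : Function.Injective ((f ^ q * e ^ q).restrict hTZ) := by
    rw [← LinearMap.ker_eq_bot, LinearMap.ker_eq_bot']
    rintro ⟨u, hu⟩ h0
    exact Subtype.ext (hinj u hu.2 (congrArg Subtype.val h0))
  have : FiniteDimensional K Z := Submodule.finiteDimensional_of_le (inf_le_left : Z ≤ U)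
  have hTx : (f ^ q * e ^ q) x ∈ Z := by
    refine ⟨?_, hTM x hx⟩
    have := hT _ hxy
    rwa [map_add, Module.End.mul_apply _ _ y, hy0, map_zero, add_zero] at this
  obtain ⟨⟨z, hz⟩, hzx⟩ := LinearMap.surjective_of_injective hinjZ ⟨_, hTx⟩
  have h1 : (f ^ q * e ^ q) z = (f ^ q * e ^ q) x := congrArg Subtype.val hzx
  have h2 := hinj (x - z) (sub_mem hx hz.2) (by rw [map_sub, h1, sub_self])
  rw [sub_eq_zero.mp h2]
  exact hz.1

/-- The integral lift of the grading by `[e, f]` is a grading of `U`. -/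
theorem component_mem_of_sl2 [CharP K p] {e f : Matrix n n K}
    (heU : e ∈ matrixStabilizer c U) (hfU : f ∈ matrixStabilizer c U) {a : n → ℤ}
    (he : e ∈ gradedPart K c a 2) (hf : f ∈ gradedPart K c a (-2))
    (hef : ⁅e, f⁆ = Matrix.diagonal fun s => (a s : K)) (ha : ∀ s t, a s - a t < p) (z : ℤ)
    {u : Matrix n n K} (hu : u ∈ U) : component K a z u ∈ U := by
  classical
  have hblock : ∀ {t x}, x ∈ gradedPart K c a t → x ∈ gradedPart K (fun _ => ()) a t :=
    fun hx s t hst => ⟨rfl, (hx s t hst).2⟩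
  have hsl : IsGradedSl2 p (AddMonoidHom.id ℤ) 2 (gradedPart K (fun _ => ()) a)
      (LieAlgebra.ad K (Matrix n n K) e) (LieAlgebra.ad K (Matrix n n K) f) :=
    isGradedSl2_gradedPart rfl (hblock he) (hblock hf) hef fun s t _ => ha s t
  have hd : Matrix.diagonal (fun s => (a s : K)) ∈ matrixStabilizer c U :=
    hef ▸ lie_mem_matrixStabilizer heU hfU
  have hres : ∀ r : K, component K (fun s => (a s : K)) r u ∈ U := fun r =>
    component_mem_of_separating (fun _ _ hst => exists_multiplier_of_diagonal hd hst) hu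
  have hzero : ∀ z : ℤ, (p : ℤ) ≤ |z| → component K a z u = 0 := by
    intro z hz
    have := component_mem_gradedPart a z u
    rwa [hsl.bound z hz, Submodule.mem_bot] at this
  have hiff : ∀ s t (z : ℤ), (a s : K) - a t = (z : K) ↔ (p : ℤ) ∣ a s - a t - z := fun s t z => by
    rw [← Int.cast_sub, ← sub_eq_zero, ← Int.cast_sub, CharP.intCast_eq_zero_iff K p]
  have hsum : ∀ z : ℤ, 0 < z → z < p → component K (fun s => (a s : K)) (z : K) u =
      component K a (z - p) u + component K a z u := by
    intro z hz0 hzp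
    ext s t
    simp only [Matrix.add_apply, component_apply]
    have h1 := ha s t
    have h2 := ha t s
    by_cases h3 : a s - a t = z
    · rw [if_pos ((hiff _ _ _).mpr (by simp [h3])), if_neg (by omega), if_pos h3, zero_add]
    by_cases h4 : a s - a t = z - p
    · rw [if_pos ((hiff _ _ _).mpr (by simp [h4])), if_pos h4, if_neg h3, add_zero]
    rw [if_neg, if_neg h4, if_neg h3, add_zero]
    rw [hiff]
    rintro ⟨k, hk⟩
    have h5 : k < 1 := by
      by_contra! h5
      have := mul_le_mul_of_nonneg_left h5 (Int.natCast_nonneg p)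
      omega
    have h6 : -2 < k := by
      by_contra! h6
      have := mul_le_mul_of_nonneg_left h6 (Int.natCast_nonneg p)
      omega
    obtain rfl | rfl : k = 0 ∨ k = -1 := by omega
    · omega
    · omega
  have hlow : ∀ q : ℕ, 0 < q → q < p → component K a (-q) u ∈ U := by
    intro q hq hqp
    refine hsl.mem_of_add_mem heU.2 hfU.2 hq (component_mem_gradedPart a _ u)
      (component_mem_gradedPart a _ u) ?_
    have := hsum (p - q) (by omega) (by omega)
    rw [sub_sub_cancel_left] at this
    rw [← this]
    exact hres _
  rcases le_or_gt (p : ℤ) |z| with hz | hz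
  · rw [hzero z hz]
    exact zero_mem _
  rw [abs_lt] at hz
  rcases lt_trichotomy z 0 with h0 | rfl | h0
  · have := hlow z.natAbs (by omega) (by omega)
    rwa [show -(z.natAbs : ℤ) = z by omega] at this
  · convert hres 0 using 1
    ext s t
    simp only [component_apply]
    have h1 := ha s t
    have h2 := ha t s
    have h0 := hiff s t 0
    rw [Int.cast_zero, sub_zero] at h0
    by_cases h3 : a s - a t = 0
    · rw [if_pos h3, if_pos (h0.mpr (by simp [h3]))]
    rw [if_neg h3, if_neg]
    intro h
    rw [h0] at h
    have := Int.le_of_dvd (abs_pos.mpr h3) ((dvd_abs _ _).mpr h)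
    rcases abs_cases (a s - a t) with h4 | h4 <;> omega
  · have h1 := hres z
    rw [hsum z h0 hz.2] at h1
    have h2 := hlow (p - z).natAbs (by omega) (by omega)
    rw [show -((p - z).natAbs : ℤ) = z - p by omega] at h2
    exact (Submodule.add_mem_iff_right _ h2).mp h1

/-- The group of weights: the values of the integral gradings of `U` and of the diagonal matrices
stabilizing `U`. -/
abbrev WeightGroup (c : n → I) (U : Submodule K (Matrix n n K)) : Type :=
  ({a : n → ℤ // ∀ z, ∀ u ∈ U, component K a z u ∈ U} → ℤ) ×
    ({d : n → K // Matrix.diagonal d ∈ matrixStabilizer c U} → K)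

/-- The weight of a basis vector. -/
def weight (c : n → I) (U : Submodule K (Matrix n n K)) (s : n) : WeightGroup c U :=
  (fun a => a.1 s, fun d => d.1 s)

theorem component_weight_mem [DecidableEq (WeightGroup c U)] (z : WeightGroup c U)
    {u : Matrix n n K} (hu : u ∈ U) : component K (weight c U) z u ∈ U := by
  refine component_mem_of_separating (fun s t hst => ?_) hu
  by_cases h : (weight c U s - weight c U t).1 = z.1
  · obtain ⟨d, hd⟩ := Function.ne_iff.mp fun h' => hst (Prod.ext h h')
    obtain ⟨φ, h1, h2, h3⟩ := exists_multiplier_of_diagonal d.2 (r := z.2 d) (s := s) (t := t) hd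
    exact ⟨φ, h1, fun s' t' h' => h2 s' t' (congrFun (congrArg Prod.snd h') d), h3⟩
  · obtain ⟨a, ha⟩ := Function.ne_iff.mp h
    refine ⟨Matrix.of fun s' t' => if a.1 s' - a.1 t' = z.1 a then 1 else 0, fun u hu => ?_,
      fun s' t' h' => if_pos (congrFun (congrArg Prod.fst h') a), if_neg ha⟩
    convert a.2 (z.1 a) u hu using 1
    ext s' t'
    rw [Matrix.hadamard_apply, Matrix.of_apply, component_apply, ite_mul, one_mul, zero_mul]

theorem IsReductiveStabilizer.eq_diagonal_of_mem (h : IsReductiveStabilizer p c U)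
    {x : Matrix n n K} (hx : x ∈ matrixStabilizer c U)
    (hx0 : x ∈ gradedPart K c (weight c U) 0) : ∃ d : n → K, x = Matrix.diagonal d := by
  refine h.eq_diagonal hx fun d hd => commute_diagonal_iff.mpr fun s t hst => ?_
  have := (hx0 s t hst).2
  rw [add_zero] at this
  exact congrFun (congrArg Prod.snd this) ⟨d, hd⟩

theorem nsmul_ne_zero_of_charP {X Y : Type} [CharP K p] {α : (X → ℤ) × (Y → K)} (hα : α ≠ 0)
    {j : ℕ} (hj : 0 < j) (hjp : j < p) : j • α ≠ 0 := by
  intro h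
  apply hα
  ext x
  · have := congrFun (congrArg Prod.fst h) x
    simpa [hj.ne'] using this
  · have := congrFun (congrArg Prod.snd h) x
    have h1 := IsGradedSl2.intCast_ne_zero (K := K) (p := p) (d := j) (by omega) (by omega)
    rw [Int.cast_natCast] at h1
    simpa [h1] using this

theorem pow_mem_gradedPart {A : Type} [AddCommGroup A] {κ : n → A} {α : A}
    {e : Matrix n n K}
    (he : e ∈ gradedPart K c κ α) (j : ℕ) : e ^ j ∈ gradedPart K c κ (j • α) := by
  induction j with
  | zero =>
    intro s t hst
    rw [pow_zero, Matrix.one_apply, ite_ne_right_iff] at hst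
    simp [hst.1]
  | succ j ih =>
    rw [pow_succ, succ_nsmul]
    exact mul_mem_gradedPart ih he

theorem isNilpotent_of_mem_gradedPart {A : Type} [AddCommGroup A] {κ : n → A} {α : A}
    {e : Matrix n n K} (he : e ∈ gradedPart K c κ α)
    (hα : ∀ j : ℕ, 0 < j → j < p → j • α ≠ 0) (hb : ∀ i, Nat.card {s // c s = i} < p) :
    IsNilpotent e := by
  refine ⟨p, ?_⟩
  ext s t
  by_contra hst
  obtain ⟨j, hj, hj'⟩ := exists_run_end (κ := κ) hα (hb (c t)) (κ t)
  apply hj'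
  have hjp : j ≤ p := hj.trans (hb (c t)).le
  rw [← Nat.sub_add_cancel hjp, pow_add, Matrix.mul_apply] at hst
  obtain ⟨r, -, hr⟩ := Finset.exists_ne_zero_of_sum_ne_zero hst
  exact ⟨r, pow_mem_gradedPart he j r t (right_ne_zero_of_mul hr)⟩

/-- Each root vector of the stabilizer is part of an integrally graded `sl₂`-triple. -/
theorem IsReductiveStabilizer.exists_sl2 [CharP K p] (h : IsReductiveStabilizer p c U)
    (hp : 2 < p) {α : WeightGroup c U} (hα : α ≠ 0) {e : Matrix n n K}
    (heG : e ∈ matrixStabilizer c U) (he : e ∈ gradedPart K c (weight c U) α) (he0 : e ≠ 0) :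
    ∃ f ∈ matrixStabilizer c U, f ∈ gradedPart K c (weight c U) (-α) ∧
      ∃ co : WeightGroup c U →+ ℤ, co α = 2 ∧
        ⁅e, f⁆ = Matrix.diagonal (fun s => (co (weight c U s) : K)) ∧
        ∀ s, |co (weight c U s)| + 1 ≤ Nat.card {t // c t = c s} := by
  classical
  have hb' : ∀ i, Nat.card {s // c s = i} < p := fun i => by
    have := h.block_le i
    omega
  have hα' : ∀ j : ℕ, 0 < j → j < p → j • α ≠ 0 := fun j h1 h2 => nsmul_ne_zero_of_charP hα h1 h2
  obtain ⟨y, hy, hey⟩ := h.pure e heG (isNilpotent_of_mem_gradedPart he hα' hb')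
  set y' := component K (weight c U) (-α) y
  have hy'G : y' ∈ matrixStabilizer c U :=
    component_mem_matrixStabilizer (fun z u hu => component_weight_mem z hu) hy _
  have hy' : y' ∈ gradedPart K c (weight c U) (-α) := component_mem_gradedPart_of_block _ _ hy.1
  have hey' : ⁅e, ⁅e, y'⁆⁆ = e := by
    have h1 := congrArg (component K (weight c U) (-α + α + α)) hey
    rwa [component_lie he, component_lie he, neg_add_cancel, zero_add, component_eq_self he] at h1
  set f := (-2 : K) • y'
  have hfG : f ∈ matrixStabilizer c U := Submodule.smul_mem _ _ hy'G
  have hf : f ∈ gradedPart K c (weight c U) (-α) := Submodule.smul_mem _ _ hy'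
  have hefe : ⁅⁅e, f⁆, e⁆ = (2 : K) • e := by
    rw [← lie_skew, lie_smul, lie_smul, hey', neg_smul, neg_neg]
  have hef0 := lie_mem_gradedPart he hf
  rw [add_neg_cancel] at hef0
  obtain ⟨d, hd⟩ := h.eq_diagonal_of_mem (lie_mem_matrixStabilizer heG hfG) hef0
  have hdG : Matrix.diagonal d ∈ matrixStabilizer c U := hd ▸ lie_mem_matrixStabilizer heG hfG
  obtain ⟨s₀, t₀, hst₀⟩ : ∃ s t, e s t ≠ 0 := by
    by_contra! h0
    exact he0 (Matrix.ext h0)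
  let η : WeightGroup c U →+ K :=
    { toFun := fun ζ => ζ.2 ⟨d, hdG⟩
      map_zero' := rfl
      map_add' := fun _ _ => rfl }
  have hη : η α = 2 := by
    have h1 := congrArg η (he s₀ t₀ hst₀).2
    have h2 := congrFun (congrFun hefe s₀) t₀
    rw [hd, lie_diagonal_apply, Matrix.smul_apply, smul_eq_mul] at h2
    have h3 := mul_right_cancel₀ hst₀ h2
    rw [map_add] at h1
    have h4 : d s₀ = d t₀ + η α := h1
    rw [← h3, h4]
    ring
  obtain ⟨a, ha1, ha2, ha3⟩ := exists_integer_lift (p := p) (η := η) he hf hη hd hα' h.block_le hp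
  have ha2' : ∀ s, d s = a s := ha2
  have hea : e ∈ gradedPart K c a 2 := fun s t hst =>
    ⟨(he s t hst).1, ha1 s t (he s t hst).1 (he s t hst).2⟩
  have hfa : f ∈ gradedPart K c a (-2) := fun s t hst => by
    have h1 := hf s t hst
    have h2 := ha1 t s h1.1.symm (by rw [h1.2]; abel)
    exact ⟨h1.1, by omega⟩
  have hef' : ⁅e, f⁆ = Matrix.diagonal fun s => (a s : K) := by
    rw [hd]
    congr 1
    funext s
    exact ha2' s
  have haX : ∀ z, ∀ u ∈ U, component K a z u ∈ U := fun z u hu =>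
    component_mem_of_sl2 (p := p) heG hfG hea hfa hef' (fun s t => by
      have h1 := ha3 s
      have h2 := ha3 t
      have h3 := h.block_le (c s)
      have h4 := h.block_le (c t)
      have h5 := le_abs_self (a s)
      have h6 := neg_abs_le (a t)
      omega) z hu
  refine ⟨f, hfG, hf, ⟨⟨fun ζ => ζ.1 ⟨a, haX⟩, rfl⟩, fun _ _ => rfl⟩, ?_, hef', ha3⟩
  have h1 := congrFun (congrArg Prod.fst (he s₀ t₀ hst₀).2) ⟨a, haX⟩
  have h2 : a s₀ = a t₀ + α.1 ⟨a, haX⟩ := h1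
  have h3 := (hea s₀ t₀ hst₀).2
  change α.1 ⟨a, haX⟩ = 2
  omega

end Roots

section RootTriples

attribute [local instance] LieRing.ofAssociativeRing LieAlgebra.ofAssociativeAlgebra

variable {K I n : Type} [Field K] [Fintype n] [DecidableEq n] {c : n → I}
  {U : Submodule K (Matrix n n K)} {p : ℕ}

/-- The root vectors of the stabilizer of degree `α`. -/
def rootSpace (c : n → I) (U : Submodule K (Matrix n n K)) (α : WeightGroup c U) :
    Submodule K (Matrix n n K) :=
  matrixStabilizer c U ⊓ gradedPart K c (weight c U) α

/-- A root of the stabilizer: a nonzero degree in which it is nonzero. -/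
def IsRoot (c : n → I) (U : Submodule K (Matrix n n K)) (α : WeightGroup c U) : Prop :=
  α ≠ 0 ∧ ∃ e ∈ rootSpace c U α, e ≠ 0

/-- An integrally graded `sl₂`-triple attached to a root. -/
structure RootTriple (c : n → I) (U : Submodule K (Matrix n n K)) (α : WeightGroup c U) where
  /-- the raising element -/
  e : Matrix n n K
  /-- the lowering element -/
  f : Matrix n n K
  /-- the coroot -/
  co : WeightGroup c U →+ ℤ
  e_mem : e ∈ rootSpace c U α
  f_mem : f ∈ rootSpace c U (-α)
  e_ne_zero : e ≠ 0
  co_self : co α = 2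
  lie_eq : ⁅e, f⁆ = Matrix.diagonal fun s => (co (weight c U s) : K)
  co_le : ∀ s, |co (weight c U s)| + 1 ≤ Nat.card {t // c t = c s}

theorem lie_mem_rootSpace {α β : WeightGroup c U} {x y : Matrix n n K}
    (hx : x ∈ rootSpace c U α) (hy : y ∈ rootSpace c U β) : ⁅x, y⁆ ∈ rootSpace c U (α + β) :=
  ⟨lie_mem_matrixStabilizer hx.1 hy.1, lie_mem_gradedPart hx.2 hy.2⟩

theorem IsReductiveStabilizer.exists_rootTriple [CharP K p] (h : IsReductiveStabilizer p c U)
    (hp : 2 < p) {α : WeightGroup c U} (hα : IsRoot c U α) : Nonempty (RootTriple c U α) := by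
  obtain ⟨hα0, e, he, he0⟩ := hα
  obtain ⟨f, hfG, hf, co, h1, h2, h3⟩ := h.exists_sl2 hp hα0 he.1 he.2 he0
  exact ⟨⟨e, f, co, he, ⟨hfG, hf⟩, he0, h1, h2, h3⟩⟩

namespace RootTriple

variable {α : WeightGroup c U}

theorem ne_zero (t : RootTriple c U α) : α ≠ 0 := by
  rintro rfl
  simpa using t.co_self

theorem isRoot (t : RootTriple c U α) : IsRoot c U α := ⟨t.ne_zero, t.e, t.e_mem, t.e_ne_zero⟩

theorem isGradedSl2 (t : RootTriple c U α) (h : IsReductiveStabilizer p c U) :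
    IsGradedSl2 p t.co α (gradedPart K (fun _ => ()) (weight c U))
      (LieAlgebra.ad K (Matrix n n K) t.e) (LieAlgebra.ad K (Matrix n n K) t.f) := by
  have hblock : ∀ {α x}, x ∈ rootSpace c U α → x ∈ gradedPart K (fun _ => ()) (weight c U) α :=
    fun hx s t hst => ⟨rfl, (hx.2 s t hst).2⟩
  refine isGradedSl2_gradedPart t.co_self (hblock t.e_mem) (hblock t.f_mem) t.lie_eq
    fun s s' _ => ?_
  have h1 := t.co_le s
  have h2 := t.co_le s'
  have h3 := h.block_le (c s)
  have h4 := h.block_le (c s')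
  have h5 := le_abs_self (t.co (weight c U s))
  have h6 := neg_abs_le (t.co (weight c U s'))
  omega

theorem f_ne_zero (t : RootTriple c U α) [CharP K p] (h : IsReductiveStabilizer p c U) :
    t.f ≠ 0 := by
  intro hf
  refine t.e_ne_zero ((t.isGradedSl2 h).eq_zero_of_e_f (ζ := α)
    (fun s t' hst => ⟨rfl, (t.e_mem.2 s t' hst).2⟩) t.co_self.ge ?_)
  rw [hf]
  simp

/-- The triple of the opposite root. -/
def symm (t : RootTriple c U α) [CharP K p] (h : IsReductiveStabilizer p c U) :
    RootTriple c U (-α) where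
  e := t.f
  f := t.e
  co := -t.co
  e_mem := t.f_mem
  f_mem := by
    rw [neg_neg]
    exact t.e_mem
  e_ne_zero := t.f_ne_zero h
  co_self := by simp [t.co_self]
  lie_eq := by
    rw [← lie_skew, t.lie_eq, Matrix.diagonal_neg]
    congr 1
    funext s
    simp
  co_le s := by simpa using t.co_le s

theorem isGradedSl2_weightPart (t : RootTriple c U α) {J : Type} {b : n → J}
    (hb : ∀ s s', c s = c s' → b s = b s')
    (h : IsReductiveStabilizer p c U) (hp : 2 < p) (i : J) :
    IsGradedSl2 p t.co α (weightPart K b (weight c U) i) (Matrix.toLin' t.e)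
      (Matrix.toLin' t.f) where
  deg_ι := t.co_self
  e_mem ζ x hx := by
    rw [Matrix.toLin'_apply]
    exact mulVec_mem_weightPart
      (fun s s' hs => ⟨hb _ _ (t.e_mem.2 s s' hs).1, (t.e_mem.2 s s' hs).2⟩) hx
  f_mem ζ x hx := by
    rw [Matrix.toLin'_apply, sub_eq_add_neg]
    exact mulVec_mem_weightPart
      (fun s s' hs => ⟨hb _ _ (t.f_mem.2 s s' hs).1, (t.f_mem.2 s s' hs).2⟩) hx
  comm ζ x hx := by
    simp only [Matrix.toLin'_apply, Matrix.mulVec_mulVec]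
    rw [← Matrix.sub_mulVec, ← Ring.lie_def, t.lie_eq]
    funext s
    rw [Matrix.mulVec_diagonal, Pi.smul_apply, smul_eq_mul]
    by_cases hs : x s = 0
    · simp [hs]
    · rw [(hx s hs).2]
  bound ζ hζ := by
    refine weightPart_eq_bot ?_
    rintro ⟨s, -, rfl⟩
    have h1 := t.co_le s
    have h3 := h.block_le (c s)
    omega

/-- Root spaces are lines. -/
theorem exists_eq_smul (t : RootTriple c U α) [CharP K p] (h : IsReductiveStabilizer p c U)
    (hp : 2 < p)
    {x : Matrix n n K} (hx : x ∈ rootSpace c U α) : ∃ r : K, x = r • t.e := by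
  have h0 := lie_mem_rootSpace t.f_mem hx
  rw [neg_add_cancel] at h0
  obtain ⟨d, hd⟩ := h.eq_diagonal_of_mem h0.1 h0.2
  have hdG : Matrix.diagonal d ∈ matrixStabilizer c U := hd ▸ h0.1
  have hde : ⁅t.e, Matrix.diagonal d⁆ = -(α.2 ⟨d, hdG⟩ • t.e) := by
    rw [← lie_skew]
    congr 1
    ext s s'
    rw [lie_diagonal_apply, Matrix.smul_apply, smul_eq_mul]
    by_cases hs : t.e s s' = 0
    · simp [hs]
    · have h1 := congrFun (congrArg Prod.snd (t.e_mem.2 s s' hs).2) ⟨d, hdG⟩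
      have h2 : d s = d s' + α.2 ⟨d, hdG⟩ := h1
      rw [h2]
      ring
  have h2K : (2 : K) ≠ 0 := by
    have := IsGradedSl2.intCast_ne_zero (K := K) (p := p) (d := 2) (by omega) (by omega)
    exact_mod_cast this
  have hgr := t.isGradedSl2 h
  have heM : t.e ∈ gradedPart K (fun _ => ()) (weight c U) α :=
    fun s t' hst => ⟨rfl, (t.e_mem.2 s t' hst).2⟩
  have hxM : x ∈ gradedPart K (fun _ => ()) (weight c U) α :=
    fun s t' hst => ⟨rfl, (hx.2 s t' hst).2⟩
  have hfe : ⁅t.e, ⁅t.f, t.e⁆⁆ = (2 : K) • t.e := by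
    have := hgr.comm _ _ heM
    simpa [t.co_self] using this
  refine ⟨-(α.2 ⟨d, hdG⟩) / 2, sub_eq_zero.mp (hgr.eq_zero_of_e_f (ζ := α)
    (sub_mem hxM (Submodule.smul_mem _ _ heM)) t.co_self.ge ?_)⟩
  simp only [LieAlgebra.ad_apply, lie_sub, lie_smul]
  rw [hfe, hd, hde, smul_smul, div_mul_cancel₀ _ h2K, neg_smul, sub_self]

theorem isRoot_sub_nsmul (t : RootTriple c U α) [CharP K p] (h : IsReductiveStabilizer p c U)
    {γ : WeightGroup c U} (hγ : IsRoot c U γ) {j : ℕ} (hj : j ≤ t.co γ) (h0 : γ - j • α ≠ 0) :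
    IsRoot c U (γ - j • α) := by
  obtain ⟨-, x, hx, hx0⟩ := hγ
  have hxM : x ∈ gradedPart K (fun _ => ()) (weight c U) γ :=
    fun s t' hst => ⟨rfl, (hx.2 s t' hst).2⟩
  refine ⟨h0, (LieAlgebra.ad K (Matrix n n K) t.f ^ j) x, ?_, fun h1 =>
    hx0 ((t.isGradedSl2 h).eq_zero_of_f_pow hxM hj h1)⟩
  clear hj h0
  induction j with
  | zero => simpa using hx
  | succ j ih =>
    rw [pow_succ', Module.End.mul_apply, LieAlgebra.ad_apply,
      show γ - (j + 1) • α = -α + (γ - j • α) by rw [succ_nsmul]; abel]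
    exact lie_mem_rootSpace t.f_mem ih

theorem isRoot_add_nsmul (t : RootTriple c U α) [CharP K p] (h : IsReductiveStabilizer p c U)
    {γ : WeightGroup c U} (hγ : IsRoot c U γ) {j : ℕ} (hj : j ≤ -t.co γ) (h0 : γ + j • α ≠ 0) :
    IsRoot c U (γ + j • α) := by
  have := (t.symm h).isRoot_sub_nsmul h hγ (j := j) (by simpa [symm] using hj) (by simpa using h0)
  simpa using this

theorem not_isRoot_two_nsmul (t : RootTriple c U α) [CharP K p] (h : IsReductiveStabilizer p c U)
    (hp : 2 < p) :
    ¬ IsRoot c U (2 • α) := by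
  rintro ⟨-, x, hx, hx0⟩
  have h1 := lie_mem_rootSpace t.f_mem hx
  rw [two_nsmul, neg_add_cancel_left] at h1
  obtain ⟨r, hr⟩ := t.exists_eq_smul h hp h1
  refine hx0 ((t.isGradedSl2 h).eq_zero_of_e_f (ζ := 2 • α)
    (fun s t' hst => ⟨rfl, (hx.2 s t' hst).2⟩) (by
      rw [map_nsmul, t.co_self]
      norm_num) ?_)
  simp [hr]

end RootTriple

end RootTriples

section Pairings

attribute [local instance] LieRing.ofAssociativeRing LieAlgebra.ofAssociativeAlgebra

variable {K I n : Type} [Field K] [Fintype n] {c : n → I}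
  {U : Submodule K (Matrix n n K)} {p : ℕ}

theorem finrank_weightPart {A J : Type} {b : n → J} {κ : n → A} {i : J} {ζ : A} :
    finrank K (weightPart K b κ i ζ) = Nat.card {s // b s = i ∧ κ s = ζ} := by
  classical
  have e : weightPart K b κ i ζ ≃ₗ[K] ({s // b s = i ∧ κ s = ζ} → K) :=
    { toFun := fun v s => v.1 s.1
      map_add' := fun _ _ => rfl
      map_smul' := fun _ _ => rfl
      invFun := fun w => ⟨fun s => if hs : b s = i ∧ κ s = ζ then w ⟨s, hs⟩ else 0, fun s hs => by
        by_contra h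
        simp [h] at hs⟩
      left_inv := fun v => by
        ext s
        by_cases hs : b s = i ∧ κ s = ζ
        · simp [hs]
        · have : v.1 s = 0 := by
            by_contra h
            exact hs (v.2 s h)
          simp [hs, this]
      right_inv := fun w => by
        funext s
        simp [s.2] }
  rw [e.finrank_eq, finrank_pi, Nat.card_eq_fintype_card]

variable [DecidableEq n]

namespace RootTriple

variable {α β γ : WeightGroup c U}

theorem card_weight_le [CharP K p] (t : RootTriple c U α) (h : IsReductiveStabilizer p c U)
    (hp : 2 < p) (ζ : WeightGroup c U) :
    Nat.card {s // weight c U s = ζ} ≤ Nat.card {s // weight c U s = ζ - t.co ζ • α} := by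
  have key : ∀ {α : WeightGroup c U} (t : RootTriple c U α), 0 ≤ t.co ζ →
      Nat.card {s // weight c U s = ζ} ≤ Nat.card {s // weight c U s = ζ - t.co ζ • α} := by
    intro α t h0
    obtain ⟨j, hj⟩ := Int.eq_ofNat_of_zero_le h0
    have hgr := t.isGradedSl2_weightPart (b := fun _ => ()) (fun _ _ _ => rfl) h hp ()
    rw [hj, natCast_zsmul]
    have hcard : ∀ ζ, Nat.card {s // weight c U s = ζ} =
        finrank K (weightPart K (fun _ => ()) (weight c U) () ζ) := fun ζ => by
      rw [finrank_weightPart]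
      simp
    rw [hcard, hcard]
    refine LinearMap.finrank_le_finrank_of_injective
      (f := (Matrix.toLin' t.f ^ j).restrict fun x hx => hgr.f_pow_mem hx j) ?_
    rw [← LinearMap.ker_eq_bot, LinearMap.ker_eq_bot']
    rintro ⟨x, hx⟩ hx0
    exact Subtype.ext (hgr.eq_zero_of_f_pow hx hj.ge (congrArg Subtype.val hx0))
  rcases le_total 0 (t.co ζ) with h0 | h0
  · exact key t h0
  · have := key (t.symm h) (by simpa [symm] using h0)
    simpa [symm] using this

theorem co_reflection (t : RootTriple c U α) (ζ : WeightGroup c U) :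
    t.co (ζ - t.co ζ • α) = -t.co ζ := by
  rw [map_sub, map_zsmul, t.co_self, smul_eq_mul]
  ring

theorem card_weight_reflection [CharP K p] (t : RootTriple c U α)
    (h : IsReductiveStabilizer p c U) (hp : 2 < p) (ζ : WeightGroup c U) :
    Nat.card {s // weight c U s = ζ - t.co ζ • α} = Nat.card {s // weight c U s = ζ} := by
  refine le_antisymm ?_ (t.card_weight_le h hp ζ)
  have := t.card_weight_le h hp (ζ - t.co ζ • α)
  rwa [t.co_reflection, neg_smul, sub_neg_eq_add, sub_add_cancel] at this

/-- Sums over the weights are invariant under reflections. -/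
theorem sum_reflection [CharP K p] (t : RootTriple c U α) (h : IsReductiveStabilizer p c U)
    (hp : 2 < p) (F : WeightGroup c U → ℤ) :
    ∑ s, F (weight c U s - t.co (weight c U s) • α) = ∑ s, F (weight c U s) := by
  classical
  have hcard : ∀ ζ, (Finset.univ.filter fun s => weight c U s = ζ).card =
      Nat.card {s // weight c U s = ζ} := fun ζ => by
    rw [Nat.card_eq_fintype_card, Fintype.card_subtype]
  rw [Finset.sum_comp (fun ζ => F (ζ - t.co ζ • α)) (weight c U), Finset.sum_comp F (weight c U)]
  have hmem : ∀ ζ ∈ Finset.univ.image (weight c U),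
      ζ - t.co ζ • α ∈ Finset.univ.image (weight c U) := by
    intro ζ hζ
    obtain ⟨s, -, rfl⟩ := Finset.mem_image.mp hζ
    have h1 := t.card_weight_reflection h hp (weight c U s)
    have h2 : 0 < Nat.card {s' // weight c U s' = weight c U s} :=
      Nat.card_pos_iff.mpr ⟨⟨s, rfl⟩, inferInstance⟩
    rw [← h1] at h2
    obtain ⟨⟨s', hs'⟩⟩ := (Nat.card_pos_iff.mp h2).1
    exact Finset.mem_image.mpr ⟨s', Finset.mem_univ _, hs'⟩
  have hinv : ∀ ζ, ζ - t.co ζ • α - t.co (ζ - t.co ζ • α) • α = ζ := fun ζ => by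
    rw [t.co_reflection, neg_smul, sub_neg_eq_add, sub_add_cancel]
  refine Finset.sum_nbij' (fun ζ => ζ - t.co ζ • α) (fun ζ => ζ - t.co ζ • α) hmem hmem
    (fun ζ _ => hinv ζ) (fun ζ _ => hinv ζ) fun ζ _ => ?_
  rw [hcard, hcard, t.card_weight_reflection h hp]

/-- The pairings of two roots are proportional, with a positive ratio. -/
theorem exists_co_mul_eq [CharP K p] (h : IsReductiveStabilizer p c U) (hp : 2 < p)
    (t : RootTriple c U α) (t' : RootTriple c U β) :
    ∃ x y : ℤ, 0 < x ∧ 0 < y ∧ t.co β * x = t'.co α * y := by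
  have hpos : ∀ {α : WeightGroup c U} (t : RootTriple c U α),
      0 < ∑ s, t.co (weight c U s) * t.co (weight c U s) := by
    intro α t
    obtain ⟨s, s', hs⟩ : ∃ s s', t.e s s' ≠ 0 := by
      by_contra! h0
      exact t.e_ne_zero (Matrix.ext h0)
    have h1 := congrArg t.co (t.e_mem.2 s s' hs).2
    rw [map_add, t.co_self] at h1
    have h2 : ∀ s ∈ Finset.univ, 0 ≤ t.co (weight c U s) * t.co (weight c U s) :=
      fun s _ => mul_self_nonneg _
    refine (Finset.sum_pos_iff_of_nonneg h2).mpr ?_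
    by_cases h3 : t.co (weight c U s) = 0
    · exact ⟨s', Finset.mem_univ _, mul_self_pos.mpr (by omega)⟩
    · exact ⟨s, Finset.mem_univ _, mul_self_pos.mpr h3⟩
  have key : ∀ {α β : WeightGroup c U} (t : RootTriple c U α) (t' : RootTriple c U β),
      t.co β * ∑ s, t'.co (weight c U s) * t'.co (weight c U s) =
        2 * ∑ s, t.co (weight c U s) * t'.co (weight c U s) := by
    intro α β t t'
    have h1 := t'.sum_reflection h hp fun ζ => t.co ζ * t'.co ζ
    have h2 : ∀ s, t.co (weight c U s - t'.co (weight c U s) • β) *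
        t'.co (weight c U s - t'.co (weight c U s) • β) =
        t.co β * (t'.co (weight c U s) * t'.co (weight c U s)) -
          t.co (weight c U s) * t'.co (weight c U s) := fun s => by
      rw [t'.co_reflection, map_sub, map_zsmul, smul_eq_mul]
      ring
    simp only [h2, Finset.sum_sub_distrib, ← Finset.mul_sum] at h1
    linarith
  refine ⟨_, _, hpos t', hpos t, ?_⟩
  rw [key t t', key t' t]
  simp only [mul_comm]

theorem co_pos [CharP K p] (h : IsReductiveStabilizer p c U) (hp : 2 < p)
    (t : RootTriple c U α) (t' : RootTriple c U β) (h0 : 0 < t.co β) : 0 < t'.co α := by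
  obtain ⟨x, y, hx, hy, hxy⟩ := exists_co_mul_eq h hp t t'
  exact pos_of_mul_pos_left (hxy ▸ mul_pos h0 hx) hy.le

theorem co_nonneg [CharP K p] (h : IsReductiveStabilizer p c U) (hp : 2 < p)
    (t : RootTriple c U α) (t' : RootTriple c U β) (h0 : 0 ≤ t.co β) : 0 ≤ t'.co α := by
  obtain ⟨x, y, hx, hy, hxy⟩ := exists_co_mul_eq h hp t t'
  exact nonneg_of_mul_nonneg_left (hxy ▸ mul_nonneg h0 hx.le) hy

theorem co_le_three [CharP K p] (h : IsReductiveStabilizer p c U) (hp : 2 < p)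
    (t : RootTriple c U β) (hγ : IsRoot c U γ) (hne : γ ≠ 2 • β) : t.co γ ≤ 3 := by
  by_contra! h4
  obtain ⟨tγ⟩ := h.exists_rootTriple hp hγ
  obtain ⟨tδ⟩ := h.exists_rootTriple hp
    (t.isRoot_sub_nsmul h hγ (j := 2) (by push_cast; omega) (sub_ne_zero.mpr hne))
  have h1 := co_nonneg h hp t tδ (by
    rw [map_sub, map_nsmul, t.co_self, nsmul_eq_mul]
    push_cast
    omega)
  have h2 := (map_sub tδ.co γ (2 • β)).symm.trans tδ.co_self
  have h6 : tδ.co (2 • β) = 2 * tδ.co β := by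
    simpa only [nsmul_eq_mul, Nat.cast_ofNat] using map_nsmul tδ.co 2 β
  have h3 := co_pos h hp tδ tγ (by omega)
  rw [map_sub, map_nsmul, tγ.co_self, nsmul_eq_mul, Nat.cast_ofNat] at h3
  have h5 := co_pos h hp t tγ (by omega)
  omega

/-- Roots are separated by the rays spanned by their pairings. -/
theorem eq_of_proportional [CharP K p] (h : IsReductiveStabilizer p c U) (hp : 2 < p)
    (hβ : IsRoot c U β) (hγ : IsRoot c U γ) {x y : ℚ} (hx : 0 < x) (hy : 0 < y)
    (hxy : ∀ (δ : WeightGroup c U) (t : RootTriple c U δ), t.co γ * y = t.co β * x) : γ = β := by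
  obtain ⟨tβ⟩ := h.exists_rootTriple hp hβ
  obtain ⟨tγ⟩ := h.exists_rootTriple hp hγ
  have h1 := hxy _ tβ
  have h2 := hxy _ tγ
  rw [tβ.co_self] at h1
  rw [tγ.co_self] at h2
  push_cast at h1 h2
  have h3 : (0 : ℚ) < tβ.co γ := pos_of_mul_pos_left (h1 ▸ by positivity) hy.le
  have h4 : (0 : ℚ) < tγ.co β := pos_of_mul_pos_left (h2 ▸ by positivity) hx.le
  have h5 : (tβ.co γ : ℚ) * tγ.co β = 4 := by
    have : (tβ.co γ : ℚ) * tγ.co β * (x * y) = 4 * (x * y) := by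
      linear_combination (tγ.co β : ℚ) * x * h1 - 2 * x * h2
    exact mul_right_cancel₀ (by positivity) this
  have h6 : tβ.co γ ≤ 3 := co_le_three h hp tβ hγ fun h0 =>
    tβ.not_isRoot_two_nsmul h hp (h0 ▸ hγ)
  have h7 : tγ.co β ≤ 3 := co_le_three h hp tγ hβ fun h0 =>
    tγ.not_isRoot_two_nsmul h hp (h0 ▸ hβ)
  have h8 : 0 < tβ.co γ := by exact_mod_cast h3
  have h9 : 0 < tγ.co β := by exact_mod_cast h4
  have h10 : tβ.co γ * tγ.co β = 4 := by exact_mod_cast h5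
  have h11 : tβ.co γ = 2 := by
    generalize tβ.co γ = u at *
    generalize tγ.co β = v at *
    interval_cases u <;> omega
  have hxy' : x = y := by
    rw [h11] at h1
    push_cast at h1
    linarith
  by_contra hne
  obtain ⟨tδ⟩ := h.exists_rootTriple hp
    (tβ.isRoot_sub_nsmul h hγ (j := 1) (by push_cast; omega)
      (by rwa [one_smul, sub_ne_zero]))
  have h12 := hxy _ tδ
  rw [hxy', mul_right_cancel_iff_of_pos hy] at h12
  have h13 := (map_sub tδ.co γ (1 • β)).symm.trans tδ.co_self
  have h14 : tδ.co γ = tδ.co β := by exact_mod_cast h12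
  have h15 : tδ.co (1 • β) = tδ.co β := congrArg tδ.co (one_smul ℕ β)
  omega

end RootTriple

end Pairings

section Transport

attribute [local instance] LieRing.ofAssociativeRing LieAlgebra.ofAssociativeAlgebra

variable {K V I n : Type} [Field K] [AddCommGroup V] [Module K V] [Fintype n] [DecidableEq n]

theorem toMatrixAlgEquiv_lie (b : Basis n K V) (x y : End K V) :
    LinearMap.toMatrixAlgEquiv b ⁅x, y⁆ =
      ⁅LinearMap.toMatrixAlgEquiv b x, LinearMap.toMatrixAlgEquiv b y⁆ := by
  simp [Ring.lie_def]

theorem toMatrixAlgEquiv_eq_diagonal_iff {b : Basis n K V} {x : End K V} {d : n → K} :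
    LinearMap.toMatrixAlgEquiv b x = Matrix.diagonal d ↔ ∀ s, x (b s) = d s • b s := by
  constructor
  · intro h s
    refine b.repr.injective (Finsupp.ext fun t => ?_)
    rw [← LinearMap.toMatrixAlgEquiv_apply, h, map_smul, b.repr_self]
    by_cases hst : t = s
    · simp [hst]
    · simp [hst]
  · intro h
    ext t s
    rw [LinearMap.toMatrixAlgEquiv_apply, h s, map_smul, b.repr_self]
    by_cases hst : t = s
    · simp [hst]
    · simp [hst]

theorem toMatrixAlgEquiv_mem_matrixStabilizer_iff [Finite I] {W : I → Submodule K V}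
    (hW : iSupIndep W) {c : n → I} {b : Basis n K V} (hb : IsAdapted W c b)
    {U : Submodule K (End K V)} {x : End K V} :
    LinearMap.toMatrixAlgEquiv b x ∈
      matrixStabilizer c (U.map (LinearMap.toMatrixAlgEquiv b).toLinearMap) ↔
      x ∈ lieStabilizer W U := by
  classical
  constructor
  · rintro ⟨h1, h2⟩
    refine ⟨fun i v hv => ?_, fun u hu => ?_⟩
    · rw [← b.sum_repr v, map_sum]
      refine sum_mem fun s _ => ?_
      rw [map_smul]
      by_cases hs : b.repr v s = 0
      · rw [hs, zero_smul]
        exact zero_mem _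
      refine Submodule.smul_mem _ _ ?_
      rw [← b.sum_repr (x (b s))]
      refine sum_mem fun t _ => ?_
      rw [← LinearMap.toMatrixAlgEquiv_apply]
      by_cases ht : LinearMap.toMatrixAlgEquiv b x t s = 0
      · rw [ht, zero_smul]
        exact zero_mem _
      refine Submodule.smul_mem _ _ ?_
      rw [← hb.eq_of_repr_ne_zero hW hv hs, ← h1 t s ht]
      exact hb t
    · obtain ⟨w, hw, hwu⟩ := h2 _ ⟨u, hu, rfl⟩
      have h3 : LinearMap.toMatrixAlgEquiv b w = LinearMap.toMatrixAlgEquiv b ⁅x, u⁆ := by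
        rw [toMatrixAlgEquiv_lie]
        exact hwu
      rwa [← (LinearMap.toMatrixAlgEquiv b).injective h3]
  · intro hx
    refine ⟨fun s t hst => ?_, ?_⟩
    · rw [LinearMap.toMatrixAlgEquiv_apply] at hst
      exact hb.eq_of_repr_ne_zero hW (hx.1 _ _ (hb t)) hst
    · rintro _ ⟨u, hu, rfl⟩
      exact ⟨_, hx.2 u hu, toMatrixAlgEquiv_lie b x u⟩

/-- In a suitable basis adapted to the blocks, the stabilizer of an `H`-stable space of
endomorphisms is reductive. -/
theorem exists_isReductiveStabilizer [IsAlgClosed K] [FiniteDimensional K V] [Finite I] {p : ℕ}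
    [CharP K p] {W : I → Submodule K V}
    (hW : iSupIndep W) (hW' : iSup W = ⊤) (hdim : ∀ i, 2 * finrank K (W i) ≤ p + 1)
    {H : Subgroup (V ≃ₗ[K] V)} (hH : ∀ i, ∀ h ∈ H, ∀ v ∈ W i, h v ∈ W i)
    (hirr : ∀ i, ∀ Z ≤ W i, (∀ h ∈ H, ∀ v ∈ Z, h v ∈ Z) → Z = ⊥ ∨ Z = W i)
    {U : Submodule K (End K V)} (hU : ∀ h ∈ H, ∀ u ∈ U, conjEnd h u ∈ U) :
    ∃ (n : Type) (_ : Fintype n) (_ : DecidableEq n) (c : n → I) (b : Basis n K V),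
      IsAdapted W c b ∧
      IsReductiveStabilizer p c (U.map (LinearMap.toMatrixAlgEquiv b).toLinearMap) := by
  classical
  cases nonempty_fintype I
  obtain ⟨n, _, c, b, hb, htoral⟩ := exists_toral_basis hW hW' U
  refine ⟨n, inferInstance, inferInstance, c, b, hb, ?_⟩
  set M := LinearMap.toMatrixAlgEquiv b with hM
  have hmem : ∀ x, M x ∈ matrixStabilizer c (U.map M.toLinearMap) ↔ x ∈ lieStabilizer W U :=
    fun x => toMatrixAlgEquiv_mem_matrixStabilizer_iff hW hb
  refine ⟨fun i => ?_, fun e he hnil => ?_, fun x hx hxc => ?_⟩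
  · rw [Nat.card_eq_fintype_card, ← hb.finrank_eq hW i]
    exact hdim i
  · obtain ⟨e, rfl⟩ := M.surjective e
    obtain ⟨y, hy, hey⟩ := exists_lie_lie_eq (p := p) hW hW' hdim hH hirr hU ((hmem e).mp he)
      ((IsNilpotent.map_iff M.injective).mp hnil)
    exact ⟨M y, (hmem y).mpr hy, by
      rw [← toMatrixAlgEquiv_lie, ← toMatrixAlgEquiv_lie, hey]⟩
  · obtain ⟨x, rfl⟩ := M.surjective x
    obtain ⟨m, hm, y, hy, ⟨d, hd⟩, hmn, hmx, hxm⟩ :=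
        htoral x ((hmem x).mp hx) fun y hy ⟨d, hd⟩ => by
      have h1 := toMatrixAlgEquiv_eq_diagonal_iff.mpr hd
      have h2 := hxc d (by rw [← h1]; exact (hmem y).mpr hy)
      rw [← h1] at h2
      exact (commute_map_iff M.injective).mp h2
    have h1 := toMatrixAlgEquiv_eq_diagonal_iff.mpr hd
    refine ⟨M m, (hmem m).mpr hm, d, by rw [← h1]; exact (hmem y).mpr hy, hmn.map M, ?_, ?_⟩
    · have h2 : M m ∈ (Algebra.adjoin K {x}).map (M : End K V →ₐ[K] Matrix n n K) := ⟨m, hmx, rfl⟩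
      rwa [AlgHom.map_adjoin, Set.image_singleton] at h2
    · rw [← h1, hxm, map_add]

end Transport

section DegreeBound

attribute [local instance] LieRing.ofAssociativeRing LieAlgebra.ofAssociativeAlgebra

variable {K I n : Type} [Field K] {c : n → I}
  {U : Submodule K (Matrix n n K)} {p : ℕ}

theorem exists_of_mem_weightPart {J A : Type} {b : n → J} {κ : n → A} {i : J} {ζ : A} {v : n → K}
    (hv : v ∈ weightPart K b κ i ζ) (h0 : v ≠ 0) : ∃ s, b s = i ∧ κ s = ζ := by
  obtain ⟨s, hs⟩ := Function.ne_iff.mp h0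
  exact ⟨s, hv s hs⟩

variable [Fintype n] [DecidableEq n]

namespace RootTriple

variable {β γ : WeightGroup c U}

theorem exists_isMax [CharP K p] (t : RootTriple c U β) (h : IsReductiveStabilizer p c U)
    (hp : 2 < p) : ∃ s₁, 1 ≤ t.co (weight c U s₁) ∧
      ∀ s, |t.co (weight c U s)| ≤ t.co (weight c U s₁) := by
  obtain ⟨s, s', hs⟩ : ∃ s s', t.e s s' ≠ 0 := by
    by_contra! h0
    exact t.e_ne_zero (Matrix.ext h0)
  have h1 := congrArg t.co (t.e_mem.2 s s' hs).2
  rw [map_add, t.co_self] at h1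
  obtain ⟨s₀, -, hs₀⟩ := Finset.exists_max_image Finset.univ
    (fun s => |t.co (weight c U s)|) ⟨s, Finset.mem_univ _⟩
  have h2 := hs₀ s (Finset.mem_univ _)
  have h3 := hs₀ s' (Finset.mem_univ _)
  have h4 : 1 ≤ |t.co (weight c U s₀)| := by
    rcases abs_cases (t.co (weight c U s)) with h5 | h5 <;>
      rcases abs_cases (t.co (weight c U s')) with h6 | h6 <;> omega
  rcases le_or_gt 0 (t.co (weight c U s₀)) with h0 | h0
  · rw [abs_of_nonneg h0] at h4
    exact ⟨s₀, h4, fun s => (hs₀ s (Finset.mem_univ _)).trans_eq (abs_of_nonneg h0)⟩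
  · have h5 := t.card_weight_reflection h hp (weight c U s₀)
    have h6 : 0 < Nat.card {s' // weight c U s' = weight c U s₀} :=
      Nat.card_pos_iff.mpr ⟨⟨s₀, rfl⟩, inferInstance⟩
    rw [← h5] at h6
    obtain ⟨⟨s₁, hs₁⟩⟩ := (Nat.card_pos_iff.mp h6).1
    refine ⟨s₁, ?_⟩
    rw [hs₁, t.co_reflection, ← abs_of_neg h0]
    exact ⟨h4, fun s => hs₀ s (Finset.mem_univ _)⟩

theorem exists_weight_sub [CharP K p] (t : RootTriple c U β) (h : IsReductiveStabilizer p c U)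
    (hp : 2 < p) (s : n) {j : ℕ} (hj : j ≤ t.co (weight c U s)) :
    ∃ s', c s' = c s ∧ weight c U s' = weight c U s - j • β := by
  have hgr := t.isGradedSl2_weightPart (b := c) (fun _ _ h => h) h hp (c s)
  have hv : Pi.single s (1 : K) ∈ weightPart K c (weight c U) (c s) (weight c U s) := by
    intro s' hs'
    have : s' = s := by
      by_contra hne
      exact hs' (Pi.single_eq_of_ne hne 1)
    exact ⟨congrArg c this, congrArg _ this⟩
  refine exists_of_mem_weightPart (hgr.f_pow_mem hv j) fun h0 => ?_
  have := congrFun (hgr.eq_zero_of_f_pow hv hj h0) s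
  simp at this

theorem exists_weight_add [CharP K p] (t : RootTriple c U β) (h : IsReductiveStabilizer p c U)
    (hp : 2 < p) (s : n) {j : ℕ} (hj : j ≤ -t.co (weight c U s)) :
    ∃ s', c s' = c s ∧ weight c U s' = weight c U s + j • β := by
  have := (t.symm h).exists_weight_sub h hp s (j := j) (by simpa [symm] using hj)
  simpa using this

theorem sum_co_le [CharP K p] (t : RootTriple c U β) (h : IsReductiveStabilizer p c U)
    (hp : 2 < p) {R : Finset (WeightGroup c U)}
    (hR : ∀ γ, γ ∈ R → IsRoot c U γ ∧ 0 < t.co γ ∧ γ ≠ β ∧ γ ≠ 2 • β)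
    (hR' : ∀ γ ∈ R, t.co γ = 3 → γ - β ∈ R) : ∑ γ ∈ R, t.co γ ≤ 2 * R.card := by
  classical
  have h1 : ∀ γ ∈ R, t.co γ ≤
      2 + ((if t.co γ = 3 then 1 else 0) - (if t.co γ = 1 then 1 else 0) : ℤ) := by
    intro γ hγ
    obtain ⟨h2, h3, -, h4⟩ := hR γ hγ
    have h5 := t.co_le_three h hp h2 h4
    split_ifs <;> omega
  refine (Finset.sum_le_sum h1).trans ?_
  rw [Finset.sum_add_distrib, Finset.sum_sub_distrib, Finset.sum_const, Finset.sum_boole,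
    Finset.sum_boole, nsmul_eq_mul]
  have h2 : (R.filter fun γ => t.co γ = 3).card ≤ (R.filter fun γ => t.co γ = 1).card := by
    refine Finset.card_le_card_of_injOn (fun γ => γ - β) (fun γ hγ => ?_)
      fun x _ y _ hxy => sub_left_injective hxy
    have h3 := Finset.mem_filter.mp hγ
    refine Finset.mem_filter.mpr ⟨hR' γ h3.1 h3.2, ?_⟩
    rw [map_sub, t.co_self, h3.2]
    norm_num
  have h3 : ((R.filter fun γ => t.co γ = 3).card : ℤ) ≤ (R.filter fun γ => t.co γ = 1).card := by
    exact_mod_cast h2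
  linarith

/-- The degrees occurring in the exterior algebra on the roots on one side of `β`, tensored with
the matrices, are smaller than `p`. -/
theorem co_sub_add_sum_lt [CharP K p] (t : RootTriple c U β) (h : IsReductiveStabilizer p c U)
    (hp : 2 < p) {ψ : WeightGroup c U →+ ℚ} (hψ : ψ β = 0) {S : Finset (WeightGroup c U)}
    (hS : ∀ γ ∈ S, IsRoot c U γ ∧ 0 < ψ γ) {Φ : Finset (WeightGroup c U)}
    (hΦ : ∀ γ, IsRoot c U γ → γ ∈ Φ) (s s' : n) :
    t.co (weight c U s) - t.co (weight c U s') + ∑ γ ∈ S, t.co γ < p := by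
  classical
  obtain ⟨s₁, ha1, hmax⟩ := t.exists_isMax h hp
  obtain ⟨a, ha⟩ := Int.eq_ofNat_of_zero_le (zero_le_one.trans ha1)
  set κ := weight c U s₁ with hκ
  let R := Φ.filter fun γ => IsRoot c U γ ∧ 0 < ψ γ ∧ 0 < t.co γ
  have hR : ∀ {γ}, γ ∈ R ↔ IsRoot c U γ ∧ 0 < ψ γ ∧ 0 < t.co γ := fun {γ} => by
    rw [Finset.mem_filter]
    exact ⟨And.right, fun h => ⟨hΦ γ h.1, h⟩⟩
  have hne : ∀ {γ}, γ ∈ R → ∀ j : ℕ, γ ≠ j • β := by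
    rintro γ hγ j rfl
    have := (hR.mp hγ).2.1
    rw [map_nsmul, hψ, smul_zero] at this
    exact this.false
  have hsum : ∑ γ ∈ R, t.co γ ≤ 2 * R.card := by
    refine t.sum_co_le h hp (fun γ hγ => ⟨(hR.mp hγ).1, (hR.mp hγ).2.2,
      by simpa using hne hγ 1, hne hγ 2⟩) fun γ hγ h3 => ?_
    have h4 := t.isRoot_sub_nsmul h (hR.mp hγ).1 (j := 1) (by push_cast; omega)
      (sub_ne_zero.mpr (hne hγ 1))
    rw [one_smul] at h4
    refine hR.mpr ⟨h4, ?_, ?_⟩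
    · rw [map_sub, hψ, sub_zero]
      exact (hR.mp hγ).2.1
    · rw [map_sub, t.co_self, h3]
      norm_num
  have hSR : ∑ γ ∈ S, t.co γ ≤ ∑ γ ∈ R, t.co γ := by
    rw [← Finset.sum_filter_add_sum_filter_not S (fun γ => 0 < t.co γ)]
    have h1 : ∑ γ ∈ S.filter (fun γ => ¬ 0 < t.co γ), t.co γ ≤ 0 :=
      Finset.sum_nonpos fun γ hγ => not_lt.mp (Finset.mem_filter.mp hγ).2
    have h2 : ∑ γ ∈ S.filter (fun γ => 0 < t.co γ), t.co γ ≤ ∑ γ ∈ R, t.co γ := by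
      refine Finset.sum_le_sum_of_subset_of_nonneg (fun γ hγ => ?_)
        fun γ hγ _ => (hR.mp hγ).2.2.le
      obtain ⟨h3, h4⟩ := Finset.mem_filter.mp hγ
      exact hR.mpr ⟨(hS γ h3).1, (hS γ h3).2, h4⟩
    linarith
  have hz : ∀ γ ∈ R, ∃ z, (∃ s, c s = c s₁ ∧ weight c U s = z) ∧
      (z = κ - γ ∨ z = κ + γ - β) := by
    intro γ hγ
    obtain ⟨hγr, hγψ, hγ0⟩ := hR.mp hγ
    obtain ⟨tγ⟩ := h.exists_rootTriple hp hγr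
    have h0 : 0 ≤ tγ.co κ := by
      by_contra! hlt
      obtain ⟨s, -, hs⟩ := tγ.exists_weight_add h hp s₁ (j := 1) (by
        rw [← hκ]
        push_cast
        omega)
      have h1 := hmax s
      rw [hs, ← hκ, map_add, one_smul] at h1
      have := le_abs_self (t.co κ + t.co γ)
      omega
    rcases h0.eq_or_lt with h0 | h0
    · obtain ⟨s, hs1, hs2⟩ := t.exists_weight_sub h hp s₁ (j := 1) (by exact_mod_cast ha1)
      have h1 := co_pos h hp t tγ hγ0
      obtain ⟨s', hs1', hs2'⟩ := tγ.exists_weight_add h hp s (j := 1) (by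
        rw [hs2, map_sub, ← h0, one_smul]
        push_cast
        omega)
      refine ⟨_, ⟨s', hs1'.trans hs1, rfl⟩, .inr ?_⟩
      rw [hs2', hs2, one_smul, one_smul]
      abel
    · obtain ⟨s, hs1, hs2⟩ := tγ.exists_weight_sub h hp s₁ (j := 1) (by exact_mod_cast h0)
      rw [one_smul] at hs2
      exact ⟨_, ⟨s, hs1, rfl⟩, .inl hs2⟩
  choose! z hz hz' using hz
  let P := (Finset.univ.filter fun s => c s = c s₁).image (weight c U)
  have hP : P.card ≤ Nat.card {s // c s = c s₁} := by
    rw [Nat.card_eq_fintype_card, Fintype.card_subtype]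
    exact Finset.card_image_le
  have hmemP : ∀ {ζ}, (∃ s, c s = c s₁ ∧ weight c U s = ζ) → ζ ∈ P := by
    rintro ζ ⟨s, hs, rfl⟩
    exact Finset.mem_image_of_mem _ (Finset.mem_filter.mpr ⟨Finset.mem_univ _, hs⟩)
  let C := (Finset.range (a + 1)).image fun j => κ - j • β
  have hC : C.card = a + 1 := by
    rw [Finset.card_image_of_injective, Finset.card_range]
    intro j j' hj
    have := congrArg t.co hj
    rw [map_sub, map_sub, map_nsmul, map_nsmul, t.co_self, nsmul_eq_mul, nsmul_eq_mul] at this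
    omega
  have hCψ : ∀ ζ ∈ C, ψ ζ = ψ κ := by
    intro ζ hζ
    obtain ⟨j, -, rfl⟩ := Finset.mem_image.mp hζ
    rw [map_sub, map_nsmul, hψ, smul_zero, sub_zero]
  have hzψ : ∀ γ ∈ R, ψ (z γ) ≠ ψ κ := by
    intro γ hγ
    have := (hR.mp hγ).2.1
    rcases hz' γ hγ with h1 | h1 <;> rw [h1] <;> simp only [map_sub, map_add, hψ] <;>
      intro h2 <;> linarith
  have hZ : (R.image z).card = R.card := by
    refine Finset.card_image_of_injOn fun γ hγ γ' hγ' hzz => ?_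
    have h1 := (hR.mp hγ).2.1
    have h2 := (hR.mp hγ').2.1
    have h3 := congrArg ψ hzz
    rcases hz' γ hγ with h4 | h4 <;> rcases hz' γ' hγ' with h5 | h5 <;> rw [h4, h5] at h3 hzz <;>
      simp only [map_sub, map_add, hψ] at h3
    · exact sub_right_injective hzz
    · linarith
    · linarith
    · exact add_right_injective _ (sub_left_injective hzz)
  have hdisj : Disjoint C (R.image z) := by
    rw [Finset.disjoint_left]
    intro ζ hζ hζ'
    obtain ⟨γ, hγ, rfl⟩ := Finset.mem_image.mp hζ'
    exact hzψ γ hγ (hCψ _ hζ)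
  have hle : (C ∪ R.image z).card ≤ P.card := by
    refine Finset.card_le_card (Finset.union_subset (fun ζ hζ => ?_) fun ζ hζ => ?_)
    · obtain ⟨j, hj, rfl⟩ := Finset.mem_image.mp hζ
      rw [Finset.mem_range] at hj
      exact hmemP (t.exists_weight_sub h hp s₁ (by rw [ha]; omega))
    · obtain ⟨γ, hγ, rfl⟩ := Finset.mem_image.mp hζ
      exact hmemP (hz γ hγ)
  rw [Finset.card_union_of_disjoint hdisj, hC, hZ] at hle
  have h1 := h.block_le (c s₁)
  have h2 := (abs_le.mp (hmax s)).2
  have h3 := (abs_le.mp (hmax s')).1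
  omega

end RootTriple

end DegreeBound

section ChevalleyEilenberg

open ExteriorAlgebra

variable {K L : Type} [Field K] [LieRing L] [LieAlgebra K L]

theorem ExteriorAlgebra.ι_mul_ι_mul_comm {L : Type} [AddCommGroup L] [Module K L] (x y : L)
    (w : ExteriorAlgebra K L) : ι K x * (ι K y * w) = -(ι K y * (ι K x * w)) := by
  have h := ι_add_mul_swap (R := K) x y
  rw [← mul_assoc, ← mul_assoc, eq_neg_iff_add_eq_zero, ← add_mul, h, zero_mul]

theorem ExteriorAlgebra.ι_mul_ι_mul_self {L : Type} [AddCommGroup L] [Module K L] (x : L)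
    (w : ExteriorAlgebra K L) : ι K x * (ι K x * w) = 0 := by
  rw [← mul_assoc, ι_sq_zero, zero_mul]

/-- Linear maps out of the exterior algebra which vanish on `1` are determined by recursion on left
multiplication. -/
theorem ExteriorAlgebra.linearMap_ext_left {L N : Type} [AddCommGroup L] [Module K L]
    [AddCommGroup N] [Module K N]
    {φ φ' : ExteriorAlgebra K L →ₗ[K] N} (h1 : φ 1 = φ' 1)
    (h : ∀ x w, φ w = φ' w → φ (ι K x * w) = φ' (ι K x * w)) : φ = φ' := by
  refine LinearMap.ext fun w => ?_
  induction w using CliffordAlgebra.left_induction with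
  | algebraMap r => rw [Algebra.algebraMap_eq_smul_one, map_smul, map_smul, h1]
  | add a b ha hb => rw [map_add, map_add, ha, hb]
  | ι_mul w x hw => exact h x w hw

/-- The action of `x` on the exterior algebra, as an auxiliary map. -/
noncomputable def exteriorLieAux (x : L) : ExteriorAlgebra K L →ₗ[K] ExteriorAlgebra K L :=
  CliffordAlgebra.foldr' 0
    (LinearMap.mk₂ K (fun (y : L) (w : ExteriorAlgebra K L × ExteriorAlgebra K L) =>
      ι K ⁅x, y⁆ * w.1 + ι K y * w.2)
      (fun _ _ _ => by
        simp only [lie_add, map_add, add_mul]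
        abel)
      (fun _ _ _ => by simp only [lie_smul, map_smul, smul_mul_assoc, smul_add])
      (fun _ _ _ => by
        simp only [Prod.fst_add, Prod.snd_add, mul_add]
        abel)
      fun _ _ _ => by simp only [Prod.smul_fst, Prod.smul_snd, mul_smul_comm, smul_add])
    (fun y w w' => by
      simp only [LinearMap.mk₂_apply]
      change ι K ⁅x, y⁆ * (ι K y * w) + ι K y * (ι K ⁅x, y⁆ * w + ι K y * w') = _
      rw [mul_add, ι_mul_ι_mul_self, ι_mul_ι_mul_comm]
      simp)
    0

theorem exteriorLieAux_one (x : L) : exteriorLieAux (K := K) x 1 = 0 :=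
  CliffordAlgebra.foldr'_algebraMap _ _ _ _ 1 |>.trans (by simp)

theorem exteriorLieAux_ι_mul (x y : L) (w : ExteriorAlgebra K L) :
    exteriorLieAux x (ι K y * w) = ι K ⁅x, y⁆ * w + ι K y * exteriorLieAux x w :=
  CliffordAlgebra.foldr'_ι_mul _ _ _ _ _ _

/-- The action of a Lie algebra on its exterior algebra by derivations. -/
noncomputable def exteriorLie :
    L →ₗ[K] ExteriorAlgebra K L →ₗ[K] ExteriorAlgebra K L where
  toFun := exteriorLieAux
  map_add' x x' := linearMap_ext_left (by simp [exteriorLieAux_one]) fun y w h => by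
    rw [LinearMap.add_apply] at h ⊢
    simp only [exteriorLieAux_ι_mul, h, add_lie, map_add, add_mul, mul_add]
    abel
  map_smul' r x := linearMap_ext_left (by simp [exteriorLieAux_one]) fun y w h => by
    rw [LinearMap.smul_apply] at h ⊢
    simp only [exteriorLieAux_ι_mul, h, smul_lie, map_smul, smul_mul_assoc, mul_smul_comm,
      smul_add, RingHom.id_apply]

theorem exteriorLie_one (x : L) : exteriorLie (K := K) x 1 = 0 := exteriorLieAux_one x

theorem exteriorLie_ι_mul (x y : L) (w : ExteriorAlgebra K L) :
    exteriorLie x (ι K y * w) = ι K ⁅x, y⁆ * w + ι K y * exteriorLie x w :=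
  exteriorLieAux_ι_mul x y w

theorem exteriorLie_ι (x y : L) : exteriorLie x (ι K y) = ι K ⁅x, y⁆ := by
  simpa [exteriorLie_one] using exteriorLie_ι_mul x y (1 : ExteriorAlgebra K L)

theorem exteriorLie_lie (x y : L) (w : ExteriorAlgebra K L) :
    exteriorLie x (exteriorLie y w) - exteriorLie y (exteriorLie x w) = exteriorLie ⁅x, y⁆ w := by
  refine LinearMap.congr_fun (f := exteriorLie x ∘ₗ exteriorLie y - exteriorLie y ∘ₗ exteriorLie x)
    (g := exteriorLie ⁅x, y⁆) (linearMap_ext_left (by simp [exteriorLie_one]) fun z w h => ?_) w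
  simp only [LinearMap.sub_apply, LinearMap.comp_apply] at h ⊢
  simp only [exteriorLie_ι_mul, map_add, ← h, lie_lie, map_sub, sub_mul, mul_sub]
  abel

/-- The Chevalley-Eilenberg differential. -/
noncomputable def exteriorDiff : ExteriorAlgebra K L →ₗ[K] ExteriorAlgebra K L :=
  CliffordAlgebra.foldr' 0
    (LinearMap.mk₂ K (fun (y : L) (w : ExteriorAlgebra K L × ExteriorAlgebra K L) =>
      exteriorLie y w.1 - ι K y * w.2)
      (fun _ _ _ => by
        simp only [map_add, add_mul, LinearMap.add_apply]
        abel)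
      (fun _ _ _ => by simp only [map_smul, smul_mul_assoc, smul_sub, LinearMap.smul_apply])
      (fun _ _ _ => by
        simp only [Prod.fst_add, Prod.snd_add, mul_add, map_add]
        abel)
      fun _ _ _ => by simp only [Prod.smul_fst, Prod.smul_snd, mul_smul_comm, smul_sub, map_smul])
    (fun y w w' => by
      simp only [LinearMap.mk₂_apply]
      change exteriorLie y (ι K y * w) - ι K y * (exteriorLie y w - ι K y * w') = _
      rw [mul_sub, ι_mul_ι_mul_self, exteriorLie_ι_mul, lie_self]
      simp)
    0

theorem exteriorDiff_one : exteriorDiff (K := K) (L := L) 1 = 0 :=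
  CliffordAlgebra.foldr'_algebraMap _ _ _ _ 1 |>.trans (by simp)

theorem exteriorDiff_ι_mul (y : L) (w : ExteriorAlgebra K L) :
    exteriorDiff (ι K y * w) = exteriorLie y w - ι K y * exteriorDiff w :=
  CliffordAlgebra.foldr'_ι_mul _ _ _ _ _ _

theorem exteriorDiff_ι (y : L) : exteriorDiff (ι K y) = 0 := by
  simpa [exteriorLie_one, exteriorDiff_one] using
    exteriorDiff_ι_mul y (1 : ExteriorAlgebra K L)

theorem exteriorDiff_exteriorLie (x : L) (w : ExteriorAlgebra K L) :
    exteriorDiff (exteriorLie x w) = exteriorLie x (exteriorDiff w) := by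
  refine LinearMap.congr_fun (f := exteriorDiff ∘ₗ exteriorLie x)
    (g := exteriorLie x ∘ₗ exteriorDiff)
    (linearMap_ext_left (by simp [exteriorLie_one, exteriorDiff_one]) fun z w h => ?_) w
  simp only [LinearMap.comp_apply] at h ⊢
  simp only [exteriorLie_ι_mul, exteriorDiff_ι_mul, map_add, map_sub, h, ← exteriorLie_lie]
  abel

end ChevalleyEilenberg

section ExteriorSpan

open ExteriorAlgebra

variable {K L A : Type} [Field K] [LieRing L] [LieAlgebra K L] [AddCommGroup A]

/-- The elements of degree `ζ` in the span of the products `e γ₁ ∧ ⋯ ∧ e γ_q ∧ u` with `γᵢ ∈ R` and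
`u` in the graded family `N`. -/
noncomputable def exteriorSpan (e : A → L) (N : A → Submodule K L) (R : Finset A) :
    ℕ → A → Submodule K (ExteriorAlgebra K L)
  | 0, ζ => (N ζ).map (ι K)
  | q + 1, ζ => ⨆ γ : R, (exteriorSpan e N R q (ζ - γ)).map (LinearMap.mulLeft K (ι K (e γ)))

/-- `x` acts on the family `e` on `R` and on `N`, raising degrees by `δ`. -/
structure RaisesDegree (e : A → L) (N : A → Submodule K L) (R : Finset A) (x : L) (δ : A) :
    Prop where
  lie_e : ∀ γ ∈ R, ⁅x, e γ⁆ = 0 ∨ γ + δ ∈ R ∧ ∃ r : K, ⁅x, e γ⁆ = r • e (γ + δ)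
  lie_mem : ∀ ζ, ∀ u ∈ N ζ, ⁅x, u⁆ ∈ N (ζ + δ)

variable {e : A → L} {N : A → Submodule K L} {R : Finset A} {q : ℕ} {ζ : A}

theorem ι_mem_exteriorSpan {u : L} (hu : u ∈ N ζ) : ι K u ∈ exteriorSpan e N R 0 ζ :=
  Submodule.mem_map_of_mem hu

theorem ι_mul_mem_exteriorSpan {γ : A} (hγ : γ ∈ R) {w : ExteriorAlgebra K L}
    (hw : w ∈ exteriorSpan e N R q ζ) : ι K (e γ) * w ∈ exteriorSpan e N R (q + 1) (ζ + γ) := by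
  refine Submodule.mem_iSup_of_mem (⟨γ, hγ⟩ : R) ⟨w, ?_, rfl⟩
  simpa using hw

theorem exteriorSpan_induction {P : ℕ → A → ExteriorAlgebra K L → Prop}
    (ι_mem : ∀ ζ, ∀ u ∈ N ζ, P 0 ζ (ι K u))
    (ι_mul : ∀ q ζ, ∀ γ ∈ R, ∀ w ∈ exteriorSpan e N R q ζ, P q ζ w →
      P (q + 1) (ζ + γ) (ι K (e γ) * w))
    (zero : ∀ q ζ, P q ζ 0) (add : ∀ q ζ w w', P q ζ w → P q ζ w' → P q ζ (w + w'))
    {w : ExteriorAlgebra K L} (hw : w ∈ exteriorSpan e N R q ζ) : P q ζ w := by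
  induction q generalizing ζ w with
  | zero =>
    obtain ⟨u, hu, rfl⟩ := hw
    exact ι_mem ζ u hu
  | succ q ih =>
    refine Submodule.iSup_induction _ (motive := P (q + 1) ζ) hw ?_ (zero _ _) (add _ _)
    rintro ⟨γ, hγ⟩ _ ⟨w, hw, rfl⟩
    have := ι_mul q _ γ hγ w hw (ih hw)
    rwa [sub_add_cancel] at this

theorem exteriorSpan_mono {R' : Finset A} (h : R ⊆ R') :
    exteriorSpan e N R q ζ ≤ exteriorSpan e N R' q ζ := fun w hw => by
  refine exteriorSpan_induction (P := fun q ζ w => w ∈ exteriorSpan e N R' q ζ)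
    (fun ζ u hu => ι_mem_exteriorSpan hu) (fun q ζ γ hγ w _ hw => ι_mul_mem_exteriorSpan (h hγ) hw)
    (fun _ _ => zero_mem _) (fun _ _ _ _ => add_mem) hw

theorem RaisesDegree.exteriorLie_mem {x : L} {δ : A} (h : RaisesDegree e N R x δ)
    {w : ExteriorAlgebra K L} (hw : w ∈ exteriorSpan e N R q ζ) :
    exteriorLie x w ∈ exteriorSpan e N R q (ζ + δ) := by
  refine exteriorSpan_induction
    (P := fun q ζ w => exteriorLie x w ∈ exteriorSpan e N R q (ζ + δ))
    (fun ζ u hu => ?_) (fun q ζ γ hγ w hw ih => ?_)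
    (fun _ _ => by simp) (fun _ _ _ _ h h' => by simpa using add_mem h h') hw
  · rw [exteriorLie_ι]
    exact ι_mem_exteriorSpan (h.lie_mem ζ u hu)
  · rw [exteriorLie_ι_mul]
    refine add_mem ?_ ?_
    · rcases h.lie_e γ hγ with h0 | ⟨h1, r, h2⟩
      · simp [h0]
      · rw [h2, map_smul, smul_mul_assoc, add_assoc]
        exact Submodule.smul_mem _ _ (ι_mul_mem_exteriorSpan h1 hw)
    · rw [add_right_comm]
      exact ι_mul_mem_exteriorSpan hγ ih

theorem exteriorDiff_mem (h : ∀ γ ∈ R, RaisesDegree e N R (e γ) γ) {w : ExteriorAlgebra K L}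
    (hw : w ∈ exteriorSpan e N R (q + 1) ζ) : exteriorDiff w ∈ exteriorSpan e N R q ζ := by
  refine exteriorSpan_induction (P := fun q ζ w => (q = 0 → exteriorDiff w = 0) ∧
      ∀ q', q = q' + 1 → exteriorDiff w ∈ exteriorSpan e N R q' ζ)
    (fun ζ u hu => ?_) (fun q ζ γ hγ w hw ih => ?_) (fun _ _ => by simp)
    (fun _ _ _ _ h h' => ⟨fun h0 => by simp [h.1 h0, h'.1 h0],
      fun q' h0 => by simpa using add_mem (h.2 q' h0) (h'.2 q' h0)⟩) hw |>.2 q rfl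
  · exact ⟨fun _ => exteriorDiff_ι u, fun q' h0 => by omega⟩
  · refine ⟨fun h0 => by omega, fun q' h0 => ?_⟩
    obtain rfl : q = q' := by omega
    rw [exteriorDiff_ι_mul]
    refine sub_mem ((h γ hγ).exteriorLie_mem hw) ?_
    cases q with
    | zero => simp [ih.1 rfl]
    | succ q => exact ι_mul_mem_exteriorSpan hγ (ih.2 q rfl)

theorem exteriorLie_eq_smul {x : L} {d : A → K} (hd : ∀ ζ ζ', d (ζ + ζ') = d ζ + d ζ')
    (he : ∀ γ ∈ R, ⁅x, e γ⁆ = d γ • e γ) (hN : ∀ ζ, ∀ u ∈ N ζ, ⁅x, u⁆ = d ζ • u)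
    {w : ExteriorAlgebra K L} (hw : w ∈ exteriorSpan e N R q ζ) :
    exteriorLie x w = d ζ • w := by
  refine exteriorSpan_induction (P := fun q ζ w => exteriorLie x w = d ζ • w)
    (fun ζ u hu => ?_) (fun q ζ γ hγ w hw ih => ?_) (fun _ _ => by simp)
    (fun _ _ _ _ h h' => by rw [map_add, h, h', smul_add]) hw
  · rw [exteriorLie_ι, hN ζ u hu, map_smul]
  · rw [exteriorLie_ι_mul, he γ hγ, ih, hd, add_comm, add_smul, map_smul, smul_mul_assoc,
      mul_smul_comm]

theorem exteriorSpan_insert [DecidableEq A] {δ : A} {w : ExteriorAlgebra K L}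
    (hw : w ∈ exteriorSpan e N (insert δ R) (q + 1) ζ) :
    ∃ w₁ ∈ exteriorSpan e N R q (ζ - δ), ∃ w₂ ∈ exteriorSpan e N R (q + 1) ζ,
      w = ι K (e δ) * w₁ + w₂ := by
  refine exteriorSpan_induction (P := fun q ζ w => (q = 0 → w ∈ exteriorSpan e N R q ζ) ∧
      ∀ q', q = q' + 1 → ∃ w₁ ∈ exteriorSpan e N R q' (ζ - δ),
        ∃ w₂ ∈ exteriorSpan e N R (q' + 1) ζ, w = ι K (e δ) * w₁ + w₂)
    (fun ζ u hu => ?_) (fun q ζ γ hγ w hw ih => ?_)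
    (fun _ _ => ⟨fun _ => zero_mem _, fun _ _ => ⟨0, zero_mem _, 0, zero_mem _, by simp⟩⟩)
    (fun _ _ w w' h h' => ⟨fun h0 => add_mem (h.1 h0) (h'.1 h0), fun q' h0 => ?_⟩) hw |>.2 q rfl
  · exact ⟨fun _ => ι_mem_exteriorSpan hu, fun q' h0 => by omega⟩
  · refine ⟨fun h0 => by omega, fun q' h0 => ?_⟩
    obtain rfl : q = q' := by omega
    cases q with
    | zero =>
      rcases Finset.mem_insert.mp hγ with rfl | hγ
      · exact ⟨w, by simpa using ih.1 rfl, 0, zero_mem _, by simp⟩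
      · exact ⟨0, zero_mem _, _, ι_mul_mem_exteriorSpan hγ (ih.1 rfl), by simp⟩
    | succ q =>
      obtain ⟨w₁, h1, w₂, h2, rfl⟩ := ih.2 q rfl
      rcases Finset.mem_insert.mp hγ with rfl | hγ
      · exact ⟨w₂, by simpa using h2, 0, zero_mem _, by rw [mul_add, ι_mul_ι_mul_self]; simp⟩
      · refine ⟨-(ι K (e γ) * w₁), neg_mem ?_, _, ι_mul_mem_exteriorSpan hγ h2, ?_⟩
        · rw [add_sub_right_comm]
          exact ι_mul_mem_exteriorSpan hγ h1
        · rw [mul_add, ι_mul_ι_mul_comm, mul_neg]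
  · obtain ⟨w₁, h1, w₂, h2, rfl⟩ := h.2 q' h0
    obtain ⟨w₁', h1', w₂', h2', rfl⟩ := h'.2 q' h0
    exact ⟨_, add_mem h1 h1', _, add_mem h2 h2', by rw [mul_add]; abel⟩

theorem exteriorSpan_eq_bot (h : R.card < q) : exteriorSpan e N R q ζ = ⊥ := by
  classical
  induction R using Finset.induction_on generalizing q ζ with
  | empty =>
    obtain ⟨q, rfl⟩ := Nat.exists_eq_succ_of_ne_zero (Nat.ne_zero_of_lt h)
    rw [exteriorSpan, iSup_of_empty]
  | insert δ R hδ ih =>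
    rw [Finset.card_insert_of_notMem hδ] at h
    obtain ⟨q, rfl⟩ := Nat.exists_eq_succ_of_ne_zero (Nat.ne_zero_of_lt h)
    rw [eq_bot_iff]
    intro w hw
    obtain ⟨w₁, h1, w₂, h2, rfl⟩ := exteriorSpan_insert hw
    rw [ih (by omega), Submodule.mem_bot] at h1 h2
    simp [h1, h2]

theorem exists_of_exteriorSpan_ne_bot (h : exteriorSpan e N R q ζ ≠ ⊥) :
    ∃ S ⊆ R, N (ζ - ∑ γ ∈ S, γ) ≠ ⊥ := by
  classical
  induction R using Finset.induction_on generalizing q ζ with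
  | empty =>
    cases q with
    | zero =>
      refine ⟨∅, subset_rfl, fun h0 => h ?_⟩
      rw [Finset.sum_empty, sub_zero] at h0
      rw [exteriorSpan, h0, Submodule.map_bot]
    | succ q => exact absurd (exteriorSpan_eq_bot (by simp)) h
  | insert δ R hδ ih =>
    cases q with
    | zero =>
      obtain ⟨S, hS, h1⟩ := ih (q := 0) h
      exact ⟨S, hS.trans (Finset.subset_insert _ _), h1⟩
    | succ q =>
      by_cases h1 : exteriorSpan e N R q (ζ - δ) = ⊥
      · by_cases h2 : exteriorSpan e N R (q + 1) ζ = ⊥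
        · refine absurd (eq_bot_iff.mpr fun w hw => ?_) h
          obtain ⟨w₁, h3, w₂, h4, rfl⟩ := exteriorSpan_insert hw
          rw [h1, Submodule.mem_bot] at h3
          rw [h2, Submodule.mem_bot] at h4
          simp [h3, h4]
        · obtain ⟨S, hS, h3⟩ := ih h2
          exact ⟨S, hS.trans (Finset.subset_insert _ _), h3⟩
      · obtain ⟨S, hS, h3⟩ := ih h1
        refine ⟨insert δ S, Finset.insert_subset_insert _ hS, ?_⟩
        rwa [Finset.sum_insert fun h => hδ (hS h), ← sub_sub]

theorem finiteDimensional_exteriorSpan (h : ∀ ζ, FiniteDimensional K (N ζ)) :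
    FiniteDimensional K (exteriorSpan e N R q ζ) := by
  induction q generalizing ζ with
  | zero =>
    have := h ζ
    exact inferInstanceAs (FiniteDimensional K ((N ζ).map (ι K)))
  | succ q ih =>
    have := fun γ : R => @ih (ζ - γ)
    exact Submodule.finite_iSup _

/-- A linear map fixing the generators fixes the exterior span. -/
theorem exteriorSpan_map_eq {φ : L →ₗ[K] L} (he : ∀ γ ∈ R, φ (e γ) = e γ)
    (hN : ∀ ζ, ∀ u ∈ N ζ, φ u = u) {w : ExteriorAlgebra K L} (hw : w ∈ exteriorSpan e N R q ζ) :
    ExteriorAlgebra.map φ w = w := by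
  refine exteriorSpan_induction (P := fun _ _ w => ExteriorAlgebra.map φ w = w)
    (fun ζ u hu => ?_) (fun q ζ γ hγ w _ hw => ?_) (fun _ _ => map_zero _)
    (fun _ _ _ _ h h' => by rw [map_add, h, h']) hw
  · rw [map_apply_ι, hN ζ u hu]
  · rw [map_mul, map_apply_ι, he γ hγ, hw]

end ExteriorSpan

section SimpleReflection

open ExteriorAlgebra

variable {K L A : Type} [Field K] [LieRing L] [LieAlgebra K L] [AddCommGroup A]
  {e : A → L} {N : A → Submodule K L} {r : Finset A}

theorem isGradedSl2_exteriorSpan {p : ℕ} {co : A →+ ℤ} {β : A} (hβ : co β = 2)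
    (hx : RaisesDegree e N r (e β) β) (hf : RaisesDegree e N r (e (-β)) (-β))
    (hr' : ∀ γ ∈ r, ⁅⁅e β, e (-β)⁆, e γ⁆ = (co γ : K) • e γ)
    (hN' : ∀ ζ, ∀ u ∈ N ζ, ⁅⁅e β, e (-β)⁆, u⁆ = (co ζ : K) • u)
    (hbound : ∀ S ⊆ r, ∀ ζ, N ζ ≠ ⊥ → |co ζ + ∑ γ ∈ S, co γ| < p) (q : ℕ) :
    IsGradedSl2 p co β (exteriorSpan e N r q) (exteriorLie (e β)) (exteriorLie (e (-β))) where
  deg_ι := hβ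
  e_mem _ _ hw := hx.exteriorLie_mem hw
  f_mem ζ w hw := by
    rw [sub_eq_add_neg]
    exact hf.exteriorLie_mem hw
  comm ζ w hw := by
    rw [exteriorLie_lie]
    exact exteriorLie_eq_smul (d := fun ζ => (co ζ : K)) (by simp) hr' hN' hw
  bound ζ hζ := by
    by_contra h0
    obtain ⟨S, hS, h1⟩ := exists_of_exteriorSpan_ne_bot h0
    have := hbound S hS _ h1
    rw [map_sub, map_sum, sub_add_cancel] at this
    omega

/-- Changing the sign of the simple root `β` of a system of positive roots. -/
theorem exists_exteriorDiff_eq_of_reflection {p : ℕ} [CharP K p] {co : A →+ ℤ} {β : A}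
    (hβ : co β = 2) (hx : RaisesDegree e N r (e β) β) (hf : RaisesDegree e N r (e (-β)) (-β))
    (hr : ∀ γ ∈ r, RaisesDegree e N r (e γ) γ)
    (hr' : ∀ γ ∈ r, ⁅⁅e β, e (-β)⁆, e γ⁆ = (co γ : K) • e γ)
    (hN' : ∀ ζ, ∀ u ∈ N ζ, ⁅⁅e β, e (-β)⁆, u⁆ = (co ζ : K) • u)
    (hbound : ∀ S ⊆ r, ∀ ζ, N ζ ≠ ⊥ → |co ζ + ∑ γ ∈ S, co γ| < p)
    (hfin : ∀ ζ, FiniteDimensional K (N ζ)) {φ : L →ₗ[K] L} (hφ : φ (e (-β)) = 0)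
    (hφr : ∀ γ ∈ r, φ (e γ) = e γ) (hφN : ∀ ζ, ∀ u ∈ N ζ, φ u = u) [DecidableEq A]
    {q : ℕ} {ζ : A} (hζ : 0 ≤ co ζ) {w m : ExteriorAlgebra K L} (hw : w ∈ exteriorSpan e N r q ζ)
    (hw0 : exteriorLie (e β) w = 0)
    (hm : m ∈ exteriorSpan e N (insert (-β) r) (q + 1) ζ) (hmw : exteriorDiff m = w) :
    ∃ m' ∈ exteriorSpan e N (insert β r) (q + 2) (ζ + β),
      exteriorDiff m' = ι K (e β) * w := by
  have hsl := isGradedSl2_exteriorSpan hβ hx hf hr' hN' hbound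
  obtain ⟨m₁, hm₁, m₂, hm₂, rfl⟩ := exteriorSpan_insert hm
  rw [sub_neg_eq_add] at hm₁
  have h1 : w = exteriorLie (e (-β)) m₁ + exteriorDiff m₂ := by
    have hfm := hf.exteriorLie_mem hm₁
    have h2 := congrArg (ExteriorAlgebra.map φ) hmw
    rw [map_add exteriorDiff, exteriorDiff_ι_mul, map_add, map_sub, map_mul, map_apply_ι, hφ,
      map_zero, zero_mul, sub_zero, exteriorSpan_map_eq hφr hφN hw,
      exteriorSpan_map_eq hφr hφN hfm,
      exteriorSpan_map_eq hφr hφN (exteriorDiff_mem hr hm₂)] at h2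
    exact h2.symm
  have := finiteDimensional_exteriorSpan (e := e) (R := r) (q := q + 1) (ζ := ζ + β) hfin
  obtain ⟨u, hu, y, hy, hu0, rfl⟩ := (hsl (q + 1)).exists_eq_add_f hζ hm₂
  have h2 : m₁ + exteriorDiff y = 0 := by
    refine (hsl q).eq_zero_of_e_f (add_mem hm₁ (exteriorDiff_mem hr hy)) (by
      rw [map_add, hβ]
      omega) ?_
    rw [← hw0, h1, map_add exteriorDiff, map_add, map_add, map_add, exteriorDiff_exteriorLie,
      map_add, ← exteriorDiff_exteriorLie (e β) u, hu0, map_zero, zero_add]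
  have h3 : w = exteriorDiff u := by
    rw [h1, map_add, exteriorDiff_exteriorLie, add_left_comm, ← map_add, h2, map_zero, add_zero]
  refine ⟨-(ι K (e β) * u), neg_mem (ι_mul_mem_exteriorSpan (Finset.mem_insert_self _ _)
    (exteriorSpan_mono (Finset.subset_insert _ _) hu)), ?_⟩
  rw [map_neg, exteriorDiff_ι_mul, hu0, zero_sub, neg_neg, h3]

end SimpleReflection

section ExteriorProducts

attribute [local instance] LieRing.ofAssociativeRing LieAlgebra.ofAssociativeAlgebra

open ExteriorAlgebra

variable {K L A : Type} [Field K]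

theorem ExteriorAlgebra.prod_mul_ι [AddCommGroup L] [Module K L] (e : A → L) (l : List A) (y : L) :
    (l.map fun γ => ι K (e γ)).prod * ι K y =
      (-1) ^ l.length * (ι K y * (l.map fun γ => ι K (e γ)).prod) := by
  induction l with
  | nil => simp
  | cons γ l ih =>
    rw [List.map_cons, List.prod_cons, mul_assoc, ih, List.length_cons, pow_succ,
      ι_mul_ι_mul_comm y (e γ), ← mul_assoc, ((Commute.neg_one_left _).pow_left _).eq.symm,
      mul_assoc]
    noncomm_ring

theorem ExteriorAlgebra.prod_mul_ι_of_mem [AddCommGroup L] [Module K L] (e : A → L) {l : List A}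
    {γ : A} (h : γ ∈ l) : (l.map fun γ => ι K (e γ)).prod * ι K (e γ) = 0 := by
  induction l with
  | nil => simp at h
  | cons δ l ih =>
    rw [List.map_cons, List.prod_cons, mul_assoc]
    rcases List.mem_cons.mp h with rfl | h
    · rw [prod_mul_ι, ← mul_assoc, ← ((Commute.neg_one_left _).pow_left _).eq, mul_assoc,
        ι_mul_ι_mul_self, mul_zero]
    · rw [ih h, mul_zero]

/-- A derivation kills a product if it maps every factor to a multiple of a preceding one. -/
theorem exteriorLie_prod_eq_zero [LieRing L] [LieAlgebra K L] {e : A → L} {l : List A} {x u : L}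
    (hu : ⁅x, u⁆ = 0) (h : ∀ l₁ γ l₂, l = l₁ ++ γ :: l₂ →
      ⁅x, e γ⁆ = 0 ∨ ∃ δ ∈ l₁, ∃ r : K, ⁅x, e γ⁆ = r • e δ) :
    exteriorLie x ((l.map fun γ => ι K (e γ)).prod * ι K u) = 0 := by
  have key : ∀ l₂ l₁, l = l₁ ++ l₂ → (l₁.map fun γ => ι K (e γ)).prod *
      exteriorLie x ((l₂.map fun γ => ι K (e γ)).prod * ι K u) = 0 := by
    intro l₂
    induction l₂ with
    | nil => simp [exteriorLie_ι, hu]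
    | cons γ l₂ ih =>
      intro l₁ hl
      have h1 := ih (l₁ ++ [γ]) (by simpa using hl)
      rw [List.map_append, List.prod_append, List.map_singleton, List.prod_singleton,
        mul_assoc] at h1
      rw [List.map_cons, List.prod_cons, mul_assoc, exteriorLie_ι_mul, mul_add, h1, add_zero,
        ← mul_assoc]
      rcases h l₁ γ l₂ hl with h0 | ⟨δ, hδ, r, h2⟩
      · simp [h0]
      · rw [h2, map_smul, mul_smul_comm, prod_mul_ι_of_mem e hδ, smul_zero, zero_mul]
  simpa using key l [] rfl

theorem exteriorSpan_prod_mem [LieRing L] [LieAlgebra K L] [AddCommGroup A] {e : A → L}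
    {N : A → Submodule K L} {R : Finset A} {l : List A} (hl : ∀ γ ∈ l, γ ∈ R) {ζ : A} {u : L}
    (hu : u ∈ N ζ) :
    (l.map fun γ => ι K (e γ)).prod * ι K u ∈ exteriorSpan e N R l.length (ζ + l.sum) := by
  induction l with
  | nil => simpa using ι_mem_exteriorSpan hu
  | cons γ l ih =>
    rw [List.map_cons, List.prod_cons, mul_assoc, List.sum_cons, add_comm γ, ← add_assoc]
    exact ι_mul_mem_exteriorSpan (hl γ List.mem_cons_self)
      (ih fun γ h => hl γ (List.mem_cons_of_mem _ h))

/-- The product of a family with dual functionals does not vanish. -/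
theorem ExteriorAlgebra.prod_mul_ι_ne_zero [AddCommGroup L] [Module K L] {e : A → L} {l : List A}
    (hl : l.Nodup) {u : L} (hu : u ≠ 0) (h : ∀ γ ∈ l, ∃ φ : Module.Dual K L, φ (e γ) = 1 ∧
      φ u = 0 ∧ ∀ δ ∈ l, δ ≠ γ → φ (e δ) = 0) :
    (l.map fun γ => ι K (e γ)).prod * ι K u ≠ 0 := by
  induction l with
  | nil => simpa [ι_eq_zero_iff] using hu
  | cons γ l ih =>
    rw [List.nodup_cons] at hl
    intro h0
    rw [List.map_cons, List.prod_cons, mul_assoc] at h0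
    refine ih hl.2 (fun δ hδ => ?_) ?_
    · obtain ⟨φ, h1, h2, h3⟩ := h δ (List.mem_cons_of_mem _ hδ)
      exact ⟨φ, h1, h2, fun δ' hδ' => h3 δ' (List.mem_cons_of_mem _ hδ')⟩
    · obtain ⟨φ, h1, h2, h3⟩ := h γ List.mem_cons_self
      have key : ∀ l' : List A, (∀ δ ∈ l', φ (e δ) = 0) → CliffordAlgebra.contractLeft φ
          ((l'.map fun γ => ι K (e γ)).prod * ι K u) = 0 := by
        intro l' hl'
        induction l' with
        | nil => simpa using h2
        | cons δ l' ih' =>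
          rw [List.map_cons, List.prod_cons, mul_assoc]
          refine (CliffordAlgebra.contractLeft_ι_mul φ _ _).trans ?_
          rw [ih' fun δ h => hl' δ (List.mem_cons_of_mem _ h), hl' δ List.mem_cons_self]
          simp
      have h4 := (CliffordAlgebra.contractLeft_ι_mul φ (e γ)
        ((l.map fun γ => ι K (e γ)).prod * ι K u)).symm.trans
        ((congrArg (CliffordAlgebra.contractLeft φ) h0).trans (map_zero _))
      rw [key l fun δ hδ => h3 δ (List.mem_cons_of_mem _ hδ) fun h => hl.1 (h ▸ hδ), h1,
        one_smul] at h4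
      simpa using h4

end ExteriorProducts

section Dual

attribute [local instance] LieRing.ofAssociativeRing LieAlgebra.ofAssociativeAlgebra

variable {K n : Type} [Field K] [Fintype n] [DecidableEq n]

/-- The inclusion of the matrices in the dual numbers over them. -/
def dualInl (K n : Type) [Field K] : Matrix n n K →ₗ[K] DualNumber (Matrix n n K) where
  toFun := TrivSqZeroExt.inl
  map_add' := TrivSqZeroExt.inl_add _
  map_smul' := TrivSqZeroExt.inl_smul _

/-- The infinitesimal matrices. -/
def dualInr (K n : Type) [Field K] : Matrix n n K →ₗ[K] DualNumber (Matrix n n K) where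
  toFun := TrivSqZeroExt.inr
  map_add' := TrivSqZeroExt.inr_add _
  map_smul' := TrivSqZeroExt.inr_smul _

/-- The classical part of a dual number. -/
def dualFst (K n : Type) [Field K] : DualNumber (Matrix n n K) →ₗ[K] Matrix n n K where
  toFun := TrivSqZeroExt.fst
  map_add' := TrivSqZeroExt.fst_add
  map_smul' := TrivSqZeroExt.fst_smul

theorem dualInl_lie (x y : Matrix n n K) : ⁅dualInl K n x, dualInl K n y⁆ = dualInl K n ⁅x, y⁆ := by
  simp [Ring.lie_def, dualInl, TrivSqZeroExt.inl_mul, TrivSqZeroExt.inl_sub]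

theorem dualInl_lie_dualInr (x y : Matrix n n K) :
    ⁅dualInl K n x, dualInr K n y⁆ = dualInr K n ⁅x, y⁆ := by
  change TrivSqZeroExt.inl x * TrivSqZeroExt.inr y - TrivSqZeroExt.inr y * TrivSqZeroExt.inl x =
    TrivSqZeroExt.inr (x * y - y * x)
  rw [TrivSqZeroExt.inl_mul_inr, TrivSqZeroExt.inr_mul_inl, TrivSqZeroExt.inr_sub]
  rfl

end Dual

section RootFamilies

attribute [local instance] LieRing.ofAssociativeRing LieAlgebra.ofAssociativeAlgebra

variable {K I n : Type} [Field K] [Fintype n] [DecidableEq n] {c : n → I}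
  {U : Submodule K (Matrix n n K)} {p : ℕ}

theorem exists_finset_isRoot (c : n → I) (U : Submodule K (Matrix n n K)) :
    ∃ Φ : Finset (WeightGroup c U), ∀ γ, γ ∈ Φ ↔ IsRoot c U γ := by
  have hfin : {γ | IsRoot c U γ}.Finite :=
    (Set.finite_range fun J : n × n => weight c U J.1 - weight c U J.2).subset fun γ hγ => by
      obtain ⟨-, x, hx, hx0⟩ := hγ
      obtain ⟨s, t, hst⟩ : ∃ s t, x s t ≠ 0 := by
        by_contra! h0
        exact hx0 (Matrix.ext h0)
      exact ⟨(s, t), by simp [(hx.2 s t hst).2]⟩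
  exact ⟨hfin.toFinset, fun γ => by simp⟩

/-- A choice of root vectors such that those of opposite roots span an `sl₂`. -/
def IsRootFamily (e : WeightGroup c U → Matrix n n K) : Prop :=
  ∀ γ, IsRoot c U γ → ∃ t : RootTriple c U γ, t.e = e γ ∧ t.f = e (-γ)

theorem IsReductiveStabilizer.isRoot_neg [CharP K p] (h : IsReductiveStabilizer p c U)
    (hp : 2 < p) {γ : WeightGroup c U} (hγ : IsRoot c U γ) : IsRoot c U (-γ) := by
  obtain ⟨t⟩ := h.exists_rootTriple hp hγ
  exact (t.symm h).isRoot

theorem exists_isRootFamily [CharP K p] (h : IsReductiveStabilizer p c U) (hp : 2 < p)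
    {η : WeightGroup c U →+ ℚ} (hη : ∀ γ, IsRoot c U γ → η γ ≠ 0) :
    ∃ e : WeightGroup c U → Matrix n n K, IsRootFamily e := by
  classical
  let T : ∀ γ : WeightGroup c U, IsRoot c U γ → RootTriple c U γ :=
    fun γ hγ => (h.exists_rootTriple hp hγ).some
  have hT : ∀ γ δ (hγ : IsRoot c U γ) (hδ : IsRoot c U δ), γ = δ → (T γ hγ).f = (T δ hδ).f := by
    rintro γ _ _ _ rfl
    rfl
  let e : WeightGroup c U → Matrix n n K := fun γ =>
    if hγ : IsRoot c U γ ∧ 0 < η γ then (T γ hγ.1).e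
    else if hγ' : IsRoot c U (-γ) then (T (-γ) hγ').f else 0
  have hpos : ∀ γ, IsRoot c U γ → 0 < η γ → ∃ t : RootTriple c U γ, t.e = e γ ∧ t.f = e (-γ) := by
    intro γ hγ h0
    refine ⟨T γ hγ, by simp only [e, dif_pos (And.intro hγ h0)], ?_⟩
    have h1 : ¬ (IsRoot c U (-γ) ∧ 0 < η (-γ)) := fun h' => by
      have := h'.2
      rw [map_neg] at this
      linarith
    have h2 : IsRoot c U (- -γ) := by rwa [neg_neg]
    simp only [e, dif_neg h1, dif_pos h2]
    exact hT _ _ hγ h2 (neg_neg γ).symm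
  refine ⟨e, fun γ hγ => ?_⟩
  rcases lt_or_gt_of_ne (hη γ hγ) with h0 | h0
  · obtain ⟨t, h1, h2⟩ := hpos (-γ) (h.isRoot_neg hp hγ) (by rw [map_neg]; linarith)
    have h3 : ∃ t : RootTriple c U (- -γ), t.e = e (- -γ) ∧ t.f = e (- - -γ) :=
      ⟨t.symm h, h2, h1.trans (congrArg e (neg_neg _).symm)⟩
    rwa [neg_neg] at h3
  · exact hpos γ hγ h0

namespace IsRootFamily

variable {e : WeightGroup c U → Matrix n n K}

theorem mem (he : IsRootFamily e) {γ : WeightGroup c U} (hγ : IsRoot c U γ) :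
    e γ ∈ rootSpace c U γ := by
  obtain ⟨t, h1, -⟩ := he γ hγ
  exact h1 ▸ t.e_mem

theorem ne_zero (he : IsRootFamily e) {γ : WeightGroup c U} (hγ : IsRoot c U γ) : e γ ≠ 0 := by
  obtain ⟨t, h1, -⟩ := he γ hγ
  exact h1 ▸ t.e_ne_zero

theorem raisesDegree [CharP K p] (he : IsRootFamily e) (h : IsReductiveStabilizer p c U)
    (hp : 2 < p) {r : Finset (WeightGroup c U)} {ψ : WeightGroup c U →+ ℚ}
    (hr : ∀ γ, γ ∈ r ↔ IsRoot c U γ ∧ 0 < ψ γ) {δ : WeightGroup c U} (hδ : IsRoot c U δ)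
    (hψ : 0 ≤ ψ δ) :
    RaisesDegree (fun γ => dualInl K n (e γ))
      (fun ζ => (gradedPart K (fun _ : n => ()) (weight c U) ζ).map (dualInr K n)) r
      (dualInl K n (e δ)) δ where
  lie_e γ hγ := by
    rw [hr] at hγ
    rw [dualInl_lie]
    by_cases h0 : ⁅e δ, e γ⁆ = 0
    · exact Or.inl (by rw [h0, map_zero])
    · have hx := lie_mem_rootSpace (he.mem hδ) (he.mem hγ.1)
      rw [add_comm] at hx
      have hψ' : 0 < ψ (γ + δ) := by
        rw [map_add]
        linarith [hγ.2]
      have hroot : IsRoot c U (γ + δ) := ⟨fun h1 => by simp [h1] at hψ', _, hx, h0⟩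
      obtain ⟨t, ht, -⟩ := he _ hroot
      obtain ⟨a, ha⟩ := t.exists_eq_smul h hp hx
      refine Or.inr ⟨(hr _).mpr ⟨hroot, hψ'⟩, a, ?_⟩
      rw [ha, ht, map_smul]
  lie_mem ζ u hu := by
    obtain ⟨x, hx, rfl⟩ := hu
    rw [dualInl_lie_dualInr]
    refine Submodule.mem_map_of_mem ?_
    rw [add_comm]
    exact lie_mem_gradedPart (fun s t hst => ⟨rfl, ((he.mem hδ).2 s t hst).2⟩) hx

end IsRootFamily

/-- The sum of an integral function over a finite set is nonnegative if some injective map on the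
set reverses its sign where it is negative. -/
theorem Finset.sum_nonneg_of_reflection {A : Type} [DecidableEq A] {J : Finset A} {f : A → ℤ}
    {τ : A → A}
    (h : ∀ γ ∈ J, f γ < 0 → τ γ ∈ J ∧ f (τ γ) = -f γ ∧ τ (τ γ) = γ) : 0 ≤ ∑ γ ∈ J, f γ := by
  have hinj : Set.InjOn τ (J.filter (f · < 0)) := fun γ hγ δ hδ hγδ => by
    simp only [Finset.coe_filter, Set.mem_ofPred_eq] at hγ hδ
    rw [← (h γ hγ.1 hγ.2).2.2, ← (h δ hδ.1 hδ.2).2.2, hγδ]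
  have h1 : ∑ γ ∈ J.filter (f · < 0), -f γ ≤ ∑ γ ∈ J.filter (¬ f · < 0), f γ := by
    rw [Finset.sum_congr rfl fun γ hγ => (h γ (Finset.mem_filter.mp hγ).1
      (Finset.mem_filter.mp hγ).2).2.1.symm, ← Finset.sum_image hinj]
    refine Finset.sum_le_sum_of_subset_of_nonneg (fun δ hδ => ?_)
      fun δ hδ _ => not_lt.mp (Finset.mem_filter.mp hδ).2
    obtain ⟨γ, hγ, rfl⟩ := Finset.mem_image.mp hδ
    rw [Finset.mem_filter] at hγ ⊢
    obtain ⟨h1, h2, -⟩ := h γ hγ.1 hγ.2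
    exact ⟨h1, by omega⟩
  rw [← Finset.sum_filter_add_sum_filter_not J (f · < 0)]
  rw [Finset.sum_neg_distrib] at h1
  linarith

theorem RootTriple.sum_co_nonneg [CharP K p] {β : WeightGroup c U} (t : RootTriple c U β)
    (h : IsReductiveStabilizer p c U) {η ψ : WeightGroup c U →+ ℚ} (hη : 0 < η β) (hψ : ψ β = 0)
    {J : Finset (WeightGroup c U)} (hJ : ∀ γ, γ ∈ J ↔ IsRoot c U γ ∧ 0 < η γ ∧ 0 < ψ γ) :
    0 ≤ ∑ γ ∈ J, t.co γ := by
  classical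
  refine Finset.sum_nonneg_of_reflection (τ := fun γ => γ - t.co γ • β) fun γ hγ h0 => ?_
  obtain ⟨j, hj⟩ := Int.eq_ofNat_of_zero_le (neg_nonneg.mpr h0.le)
  have hτ : γ - t.co γ • β = γ + j • β := by
    rw [← natCast_zsmul, show (j : ℤ) = -t.co γ from hj.symm, neg_smul, sub_eq_add_neg]
  obtain ⟨h1, h2, h3⟩ := (hJ γ).mp hγ
  have hψ' : ψ (γ + j • β) = ψ γ := by rw [map_add, map_nsmul, hψ, smul_zero, add_zero]
  have hη' : 0 < η (γ + j • β) := by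
    rw [map_add, map_nsmul]
    positivity
  refine ⟨?_, t.co_reflection γ, ?_⟩
  · rw [hτ, hJ]
    refine ⟨t.isRoot_add_nsmul h h1 (by omega) fun h4 => ?_, hη', hψ' ▸ h3⟩
    rw [h4, map_zero] at hη'
    exact lt_irrefl _ hη'
  · rw [t.co_reflection, neg_smul, sub_neg_eq_add, sub_add_cancel]

end RootFamilies

section HighestWeight

attribute [local instance] LieRing.ofAssociativeRing LieAlgebra.ofAssociativeAlgebra

open ExteriorAlgebra

variable {K I n : Type} [Field K] [Fintype n] [DecidableEq n] {c : n → I}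
  {U : Submodule K (Matrix n n K)} {p : ℕ} {e : WeightGroup c U → Matrix n n K}

/-- The span of the products of root vectors for roots in `R` and one infinitesimal matrix. -/
noncomputable abbrev rootExteriorSpan (e : WeightGroup c U → Matrix n n K)
    (R : Finset (WeightGroup c U)) (q : ℕ) (ζ : WeightGroup c U) :
    Submodule K (ExteriorAlgebra K (DualNumber (Matrix n n K))) :=
  exteriorSpan (fun γ => dualInl K n (e γ))
    (fun ζ => (gradedPart K (fun _ : n => ()) (weight c U) ζ).map (dualInr K n)) R q ζ

theorem IsRootFamily.exists_exteriorDiff_eq_ι_mul [CharP K p] (he : IsRootFamily e)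
    (h : IsReductiveStabilizer p c U) (hp : 2 < p) {ψ : WeightGroup c U →+ ℚ}
    {r : Finset (WeightGroup c U)} (hr : ∀ γ, γ ∈ r ↔ IsRoot c U γ ∧ 0 < ψ γ)
    {β : WeightGroup c U} (hψ : ψ β = 0) {t : RootTriple c U β} (hte : t.e = e β)
    (htf : t.f = e (-β)) [DecidableEq (WeightGroup c U)] {q : ℕ} {ζ : WeightGroup c U}
    (hζ : 0 ≤ t.co ζ) {w m : ExteriorAlgebra K (DualNumber (Matrix n n K))}
    (hw : w ∈ rootExteriorSpan e r q ζ) (hw0 : exteriorLie (dualInl K n (e β)) w = 0)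
    (hm : m ∈ rootExteriorSpan e (insert (-β) r) (q + 1) ζ) (hmw : exteriorDiff m = w) :
    ∃ m' ∈ rootExteriorSpan e (insert β r) (q + 2) (ζ + β),
      exteriorDiff m' = ι K (dualInl K n (e β)) * w := by
  have hψ' : ψ (-β) = 0 := by rw [map_neg, hψ, neg_zero]
  have hco : ∀ {ζ : WeightGroup c U} {x : Matrix n n K},
      x ∈ gradedPart K (fun _ => ()) (weight c U) ζ → ⁅⁅e β, e (-β)⁆, x⁆ = (t.co ζ : K) • x := by
    intro ζ x hx
    rw [← hte, ← htf, t.lie_eq]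
    ext s s'
    rw [lie_diagonal_apply, Matrix.smul_apply, smul_eq_mul]
    by_cases hs : x s s' = 0
    · simp [hs]
    · rw [(hx s s' hs).2, map_add]
      push_cast
      ring
  let φ : DualNumber (Matrix n n K) →ₗ[K] DualNumber (Matrix n n K) :=
    LinearMap.id - dualInl K n ∘ₗ component K (weight c U) (-β) ∘ₗ dualFst K n
  have hφ : ∀ x, φ (dualInl K n x) = dualInl K n (x - component K (weight c U) (-β) x) :=
    fun x => (map_sub (dualInl K n) _ _).symm
  obtain ⟨hroot, hroot'⟩ : IsRoot c U β ∧ IsRoot c U (-β) := ⟨t.isRoot, (t.symm h).isRoot⟩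
  refine exists_exteriorDiff_eq_of_reflection (φ := φ) t.co_self
    (he.raisesDegree h hp hr hroot hψ.ge) (he.raisesDegree h hp hr hroot' hψ'.ge)
    (fun γ hγ => he.raisesDegree h hp hr ((hr γ).mp hγ).1 ((hr γ).mp hγ).2.le)
    (fun γ hγ => ?_) ?_ (fun S hS ζ hζ => ?_) (fun ζ => ?_) ?_ (fun γ hγ => ?_) ?_ hζ hw hw0 hm hmw
  · rw [dualInl_lie, dualInl_lie, hco fun s s' hs => ⟨rfl, ((he.mem ((hr γ).mp hγ).1).2 s s' hs).2⟩,
      map_smul]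
  · rintro ζ _ ⟨x, hx, rfl⟩
    rw [dualInl_lie, dualInl_lie_dualInr, hco hx, map_smul]
  · obtain ⟨_, ⟨x, hx, rfl⟩, hx0⟩ := (Submodule.ne_bot_iff _).mp hζ
    obtain ⟨s, s', hs⟩ : ∃ s s', x s s' ≠ 0 := by
      by_contra! h0
      exact hx0 (by rw [show x = 0 from Matrix.ext h0, map_zero])
    have hζs : t.co ζ = t.co (weight c U s) - t.co (weight c U s') := by
      rw [(hx s s' hs).2, map_add]
      ring
    obtain ⟨Φ, hΦ⟩ := exists_finset_isRoot c U
    have h1 := t.co_sub_add_sum_lt h hp hψ (fun γ hγ => (hr γ).mp (hS hγ))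
      (fun γ => (hΦ γ).mpr) s s'
    have h2 := (t.symm h).co_sub_add_sum_lt h hp hψ' (fun γ hγ => (hr γ).mp (hS hγ))
      (fun γ => (hΦ γ).mpr) s s'
    simp only [RootTriple.symm, AddMonoidHom.neg_apply, Finset.sum_neg_distrib] at h2
    rw [abs_lt]
    constructor <;> omega
  · infer_instance
  · have h1 : e (-β) ∈ gradedPart K c (weight c U) (-β) := (he.mem hroot').2
    rw [hφ, component_eq_self h1, sub_self, map_zero]
  · have h1 := ((hr γ).mp hγ).2
    have h2 : e γ ∈ gradedPart K c (weight c U) γ := (he.mem ((hr γ).mp hγ).1).2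
    rw [hφ, ← component_eq_self h2, component_component_of_ne, sub_zero]
    rintro rfl
    exact h1.ne' hψ'
  · rintro ζ _ ⟨x, -, rfl⟩
    have h1 : φ (dualInr K n x) = dualInr K n x -
      dualInl K n (component K (weight c U) (-β) (dualFst K n (dualInr K n x))) := rfl
    have h2 : dualFst K n (dualInr K n x) = 0 := rfl
    rw [h1, h2, map_zero, map_zero, sub_zero]

/-- The roots positive for `η`, with signs changed outside `J`. -/
theorem IsRootFamily.exists_exteriorDiff_eq_prod [CharP K p] (he : IsRootFamily e)
    (h : IsReductiveStabilizer p c U) (hp : 2 < p) {η ξ : WeightGroup c U →+ ℚ}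
    (hη : ∀ γ, IsRoot c U γ → η γ ≠ 0)
    (hξ : ∀ β γ, IsRoot c U β → IsRoot c U γ → 0 < η β → 0 < η γ → ξ β / η β = ξ γ / η γ → β = γ)
    {Φ : Finset (WeightGroup c U)} (hΦ : ∀ γ, γ ∈ Φ ↔ IsRoot c U γ)
    [DecidableEq (WeightGroup c U)] {ζ : WeightGroup c U} {v : Matrix n n K}
    (hv : v ∈ gradedPart K (fun _ => ()) (weight c U) ζ) (hv0 : v ≠ 0)
    (hve : ∀ γ, IsRoot c U γ → 0 < η γ → ⁅e γ, v⁆ = 0) {u : WeightGroup c U → Matrix n n K}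
    (hu : ∀ γ, u γ ∈ gradedPart K (fun _ => ()) (weight c U) (ζ + γ))
    (hvu : v = ∑ γ ∈ Φ.filter (0 < η ·), ⁅e (-γ), u γ⁆) {J : Finset (WeightGroup c U)}
    (hJ : ∀ γ ∈ J, IsRoot c U γ ∧ 0 < η γ)
    (hJlow : ∀ γ ∈ J, ∀ δ, IsRoot c U δ → 0 < η δ → ξ δ / η δ < ξ γ / η γ → δ ∈ J) :
    ∃ l : List (WeightGroup c U), l.toFinset = J ∧
      (l.Pairwise fun a b => ξ b / η b < ξ a / η a) ∧
      ∃ m ∈ rootExteriorSpan e (Φ.filter fun γ => 0 < η γ ∧ γ ∈ J ∨ η γ < 0 ∧ -γ ∉ J)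
        (l.length + 1) (ζ + l.sum), exteriorDiff m =
          (l.map fun γ => ι K (dualInl K n (e γ))).prod * ι K (dualInr K n v) := by
  induction J using Finset.induction_on_max_value (fun γ => ξ γ / η γ) with
  | empty =>
    refine ⟨[], rfl, List.Pairwise.nil, ∑ γ ∈ Φ.filter (0 < η ·),
      ι K (dualInl K n (e (-γ))) * ι K (dualInr K n (u γ)), sum_mem fun γ hγ => ?_, ?_⟩
    · rw [Finset.mem_filter, hΦ] at hγ
      have h1 := ι_mul_mem_exteriorSpan (e := fun γ => dualInl K n (e γ))
        (N := fun ζ => (gradedPart K (fun _ : n => ()) (weight c U) ζ).map (dualInr K n))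
        (R := Φ.filter fun γ => 0 < η γ ∧ γ ∈ (∅ : Finset (WeightGroup c U)) ∨
          η γ < 0 ∧ -γ ∉ (∅ : Finset (WeightGroup c U))) (γ := -γ) (by
        rw [Finset.mem_filter, hΦ]
        exact ⟨h.isRoot_neg hp hγ.1, Or.inr ⟨by rw [map_neg]; linarith [hγ.2], by simp⟩⟩)
        (ι_mem_exteriorSpan (K := K) (Submodule.mem_map_of_mem (hu γ)))
      simpa using h1
    · simp only [map_sum, exteriorDiff_ι_mul, exteriorDiff_ι, mul_zero, sub_zero, exteriorLie_ι,
        dualInl_lie_dualInr, List.map_nil, List.prod_nil, one_mul]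
      rw [← map_sum, ← map_sum, ← hvu]
  | insert β s hβs hmax ih =>
    obtain ⟨hβ, hηβ⟩ := hJ β (Finset.mem_insert_self _ _)
    have hmem : ∀ γ, γ ∈ s ↔ IsRoot c U γ ∧ 0 < η γ ∧ ξ γ / η γ < ξ β / η β := by
      refine fun γ => ⟨fun hγ => ?_, fun hγ => ?_⟩
      · obtain ⟨h1, h2⟩ := hJ γ (Finset.mem_insert_of_mem hγ)
        exact ⟨h1, h2, lt_of_le_of_ne (hmax γ hγ) fun h3 =>
          hβs (hξ γ β h1 hβ h2 hηβ h3 ▸ hγ)⟩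
      · refine (Finset.mem_insert.mp (hJlow β (Finset.mem_insert_self _ _) γ hγ.1 hγ.2.1
          hγ.2.2)).resolve_left fun h1 => ?_
        rw [h1] at hγ
        exact lt_irrefl _ hγ.2.2
    obtain ⟨l, hl, hpair, m, hm, hmw⟩ := ih (fun γ hγ => hJ γ (Finset.mem_insert_of_mem hγ))
      fun γ hγ δ hδ hηδ h1 => (hmem δ).mpr ⟨hδ, hηδ, h1.trans ((hmem γ).mp hγ).2.2⟩
    obtain ⟨ψ, hψ⟩ : ∃ ψ : WeightGroup c U →+ ℚ, ∀ γ, ψ γ = ξ β / η β * η γ - ξ γ :=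
      ⟨(AddMonoidHom.mulLeft (ξ β / η β)).comp η - ξ, fun γ => rfl⟩
    have hψβ : ψ β = 0 := by rw [hψ, div_mul_cancel₀ _ hηβ.ne', sub_self]
    have hψpos : ∀ γ, 0 < η γ → (ξ γ / η γ < ξ β / η β ↔ 0 < ψ γ) := fun γ hγ => by
      rw [hψ, sub_pos, div_lt_iff₀ hγ]
    have hψ0 : ∀ γ, IsRoot c U γ → 0 < η γ → ψ γ = 0 → γ = β := fun γ hγ h1 h2 => by
      refine hξ γ β hγ hβ h1 hηβ ?_
      rw [hψ, sub_eq_zero] at h2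
      rw [div_eq_iff h1.ne', h2]
    obtain ⟨t, hte, htf⟩ := he β hβ
    have hr : ∀ γ, γ ∈ Φ.filter (0 < ψ ·) ↔ IsRoot c U γ ∧ 0 < ψ γ := fun γ => by
      rw [Finset.mem_filter, hΦ]
    have hsψ : ∀ γ, γ ∈ s ↔ IsRoot c U γ ∧ 0 < η γ ∧ 0 < ψ γ := fun γ => by
      rw [hmem]
      exact and_congr_right fun _ => and_congr_right fun h1 => hψpos γ h1
    have hroots : ∀ γ, IsRoot c U γ → (γ ∉ s → 0 < η γ → ψ γ = 0 → γ = β) ∧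
        (η γ < 0 → (-γ ∉ s ↔ 0 ≤ ψ γ) ∧ (ψ γ = 0 → γ = -β)) := by
      refine fun γ hγ => ⟨fun _ => hψ0 γ hγ, fun h1 => ?_⟩
      have h2 : 0 < η (-γ) := by rw [map_neg]; linarith
      have h3 := h.isRoot_neg hp hγ
      refine ⟨?_, fun h4 => ?_⟩
      · rw [hsψ, map_neg ψ]
        simp only [h3, h2, true_and]
        rw [neg_pos, not_lt]
      · rw [← hψ0 (-γ) h3 h2 (by rw [map_neg, h4, neg_zero]), neg_neg]
    have hR : (Φ.filter fun γ => 0 < η γ ∧ γ ∈ s ∨ η γ < 0 ∧ -γ ∉ s) =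
        insert (-β) (Φ.filter (0 < ψ ·)) := by
      ext γ
      rw [Finset.mem_insert, hr, Finset.mem_filter, hΦ]
      constructor
      · rintro ⟨hγ, ⟨h1, h2⟩ | ⟨h1, h2⟩⟩
        · exact Or.inr ⟨hγ, ((hsψ γ).mp h2).2.2⟩
        · rcases (((hroots γ hγ).2 h1).1.mp h2).eq_or_lt' with h3 | h3
          · exact Or.inl (((hroots γ hγ).2 h1).2 h3)
          · exact Or.inr ⟨hγ, h3⟩
      · rintro (rfl | ⟨hγ, h1⟩)
        · exact ⟨h.isRoot_neg hp hβ, Or.inr ⟨by rw [map_neg]; linarith, by rwa [neg_neg]⟩⟩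
        · refine ⟨hγ, ?_⟩
          rcases lt_or_gt_of_ne (hη γ hγ) with h2 | h2
          · exact Or.inr ⟨h2, ((hroots γ hγ).2 h2).1.mpr h1.le⟩
          · exact Or.inl ⟨h2, (hsψ γ).mpr ⟨hγ, h2, h1⟩⟩
    have hR' : (Φ.filter fun γ => 0 < η γ ∧ γ ∈ insert β s ∨ η γ < 0 ∧ -γ ∉ insert β s) =
        insert β (Φ.filter (0 < ψ ·)) := by
      ext γ
      rw [Finset.mem_insert, hr, Finset.mem_filter, hΦ]
      constructor
      · rintro ⟨hγ, ⟨h1, h2⟩ | ⟨h1, h2⟩⟩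
        · exact (Finset.mem_insert.mp h2).imp id fun h2 => ⟨hγ, ((hsψ γ).mp h2).2.2⟩
        · rw [Finset.mem_insert, not_or] at h2
          rcases (((hroots γ hγ).2 h1).1.mp h2.2).eq_or_lt' with h3 | h3
          · exact absurd (by rw [((hroots γ hγ).2 h1).2 h3, neg_neg]) h2.1
          · exact Or.inr ⟨hγ, h3⟩
      · rintro (rfl | ⟨hγ, h1⟩)
        · exact ⟨hβ, Or.inl ⟨hηβ, Finset.mem_insert_self _ _⟩⟩
        · refine ⟨hγ, ?_⟩
          rcases lt_or_gt_of_ne (hη γ hγ) with h2 | h2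
          · refine Or.inr ⟨h2, ?_⟩
            rw [Finset.mem_insert, not_or]
            refine ⟨fun h3 => ?_, ((hroots γ hγ).2 h2).1.mpr h1.le⟩
            rw [neg_eq_iff_eq_neg.mp h3, map_neg, hψβ, neg_zero] at h1
            exact lt_irrefl _ h1
          · exact Or.inl ⟨h2, Finset.mem_insert_of_mem ((hsψ γ).mpr ⟨hγ, h2, h1⟩)⟩
    have hls : ∀ γ, γ ∈ l ↔ γ ∈ s := fun γ => by rw [← hl, List.mem_toFinset]
    have hnodup : l.Nodup := hpair.imp fun h1 h2 => by
      rw [h2] at h1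
      exact lt_irrefl _ h1
    have hζ : 0 ≤ t.co (ζ + l.sum) := by
      have h1 : 0 ≤ t.co ζ := (t.isGradedSl2 h).deg_nonneg_of_e_eq_zero hv hv0 (by
        rw [LieAlgebra.ad_apply, hte]
        exact hve β hβ hηβ)
      have h2 := t.sum_co_nonneg h hηβ hψβ hsψ
      rw [← hl, List.sum_toFinset _ hnodup, ← map_list_sum] at h2
      rw [map_add]
      exact add_nonneg h1 h2
    rw [hR] at hm
    rw [hR']
    have hw0 : exteriorLie (dualInl K n (e β))
        ((l.map fun γ => ι K (dualInl K n (e γ))).prod * ι K (dualInr K n v)) = 0 := by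
      refine exteriorLie_prod_eq_zero (by rw [dualInl_lie_dualInr, hve β hβ hηβ, map_zero])
        fun l₁ γ l₂ hl' => ?_
      have hγ : γ ∈ s := (hls γ).mp (by simp [hl'])
      obtain ⟨h1, h2, h3⟩ := (hsψ γ).mp hγ
      refine ((he.raisesDegree h hp hr hβ hψβ.ge).lie_e γ ((hr γ).mpr ⟨h1, h3⟩)).imp id ?_
      rintro ⟨h4, a, ha⟩
      have h5 : 0 < η (γ + β) := by
        rw [map_add]
        linarith
      have h6 : ξ γ / η γ < ξ (γ + β) / η (γ + β) := by
        have h7 := (hψpos γ h2).mpr h3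
        rw [div_lt_div_iff₀ h2 h5, map_add, map_add]
        rw [div_lt_div_iff₀ h2 hηβ] at h7
        linarith
      refine ⟨γ + β, ?_, a, ha⟩
      have h7 : γ + β ∈ l := (hls _).mpr ((hsψ _).mpr ⟨((hr _).mp h4).1, h5, ((hr _).mp h4).2⟩)
      rw [hl', List.pairwise_append, List.pairwise_cons] at hpair
      rw [hl', List.mem_append, List.mem_cons] at h7
      rcases h7 with h7 | h7 | h7
      · exact h7
      · rw [h7] at h6
        exact absurd h6 (lt_irrefl _)
      · exact absurd h6 (hpair.2.1.1 _ h7).not_gt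
    obtain ⟨m', hm', hmw'⟩ := he.exists_exteriorDiff_eq_ι_mul h hp hr hψβ hte htf hζ
      (exteriorSpan_prod_mem (fun γ hγ => (hr γ).mpr ⟨((hsψ γ).mp ((hls γ).mp hγ)).1,
        ((hsψ γ).mp ((hls γ).mp hγ)).2.2⟩) (Submodule.mem_map_of_mem hv)) hw0 hm hmw
    refine ⟨β :: l, by rw [List.toFinset_cons, hl],
      List.pairwise_cons.mpr ⟨fun γ hγ => ((hmem γ).mp ((hls γ).mp hγ)).2.2, hpair⟩, m', ?_, ?_⟩
    · rw [List.length_cons, List.sum_cons, add_comm β, ← add_assoc]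
      exact hm'
    · rw [hmw', List.map_cons, List.prod_cons, mul_assoc]

/-- A highest weight vector in the image of the negative root vectors vanishes. -/
theorem IsRootFamily.eq_zero_of_eq_sum_lie [CharP K p] (he : IsRootFamily e)
    (h : IsReductiveStabilizer p c U) (hp : 2 < p) {η ξ : WeightGroup c U →+ ℚ}
    (hη : ∀ γ, IsRoot c U γ → η γ ≠ 0)
    (hξ : ∀ β γ, IsRoot c U β → IsRoot c U γ → 0 < η β → 0 < η γ → ξ β / η β = ξ γ / η γ → β = γ)
    {Φ : Finset (WeightGroup c U)} (hΦ : ∀ γ, γ ∈ Φ ↔ IsRoot c U γ) {ζ : WeightGroup c U}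
    {v : Matrix n n K} (hv : v ∈ gradedPart K (fun _ => ()) (weight c U) ζ)
    (hve : ∀ γ, IsRoot c U γ → 0 < η γ → ⁅e γ, v⁆ = 0) {u : WeightGroup c U → Matrix n n K}
    (hu : ∀ γ, u γ ∈ gradedPart K (fun _ => ()) (weight c U) (ζ + γ))
    (hvu : v = ∑ γ ∈ Φ.filter (0 < η ·), ⁅e (-γ), u γ⁆) : v = 0 := by
  classical
  by_contra hv0
  have hJ : ∀ γ, γ ∈ Φ.filter (0 < η ·) ↔ IsRoot c U γ ∧ 0 < η γ := fun γ => by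
    rw [Finset.mem_filter, hΦ]
  obtain ⟨l, hl, hpair, m, hm, hmw⟩ :=
    he.exists_exteriorDiff_eq_prod h hp hη hξ hΦ hv hv0 hve hu hvu
      (J := Φ.filter (0 < η ·)) (fun γ => (hJ γ).mp) fun _ _ δ h1 h2 _ => (hJ δ).mpr ⟨h1, h2⟩
  have hnodup : l.Nodup := hpair.imp fun h1 h2 => by
    rw [h2] at h1
    exact lt_irrefl _ h1
  have hls : ∀ γ ∈ l, IsRoot c U γ := fun γ hγ => by
    rw [← List.mem_toFinset, hl, hJ] at hγ
    exact hγ.1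
  rw [rootExteriorSpan, exteriorSpan_eq_bot, Submodule.mem_bot] at hm
  · rw [hm, map_zero] at hmw
    refine ExteriorAlgebra.prod_mul_ι_ne_zero (e := fun γ => dualInl K n (e γ)) hnodup
      (u := dualInr K n v) (fun h0 => hv0 (TrivSqZeroExt.inr_injective h0)) (fun γ hγ => ?_)
      hmw.symm
    obtain ⟨s, t, hst⟩ : ∃ s t, e γ s t ≠ 0 := by
      by_contra! h0
      exact he.ne_zero (hls γ hγ) (Matrix.ext h0)
    refine ⟨(e γ s t)⁻¹ • Matrix.entryLinearMap K K s t ∘ₗ dualFst K n, ?_, ?_, fun δ hδ hne => ?_⟩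
    · change (e γ s t)⁻¹ * e γ s t = 1
      exact inv_mul_cancel₀ hst
    · change (e γ s t)⁻¹ * 0 = 0
      exact mul_zero _
    · change (e γ s t)⁻¹ * e δ s t = 0
      rw [mul_eq_zero]
      refine Or.inr ?_
      by_contra h0
      exact hne (add_left_cancel (((he.mem (hls δ hδ)).2 s t h0).2.symm.trans
        ((he.mem (hls γ hγ)).2 s t hst).2))
  · rw [Nat.lt_succ_iff, ← List.toFinset_card_of_nodup hnodup, hl]
    refine Finset.card_le_card fun γ hγ => ?_
    rw [Finset.mem_filter] at hγ ⊢
    refine ⟨hγ.1, ?_⟩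
    rcases hγ.2 with h1 | ⟨h1, h2⟩
    · exact h1.1
    · exact absurd ((hJ _).mpr ⟨h.isRoot_neg hp ((hΦ γ).mp hγ.1), by rw [map_neg]; linarith⟩) h2

end HighestWeight

section TriangularDecomposition

attribute [local instance] LieRing.ofAssociativeRing LieAlgebra.ofAssociativeAlgebra

variable {K I n : Type} [Field K] [Fintype n] [DecidableEq n] {c : n → I}
  {U : Submodule K (Matrix n n K)} {p : ℕ} {e : WeightGroup c U → Matrix n n K}

theorem exists_regular [CharP K p] (h : IsReductiveStabilizer p c U) (hp : 2 < p) :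
    ∃ η : WeightGroup c U →+ ℚ, ∀ γ, IsRoot c U γ → η γ ≠ 0 := by
  obtain ⟨Φ, hΦ⟩ := exists_finset_isRoot c U
  let f : Φ → Dual ℚ (WeightGroup c U →+ ℚ) := fun γ =>
    { toFun := fun η => η γ
      map_add' := fun _ _ => rfl
      map_smul' := fun _ _ => rfl }
  obtain ⟨η, hη⟩ := Module.Dual.exists_forall_ne_zero_of_forall_exists f fun γ => by
    obtain ⟨t⟩ := h.exists_rootTriple hp ((hΦ γ).mp γ.2)
    refine ⟨(Int.castAddHom ℚ).comp t.co, ?_⟩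
    change ((t.co γ : ℤ) : ℚ) ≠ 0
    rw [t.co_self]
    norm_num
  exact ⟨η, fun γ hγ => hη ⟨γ, (hΦ γ).mpr hγ⟩⟩

theorem exists_slope [CharP K p] (h : IsReductiveStabilizer p c U) (hp : 2 < p)
    (η : WeightGroup c U →+ ℚ) :
    ∃ ξ : WeightGroup c U →+ ℚ, ∀ β γ, IsRoot c U β → IsRoot c U γ → 0 < η β → 0 < η γ →
      ξ β / η β = ξ γ / η γ → β = γ := by
  obtain ⟨Φ, hΦ⟩ := exists_finset_isRoot c U
  let P := {J : Φ × Φ // J.1 ≠ J.2 ∧ 0 < η J.1 ∧ 0 < η J.2}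
  let f : P → Dual ℚ (WeightGroup c U →+ ℚ) := fun J =>
    { toFun := fun ξ => ξ J.1.1 * η J.1.2 - ξ J.1.2 * η J.1.1
      map_add' := fun ξ ξ' => by
        rw [AddMonoidHom.add_apply, AddMonoidHom.add_apply]
        ring
      map_smul' := fun a ξ => by
        change a * ξ J.1.1 * η J.1.2 - a * ξ J.1.2 * η J.1.1 =
          a * (ξ J.1.1 * η J.1.2 - ξ J.1.2 * η J.1.1)
        ring }
  obtain ⟨ξ, hξ⟩ := Module.Dual.exists_forall_ne_zero_of_forall_exists f fun J => by
    obtain ⟨⟨⟨β, hβ⟩, γ, hγ⟩, hne, h1, h2⟩ := J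
    by_contra! h0
    refine hne (Subtype.ext (RootTriple.eq_of_proportional h hp ((hΦ γ).mp hγ) ((hΦ β).mp hβ) h1 h2
      fun δ t => ?_))
    exact sub_eq_zero.mp (h0 ((Int.castAddHom ℚ).comp t.co))
  refine ⟨ξ, fun β γ hβ hγ h1 h2 h3 => ?_⟩
  by_contra hne
  refine hξ ⟨(⟨β, (hΦ β).mpr hβ⟩, ⟨γ, (hΦ γ).mpr hγ⟩), fun h4 => hne (congrArg Subtype.val h4),
    h1, h2⟩ ?_
  rw [div_eq_div_iff h1.ne' h2.ne'] at h3
  exact sub_eq_zero.mpr h3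

/-- The matrices killed by all root vectors positive for `η`. -/
def highestPart (e : WeightGroup c U → Matrix n n K) (η : WeightGroup c U →+ ℚ) :
    Submodule K (Matrix n n K) where
  carrier := {v | ∀ γ, IsRoot c U γ → 0 < η γ → ⁅e γ, v⁆ = 0}
  add_mem' := fun hv hw γ h1 h2 => by rw [lie_add, hv γ h1 h2, hw γ h1 h2, add_zero]
  zero_mem' := fun _ _ _ => lie_zero _
  smul_mem' := fun a v hv γ h1 h2 => by rw [lie_smul, hv γ h1 h2, smul_zero]

/-- The span of the images of the root vectors negative for `η`. -/
def loweringPart (e : WeightGroup c U → Matrix n n K) (η : WeightGroup c U →+ ℚ) :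
    Submodule K (Matrix n n K) :=
  Submodule.span K {v | ∃ γ u, IsRoot c U γ ∧ η γ < 0 ∧ v = ⁅e γ, u⁆}

theorem exists_eq_sum_of_mem_loweringPart [CharP K p] (h : IsReductiveStabilizer p c U)
    (hp : 2 < p) {η : WeightGroup c U →+ ℚ} {Φ : Finset (WeightGroup c U)}
    (hΦ : ∀ γ, γ ∈ Φ ↔ IsRoot c U γ) {v : Matrix n n K} (hv : v ∈ loweringPart e η) :
    ∃ u : WeightGroup c U → Matrix n n K, v = ∑ γ ∈ Φ.filter (0 < η ·), ⁅e (-γ), u γ⁆ := by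
  classical
  induction hv using Submodule.span_induction with
  | mem v hv =>
    obtain ⟨γ, u, hγ, h1, rfl⟩ := hv
    refine ⟨fun δ => if δ = -γ then u else 0, ?_⟩
    rw [Finset.sum_eq_single (-γ)]
    · simp only [if_true, neg_neg]
    · intro δ _ hδ
      simp only [if_neg hδ, lie_zero]
    · intro h2
      refine absurd (Finset.mem_filter.mpr ⟨(hΦ _).mpr (h.isRoot_neg hp hγ), ?_⟩) h2
      rw [map_neg]
      linarith
  | zero => exact ⟨0, by simp⟩
  | add v w _ _ hv hw =>
    obtain ⟨u, rfl⟩ := hv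
    obtain ⟨u', rfl⟩ := hw
    exact ⟨u + u', by simp only [Pi.add_apply, lie_add, Finset.sum_add_distrib]⟩
  | smul a v _ hv =>
    obtain ⟨u, rfl⟩ := hv
    exact ⟨a • u, by simp only [Pi.smul_apply, lie_smul, Finset.smul_sum]⟩

theorem IsRootFamily.component_mem_highestPart [DecidableEq (WeightGroup c U)]
    (he : IsRootFamily e) {η : WeightGroup c U →+ ℚ} {v : Matrix n n K} (hv : v ∈ highestPart e η)
    (ζ : WeightGroup c U) : component K (weight c U) ζ v ∈ highestPart e η := fun γ h1 h2 => by
  rw [← component_lie (he.mem h1).2, hv γ h1 h2, map_zero]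

theorem IsRootFamily.disjoint_highestPart [CharP K p] (he : IsRootFamily e)
    (h : IsReductiveStabilizer p c U) (hp : 2 < p) {η : WeightGroup c U →+ ℚ}
    (hη : ∀ γ, IsRoot c U γ → η γ ≠ 0) : Disjoint (highestPart e η) (loweringPart e η) := by
  classical
  obtain ⟨Φ, hΦ⟩ := exists_finset_isRoot c U
  obtain ⟨ξ, hξ⟩ := exists_slope h hp η
  rw [Submodule.disjoint_def]
  intro v hv hv'
  obtain ⟨u, hu⟩ := exists_eq_sum_of_mem_loweringPart h hp hΦ hv'
  rw [← sum_component (weight c U) v]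
  refine Finset.sum_eq_zero fun ζ _ => ?_
  refine he.eq_zero_of_eq_sum_lie h hp hη hξ hΦ (component_mem_gradedPart _ ζ v)
    (he.component_mem_highestPart hv ζ)
    (u := fun γ => component K (weight c U) (ζ + γ) (u γ))
    (fun γ => component_mem_gradedPart _ _ _) ?_
  conv_lhs => rw [hu, map_sum]
  refine Finset.sum_congr rfl fun γ hγ => ?_
  rw [Finset.mem_filter, hΦ] at hγ
  rw [← component_lie (he.mem (h.isRoot_neg hp hγ.1)).2, add_neg_cancel_right]

end TriangularDecomposition

section TraceForm

attribute [local instance] LieRing.ofAssociativeRing LieAlgebra.ofAssociativeAlgebra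

variable {K n : Type} [Field K] [Fintype n]

/-- The trace form on matrices. -/
def matrixTraceForm (K n : Type) [Field K] [Fintype n] : LinearMap.BilinForm K (Matrix n n K) :=
  LinearMap.mk₂ K (fun x y => (x * y).trace)
    (fun x y z => by rw [add_mul, Matrix.trace_add])
    (fun a x y => by rw [Matrix.smul_mul, Matrix.trace_smul])
    (fun x y z => by rw [mul_add, Matrix.trace_add])
    (fun a x y => by rw [Matrix.mul_smul, Matrix.trace_smul])

theorem matrixTraceForm_apply (x y : Matrix n n K) : matrixTraceForm K n x y = (x * y).trace := rfl

theorem matrixTraceForm_comm (x y : Matrix n n K) :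
    matrixTraceForm K n x y = matrixTraceForm K n y x :=
  Matrix.trace_mul_comm x y

theorem matrixTraceForm_isRefl : (matrixTraceForm K n).IsRefl := fun x y h => by
  rw [matrixTraceForm_comm]
  exact h

theorem matrixTraceForm_nondegenerate : (matrixTraceForm K n).Nondegenerate := by
  refine ⟨fun x hx => ?_, fun x hx => ?_⟩
  · exact Matrix.ext_iff_trace_mul_right.mpr fun y => by
      rw [zero_mul, Matrix.trace_zero]
      exact hx y
  · exact Matrix.ext_iff_trace_mul_left.mpr fun y => by
      rw [mul_zero, Matrix.trace_zero]
      exact hx y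

theorem matrixTraceForm_lie [DecidableEq n] (x y z : Matrix n n K) :
    matrixTraceForm K n ⁅x, y⁆ z = -matrixTraceForm K n y ⁅x, z⁆ := by
  simp only [matrixTraceForm_apply, Ring.lie_def, sub_mul, mul_sub, Matrix.trace_sub, neg_sub]
  rw [mul_assoc x, Matrix.trace_mul_comm x, mul_assoc, mul_assoc]

end TraceForm

section HighestWeight

attribute [local instance] LieRing.ofAssociativeRing LieAlgebra.ofAssociativeAlgebra

variable {K I n : Type} [Field K] [Fintype n] [DecidableEq n] {c : n → I}
  {U : Submodule K (Matrix n n K)} {p : ℕ} {e : WeightGroup c U → Matrix n n K}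

theorem exists_of_lie_apply_ne_zero {A : Type} [AddCommGroup A] {κ : n → A} {γ : A}
    {x z : Matrix n n K} (hx : x ∈ gradedPart K c κ γ) {s t : n} (h : ⁅x, z⁆ s t ≠ 0) :
    ∃ s' t', z s' t' ≠ 0 ∧ κ s - κ t = γ + (κ s' - κ t') := by
  rw [Ring.lie_def, Matrix.sub_apply] at h
  by_cases h1 : (x * z) s t = 0
  · rw [h1, zero_sub, neg_ne_zero, Matrix.mul_apply] at h
    obtain ⟨r, -, hr⟩ := Finset.exists_ne_zero_of_sum_ne_zero h
    refine ⟨s, r, left_ne_zero_of_mul hr, ?_⟩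
    rw [(hx r t (right_ne_zero_of_mul hr)).2]
    abel
  · rw [Matrix.mul_apply] at h1
    obtain ⟨r, -, hr⟩ := Finset.exists_ne_zero_of_sum_ne_zero h1
    refine ⟨r, t, right_ne_zero_of_mul hr, ?_⟩
    rw [(hx s r (left_ne_zero_of_mul hr)).2]
    abel

/-- A nonzero space of matrices stable under the positive root vectors contains a nonzero vector
killed by them. -/
theorem IsRootFamily.exists_mem_highestPart (he : IsRootFamily e) {η : WeightGroup c U →+ ℚ}
    {Z : Submodule K (Matrix n n K)} (hZ : Z ≠ ⊥)
    (hstable : ∀ γ, IsRoot c U γ → 0 < η γ → ∀ z ∈ Z, ⁅e γ, z⁆ ∈ Z) :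
    ∃ z ∈ Z, z ≠ 0 ∧ z ∈ highestPart e η := by
  classical
  let δ : n × n → ℚ := fun J => η (weight c U J.1 - weight c U J.2)
  let S := (Finset.univ.image δ).filter fun q =>
    ∃ z ∈ Z, z ≠ 0 ∧ ∀ s t, z s t ≠ 0 → q ≤ δ (s, t)
  have key : ∀ z ∈ Z, z ≠ 0 → ∃ s t, z s t ≠ 0 ∧ δ (s, t) ∈ S := by
    intro z hz hz0
    have hne : (Finset.univ.filter fun J : n × n => z J.1 J.2 ≠ 0).Nonempty := by
      by_contra h
      rw [Finset.not_nonempty_iff_eq_empty, Finset.filter_eq_empty_iff] at h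
      exact hz0 (Matrix.ext fun s t => not_not.mp (h (Finset.mem_univ (s, t))))
    obtain ⟨⟨s, t⟩, hst, hmin⟩ := Finset.exists_min_image _ δ hne
    rw [Finset.mem_filter] at hst
    refine ⟨s, t, hst.2, Finset.mem_filter.mpr ⟨Finset.mem_image_of_mem _ (Finset.mem_univ _),
      z, hz, hz0, fun s' t' h => hmin (s', t') ?_⟩⟩
    exact Finset.mem_filter.mpr ⟨Finset.mem_univ _, h⟩
  obtain ⟨z₀, hz₀, hz₀0⟩ := Submodule.exists_mem_ne_zero_of_ne_bot hZ
  obtain ⟨s₀, t₀, -, h₀⟩ := key z₀ hz₀ hz₀0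
  obtain ⟨q, hq, hmax⟩ := Finset.exists_max_image S id ⟨_, h₀⟩
  obtain ⟨-, z, hz, hz0, hqz⟩ := Finset.mem_filter.mp hq
  refine ⟨z, hz, hz0, fun γ hγ h1 => ?_⟩
  by_contra hne
  obtain ⟨s, t, hst, hS⟩ := key _ (hstable γ hγ h1 z hz) hne
  obtain ⟨s', t', h2, h3⟩ := exists_of_lie_apply_ne_zero (he.mem hγ).2 hst
  have h4 : δ (s, t) = η γ + δ (s', t') := by
    change η (weight c U s - weight c U t) = _
    rw [h3, map_add]
  have h5 := hmax _ hS
  have h6 := hqz s' t' h2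
  rw [id, id] at h5
  linarith

/-- The stabilizer is spanned by its diagonal matrices and the root vectors. -/
theorem IsRootFamily.matrixStabilizer_le [CharP K p] (he : IsRootFamily e)
    (h : IsReductiveStabilizer p c U) (hp : 2 < p) {Q : Submodule K (Matrix n n K)}
    (hd : ∀ d, Matrix.diagonal d ∈ matrixStabilizer c U → Matrix.diagonal d ∈ Q)
    (hQ : ∀ γ, IsRoot c U γ → e γ ∈ Q) : matrixStabilizer c U ≤ Q := by
  classical
  intro x hx
  rw [← sum_component (weight c U) x]
  refine sum_mem fun ζ _ => ?_
  have h1 := component_mem_matrixStabilizer (fun z u hu => component_weight_mem z hu) hx ζ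
  have h2 : component K (weight c U) ζ x ∈ gradedPart K c (weight c U) ζ :=
    component_mem_gradedPart_of_block _ ζ hx.1
  by_cases hζ : ζ = 0
  · subst hζ
    obtain ⟨d, hd'⟩ := h.eq_diagonal_of_mem h1 h2
    rw [hd'] at h1 ⊢
    exact hd d h1
  by_cases hx0 : component K (weight c U) ζ x = 0
  · rw [hx0]
    exact zero_mem _
  have hroot : IsRoot c U ζ := ⟨hζ, _, ⟨h1, h2⟩, hx0⟩
  obtain ⟨t, ht, -⟩ := he ζ hroot
  obtain ⟨r, hr⟩ := t.exists_eq_smul h hp ⟨h1, h2⟩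
  rw [hr, ht]
  exact Q.smul_mem _ (hQ ζ hroot)

theorem diagonal_lie_eq_smul {d : n → K} (hd : Matrix.diagonal d ∈ matrixStabilizer c U)
    {J : Type} {b : n → J} {ζ : WeightGroup c U} {v : Matrix n n K}
    (hv : v ∈ gradedPart K b (weight c U) ζ) : ⁅Matrix.diagonal d, v⁆ = ζ.2 ⟨d, hd⟩ • v := by
  ext s t
  rw [lie_diagonal_apply, Matrix.smul_apply, smul_eq_mul]
  by_cases hst : v s t = 0
  · rw [hst, mul_zero, mul_zero]
  have h1 : d s = d t + ζ.2 ⟨d, hd⟩ := congrFun (congrArg Prod.snd (hv s t hst).2) ⟨d, hd⟩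
  rw [h1, add_sub_cancel_left]

/-- A space stable under the stabilizer is the whole space as soon as it contains the vectors
killed by the positive root vectors. -/
theorem IsRootFamily.eq_top_of_highestPart_le [CharP K p] (he : IsRootFamily e)
    (h : IsReductiveStabilizer p c U) (hp : 2 < p) {η : WeightGroup c U →+ ℚ}
    (hη : ∀ γ, IsRoot c U γ → η γ ≠ 0) {Y : Submodule K (Matrix n n K)}
    (hY : ∀ x ∈ matrixStabilizer c U, ∀ y ∈ Y, ⁅x, y⁆ ∈ Y) (hle : highestPart e η ≤ Y) :
    Y = ⊤ := by
  set B := matrixTraceForm K n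
  have hB : ∀ Z, B.orthogonal (B.orthogonal Z) = Z :=
    LinearMap.BilinForm.orthogonal_orthogonal matrixTraceForm_nondegenerate matrixTraceForm_isRefl
  by_contra hne
  have hperp : B.orthogonal Y ≠ ⊥ := fun h0 => hne (by
    rw [← hB Y, h0, LinearMap.BilinForm.orthogonal_bot])
  obtain ⟨y, hy, hy0, hy1⟩ := he.exists_mem_highestPart (η := -η) hperp fun γ hγ _ z hz y hy => by
    have h1 := matrixTraceForm_lie (e γ) y z
    have h2 : B ⁅e γ, y⁆ z = 0 := hz _ (hY _ (he.mem hγ).1 y hy)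
    rw [h2, zero_eq_neg] at h1
    exact h1
  have h1 : B.orthogonal (loweringPart e (-η)) ≤ highestPart e η := by
    intro z hz γ hγ h1
    refine matrixTraceForm_nondegenerate.2 _ fun u => ?_
    have h2 : B ⁅e γ, u⁆ z = 0 := hz _ (Submodule.subset_span ⟨γ, u, hγ, by
      rw [AddMonoidHom.neg_apply]
      linarith, rfl⟩)
    have h3 := matrixTraceForm_lie (e γ) u z
    rw [h2, zero_eq_neg] at h3
    exact h3
  have h2 : y ∈ loweringPart e (-η) := by
    rw [← hB (loweringPart e (-η))]
    exact LinearMap.BilinForm.orthogonal_le (h1.trans hle) hy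
  have h3 := he.disjoint_highestPart h hp (η := -η) fun γ hγ => by
    rw [AddMonoidHom.neg_apply]
    exact neg_ne_zero.mpr (hη γ hγ)
  exact hy0 (Submodule.disjoint_def.mp h3 y hy1 h2)

end HighestWeight

section Complement

attribute [local instance] LieRing.ofAssociativeRing LieAlgebra.ofAssociativeAlgebra

variable {K I n : Type} [Field K] [Fintype n] [DecidableEq n] {c : n → I}
  {U : Submodule K (Matrix n n K)} {p : ℕ} {e : WeightGroup c U → Matrix n n K}

/-- The space generated by a vector under the negative root vectors. -/
def loweringClosure (e : WeightGroup c U → Matrix n n K) (η : WeightGroup c U →+ ℚ)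
    (v : Matrix n n K) : Submodule K (Matrix n n K) :=
  sInf {D | v ∈ D ∧ ∀ γ, IsRoot c U γ → η γ < 0 → ∀ d ∈ D, ⁅e γ, d⁆ ∈ D}

theorem mem_loweringClosure (η : WeightGroup c U →+ ℚ) (v : Matrix n n K) :
    v ∈ loweringClosure e η v :=
  (Submodule.mem_sInf).mpr fun _ hD => hD.1

theorem lie_mem_loweringClosure {η : WeightGroup c U →+ ℚ} {v : Matrix n n K}
    {γ : WeightGroup c U} (hγ : IsRoot c U γ) (h1 : η γ < 0) {d : Matrix n n K}
    (hd : d ∈ loweringClosure e η v) : ⁅e γ, d⁆ ∈ loweringClosure e η v :=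
  (Submodule.mem_sInf).mpr fun D hD => hD.2 γ hγ h1 d ((Submodule.mem_sInf).mp hd D hD)

theorem loweringClosure_le {η : WeightGroup c U →+ ℚ} {v : Matrix n n K}
    {D : Submodule K (Matrix n n K)} (hv : v ∈ D)
    (hD : ∀ γ, IsRoot c U γ → η γ < 0 → ∀ d ∈ D, ⁅e γ, d⁆ ∈ D) : loweringClosure e η v ≤ D :=
  sInf_le ⟨hv, hD⟩

theorem loweringClosure_le_sup (η : WeightGroup c U →+ ℚ) (v : Matrix n n K) :
    loweringClosure e η v ≤ Submodule.span K {v} ⊔ loweringPart e η :=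
  loweringClosure_le (Submodule.mem_sup_left (Submodule.mem_span_singleton_self v))
    fun γ hγ h1 d _ => Submodule.mem_sup_right (Submodule.subset_span ⟨γ, d, hγ, h1, rfl⟩)

/-- The space generated by a highest weight vector under the negative root vectors is stable under
the whole stabilizer. -/
theorem IsRootFamily.lie_mem_loweringClosure_of_highest [CharP K p] (he : IsRootFamily e)
    (h : IsReductiveStabilizer p c U) (hp : 2 < p) {η : WeightGroup c U →+ ℚ}
    (hη : ∀ γ, IsRoot c U γ → η γ ≠ 0) {J : Type} {b : n → J} {ζ : WeightGroup c U}
    {v : Matrix n n K} (hv : v ∈ highestPart e η) (hvζ : v ∈ gradedPart K b (weight c U) ζ)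
    {x d : Matrix n n K} (hx : x ∈ matrixStabilizer c U) (hd : d ∈ loweringClosure e η v) :
    ⁅x, d⁆ ∈ loweringClosure e η v := by
  let D : Submodule K (Matrix n n K) :=
    { carrier := {d | d ∈ loweringClosure e η v ∧
        ∀ x ∈ matrixStabilizer c U, ⁅x, d⁆ ∈ loweringClosure e η v}
      add_mem' := fun hd hd' => ⟨add_mem hd.1 hd'.1, fun x hx => by
        rw [lie_add]
        exact add_mem (hd.2 x hx) (hd'.2 x hx)⟩
      zero_mem' := ⟨zero_mem _, fun x _ => by
        rw [lie_zero]
        exact zero_mem _⟩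
      smul_mem' := fun a d hd => ⟨Submodule.smul_mem _ _ hd.1, fun x hx => by
        rw [lie_smul]
        exact Submodule.smul_mem _ _ (hd.2 x hx)⟩ }
  have hD : loweringClosure e η v ≤ D := by
    refine loweringClosure_le ⟨mem_loweringClosure η v, ?_⟩ fun γ hγ h1 d hd =>
      ⟨lie_mem_loweringClosure hγ h1 hd.1, fun x hx => ?_⟩
    · let Q : Submodule K (Matrix n n K) := (loweringClosure e η v).comap
        (LieAlgebra.ad K (Matrix n n K) v)
      have hQ : ∀ x, x ∈ Q ↔ ⁅x, v⁆ ∈ loweringClosure e η v := fun x => by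
        rw [← lie_skew, neg_mem_iff]
        rfl
      suffices matrixStabilizer c U ≤ Q from fun x hx => (hQ x).mp (this hx)
      refine he.matrixStabilizer_le h hp (fun d hd => ?_) fun γ hγ => ?_
      · rw [hQ, diagonal_lie_eq_smul hd hvζ]
        exact Submodule.smul_mem _ _ (mem_loweringClosure η v)
      · rw [hQ]
        rcases (hη γ hγ).lt_or_gt with h1 | h1
        · exact lie_mem_loweringClosure hγ h1 (mem_loweringClosure η v)
        · rw [hv γ hγ h1]
          exact zero_mem _
    · rw [leibniz_lie]
      exact add_mem (hd.2 _ (lie_mem_matrixStabilizer hx (he.mem hγ).1))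
        (lie_mem_loweringClosure hγ h1 (hd.2 x hx))
  exact (hD hd).2 x hx

/-- A space of matrices has a complement stable under its stabilizer. -/
theorem IsReductiveStabilizer.exists_isCompl [CharP K p] (h : IsReductiveStabilizer p c U)
    (hp : 2 < p) :
    ∃ U' : Submodule K (Matrix n n K),
      (∀ x ∈ matrixStabilizer c U, ∀ u ∈ U', ⁅x, u⁆ ∈ U') ∧ IsCompl U U' := by
  classical
  obtain ⟨η, hη⟩ := exists_regular h hp
  obtain ⟨e, he⟩ := exists_isRootFamily h hp hη
  obtain ⟨U', ⟨hU', hdisj⟩, hmax⟩ := WellFounded.has_min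
    (wellFounded_gt (α := Submodule K (Matrix n n K)))
    {U' | (∀ x ∈ matrixStabilizer c U, ∀ u ∈ U', ⁅x, u⁆ ∈ U') ∧ Disjoint U U'}
    ⟨⊥, fun x _ u hu => by
      rw [(Submodule.mem_bot K).mp hu, lie_zero]
      exact zero_mem _, disjoint_bot_right⟩
  have hsup : ∀ {Z Z' : Submodule K (Matrix n n K)},
      (∀ x ∈ matrixStabilizer c U, ∀ u ∈ Z, ⁅x, u⁆ ∈ Z) →
      (∀ x ∈ matrixStabilizer c U, ∀ u ∈ Z', ⁅x, u⁆ ∈ Z') →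
      ∀ x ∈ matrixStabilizer c U, ∀ u ∈ Z ⊔ Z', ⁅x, u⁆ ∈ Z ⊔ Z' := by
    intro Z Z' hZ hZ' x hx u hu
    obtain ⟨y, hy, z, hz, rfl⟩ := Submodule.mem_sup.mp hu
    rw [lie_add]
    exact Submodule.add_mem_sup (hZ x hx y hy) (hZ' x hx z hz)
  have hY := hsup (fun x hx => hx.2) hU'
  refine ⟨U', hU', hdisj, codisjoint_iff.mpr ?_⟩
  refine he.eq_top_of_highestPart_le h hp hη hY ?_
  by_contra hle
  obtain ⟨w, hw, hwY⟩ := SetLike.not_le_iff_exists.mp hle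
  obtain ⟨ζ, hζ⟩ : ∃ ζ, component K (weight c U) ζ w ∉ U ⊔ U' := by
    by_contra! h1
    rw [← sum_component (weight c U) w] at hwY
    exact hwY (sum_mem fun ζ _ => h1 ζ)
  set v := component K (weight c U) ζ w
  have hv : v ∈ highestPart e η := he.component_mem_highestPart hw ζ
  set D := loweringClosure e η v
  have hD : ∀ x ∈ matrixStabilizer c U, ∀ d ∈ D, ⁅x, d⁆ ∈ D := fun x hx d hd =>
    he.lie_mem_loweringClosure_of_highest h hp hη hv (component_mem_gradedPart _ ζ w) hx hd
  have hDY : Disjoint (U ⊔ U') D := by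
    rw [disjoint_iff]
    by_contra hne
    obtain ⟨z, hz, hz0, hzh⟩ := he.exists_mem_highestPart (η := η) hne fun γ hγ _ z hz =>
      ⟨hY _ (he.mem hγ).1 z hz.1, hD _ (he.mem hγ).1 z hz.2⟩
    obtain ⟨_, hav, l, hl, hz'⟩ := Submodule.mem_sup.mp (loweringClosure_le_sup η v hz.2)
    obtain ⟨a, rfl⟩ := Submodule.mem_span_singleton.mp hav
    have hl0 : l = 0 := Submodule.disjoint_def.mp (he.disjoint_highestPart h hp hη) l (by
      rw [← add_sub_cancel_left (a • v) l, hz']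
      exact sub_mem hzh (Submodule.smul_mem _ _ hv)) hl
    rw [hl0, add_zero] at hz'
    have ha : a ≠ 0 := fun ha => hz0 (by rw [← hz', ha, zero_smul])
    refine hζ ?_
    rw [← (Submodule.smul_mem_iff (U ⊔ U') ha), hz']
    exact hz.1
  refine hmax (U' ⊔ D) ⟨hsup hU' hD, hdisj.disjoint_sup_right_of_disjoint_sup_left hDY⟩ ?_
  refine lt_of_le_of_ne le_sup_left fun h1 => hζ (Submodule.mem_sup_right ?_)
  rw [h1]
  exact Submodule.mem_sup_right (mem_loweringClosure η v)

end Complement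

section Complement

attribute [local instance] LieRing.ofAssociativeRing LieAlgebra.ofAssociativeAlgebra

variable {K V I : Type} [Field K] [AddCommGroup V] [Module K V]

/-- An `H`-stable space of endomorphisms has a complement stable under its stabilizer. -/
theorem exists_isCompl_of_irreducible [IsAlgClosed K] [FiniteDimensional K V] [Finite I] {p : ℕ}
    [CharP K p] (hp : 2 < p) {W : I → Submodule K V}
    (hW : iSupIndep W) (hW' : iSup W = ⊤) (hdim : ∀ i, 2 * finrank K (W i) ≤ p + 1)
    {H : Subgroup (V ≃ₗ[K] V)} (hH : ∀ i, ∀ h ∈ H, ∀ v ∈ W i, h v ∈ W i)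
    (hirr : ∀ i, ∀ Z ≤ W i, (∀ h ∈ H, ∀ v ∈ Z, h v ∈ Z) → Z = ⊥ ∨ Z = W i)
    {U : Submodule K (End K V)} (hU : ∀ h ∈ H, ∀ u ∈ U, conjEnd h u ∈ U) :
    ∃ U' : Submodule K (End K V), (∀ x ∈ lieStabilizer W U, ∀ u ∈ U', ⁅x, u⁆ ∈ U') ∧
      IsCompl U U' := by
  obtain ⟨n, _, _, c, b, hb, h⟩ := exists_isReductiveStabilizer hW hW' hdim hH hirr hU
  obtain ⟨Y, hY, hUY⟩ := h.exists_isCompl hp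
  set M := LinearMap.toMatrixAlgEquiv b
  refine ⟨Y.comap M.toLinearMap, fun x hx u hu => ?_, ?_⟩
  · change M ⁅x, u⁆ ∈ Y
    rw [toMatrixAlgEquiv_lie]
    exact hY _ ((toMatrixAlgEquiv_mem_matrixStabilizer_iff hW hb).mpr hx) _ hu
  · let φ : Submodule K (End K V) ≃o Submodule K (Matrix n n K) :=
      Submodule.orderIsoMapComap M.toLinearEquiv
    have h1 : IsCompl (φ.symm (φ U)) (φ.symm Y) := φ.symm.isCompl hUY
    rwa [φ.symm_apply_apply] at h1

end Complement

section TruncatedExponential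

open Polynomial

variable {K : Type} [Field K]

/-- A formal series with nonzero linear term has a left inverse for composition, modulo a power of
the variable. -/
theorem exists_comp_left_inverse {E : K[X]} (h0 : E.eval 0 = 0) (h1 : E.derivative.eval 0 = 1)
    (m : ℕ) : ∃ L : K[X], X ^ m ∣ L.comp E - X := by
  obtain ⟨F, rfl⟩ : X ∣ E := by rwa [X_dvd_iff, coeff_zero_eq_eval_zero]
  have hF : F.eval 0 = 1 := by simpa using h1
  induction m with
  | zero => exact ⟨0, by simp⟩
  | succ m ih =>
    obtain ⟨L, w, hw⟩ := ih
    refine ⟨L - C (w.eval 0) * X ^ m, ?_⟩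
    have h2 : (L - C (w.eval 0) * X ^ m).comp (X * F) - X = X ^ m * (w - C (w.eval 0) * F ^ m) := by
      simp only [sub_comp, mul_comp, C_comp, pow_comp, X_comp]
      rw [sub_right_comm, hw]
      ring
    rw [h2, pow_succ]
    refine mul_dvd_mul_left _ ?_
    rw [X_dvd_iff, coeff_zero_eq_eval_zero]
    simp [hF]

/-- A formal series with nonzero linear term has a right inverse for composition, modulo a power of
the variable. -/
theorem exists_comp_right_inverse {E : K[X]} (h0 : E.eval 0 = 1) (h1 : E.derivative.eval 0 = 1)
    (m : ℕ) : ∃ q : K[X], X ∣ q ∧ X ^ m ∣ E.comp q - (1 + X) := by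
  suffices ∀ m : ℕ, ∃ q : K[X], X ∣ q ∧ X ^ (m + 1) ∣ E.comp q - (1 + X) by
    obtain ⟨q, hq, h⟩ := this m
    exact ⟨q, hq, (pow_dvd_pow _ (Nat.le_succ m)).trans h⟩
  intro m
  induction m with
  | zero => exact ⟨0, dvd_zero _, by simp [h0]⟩
  | succ m ih =>
    obtain ⟨q, hq, hs⟩ := ih
    set s := E.comp q - (1 + X) with hs'
    have hXs : X ∣ s := (dvd_pow_self X (Nat.succ_ne_zero m)).trans hs
    refine ⟨q - s, dvd_sub hq hXs, ?_⟩
    obtain ⟨k, hk⟩ := (E.map C).binomExpansion q (-s)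
    rw [derivative_map, eval_map, eval_map, eval_map] at hk
    change E.comp (q + -s) = E.comp q + E.derivative.comp q * -s + k * (-s) ^ 2 at hk
    have h2 : X ∣ E.derivative.comp q - 1 := by
      rw [X_dvd_iff, coeff_zero_eq_eval_zero, eval_sub, eval_comp, eval_one,
        ← coeff_zero_eq_eval_zero q, X_dvd_iff.mp hq, h1, sub_self]
    have h3 : E.comp (q - s) - (1 + X) = s * (k * s - (E.derivative.comp q - 1)) := by
      rw [sub_eq_add_neg q s, hk, eq_add_of_sub_eq hs'.symm]
      ring
    rw [h3, pow_succ]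
    exact mul_dvd_mul hs (dvd_sub (hXs.mul_left k) h2)

/-- The exponential series, truncated at degree `p`. -/
noncomputable def truncExp (K : Type) [Field K] (p : ℕ) : K[X] :=
  ∑ i ∈ Finset.range p, C ((i.factorial : K)⁻¹) * X ^ i

theorem aeval_truncExp {A : Type} [Ring A] [Algebra K A] (p : ℕ) (a : A) :
    aeval a (truncExp K p) = ∑ i ∈ Finset.range p, (i.factorial : K)⁻¹ • a ^ i := by
  simp [truncExp, Algebra.smul_def]

theorem eval_zero_truncExp {p : ℕ} (hp : 0 < p) : (truncExp K p).eval 0 = 1 := by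
  obtain ⟨p, rfl⟩ := Nat.exists_eq_succ_of_ne_zero hp.ne'
  simp [truncExp, eval_finsetSum, Finset.sum_range_succ']

theorem eval_zero_derivative_truncExp {p : ℕ} (hp : 1 < p) :
    (truncExp K p).derivative.eval 0 = 1 := by
  obtain ⟨p, rfl⟩ := Nat.exists_eq_add_of_lt hp
  rw [show 1 + p + 1 = p + 1 + 1 by ring]
  simp [truncExp, eval_finsetSum, Finset.sum_range_succ']

theorem aeval_truncExp_mul {A : Type} [Ring A] [Algebra K A] {p m : ℕ} [CharP K p]
    (hp : p.Prime) (hm : 2 * m ≤ p + 1) {a b : A} (hab : Commute a b) (ha : a ^ m = 0)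
    (hb : b ^ m = 0) :
    aeval a (truncExp K p) * aeval b (truncExp K p) = aeval (a + b) (truncExp K p) := by
  let f : ℕ × ℕ → A := fun J =>
    ((J.1.factorial : K)⁻¹ * (J.2.factorial : K)⁻¹) • (a ^ J.1 * b ^ J.2)
  have hf : ∀ J : ℕ × ℕ, p ≤ J.1 + J.2 → f J = 0 := by
    intro J hJ
    rcases le_or_gt m J.1 with h | h
    · simp [f, pow_eq_zero_of_le h ha]
    · simp [f, pow_eq_zero_of_le (show m ≤ J.2 by omega) hb]
  let S := Finset.range p ×ˢ Finset.range p
  have h1 : aeval a (truncExp K p) * aeval b (truncExp K p) = ∑ J ∈ S, f J := by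
    rw [aeval_truncExp, aeval_truncExp, Finset.sum_mul_sum, ← Finset.sum_product']
    exact Finset.sum_congr rfl fun J _ => smul_mul_smul_comm _ _ _ _
  have h2 : ∑ J ∈ S, f J = ∑ J ∈ S.filter fun J => J.1 + J.2 < p, f J :=
    (Finset.sum_filter_of_ne fun J _ hJ => lt_of_not_ge fun h => hJ (hf J h)).symm
  have h3 := Finset.sum_fiberwise_of_maps_to (s := S.filter fun J => J.1 + J.2 < p)
    (t := Finset.range p) (g := fun J => J.1 + J.2)
    (fun J hJ => Finset.mem_range.mpr (Finset.mem_filter.mp hJ).2) f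
  rw [h1, h2, ← h3, aeval_truncExp]
  refine Finset.sum_congr rfl fun i hi => ?_
  have hi' := Finset.mem_range.mp hi
  have h4 : (S.filter fun J => J.1 + J.2 < p).filter (fun J => J.1 + J.2 = i) =
      Finset.HasAntidiagonal.antidiagonal i := by
    ext J
    simp only [S, Finset.mem_filter, Finset.mem_product, Finset.mem_range,
      Finset.HasAntidiagonal.mem_antidiagonal]
    omega
  have hfac : ∀ j ≤ i, (j.factorial : K) ≠ 0 := fun j hj h0 => by
    rw [CharP.cast_eq_zero_iff K p, hp.dvd_factorial] at h0
    omega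
  rw [h4, hab.add_pow', Finset.smul_sum]
  refine Finset.sum_congr rfl fun J hJ => ?_
  have hJ' := Finset.HasAntidiagonal.mem_antidiagonal.mp hJ
  rw [← Nat.cast_smul_eq_nsmul K, smul_smul]
  have h5 : (i.factorial : K) = i.choose J.1 * J.1.factorial * J.2.factorial := by
    rw [← Nat.choose_mul_factorial_mul_factorial (show J.1 ≤ i by omega), ← hJ']
    push_cast
    rw [Nat.add_sub_cancel_left]
  have h6 := hfac i le_rfl
  have h7 := hfac J.1 (by omega)
  have h8 := hfac J.2 (by omega)
  refine congrArg (· • (a ^ J.1 * b ^ J.2)) ?_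
  rw [eq_inv_mul_iff_mul_eq₀ h6, h5]
  field_simp

end TruncatedExponential

section Unipotent

open Polynomial

attribute [local instance] LieRing.ofAssociativeRing LieAlgebra.ofAssociativeAlgebra

variable {K V I : Type} [Field K] [AddCommGroup V] [Module K V]

/-- The exponential of an inner derivation is the conjugation by the exponential. -/
theorem aeval_ad_truncExp {p m : ℕ} [CharP K p] (hp : p.Prime) (hm : 2 * m ≤ p + 1) {e : End K V}
    (he : e ^ m = 0) {g : V ≃ₗ[K] V} (hg : aeval e (truncExp K p) = (g : V →ₗ[K] V))
    (u : End K V) :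
    aeval (LieAlgebra.ad K (End K V) e) (truncExp K p) u = conjEnd g u := by
  have he' : (-e) ^ m = 0 := by rw [neg_pow, he, mul_zero]
  have h1 : aeval (-e) (truncExp K p) = (g.symm : V →ₗ[K] V) := by
    have h2 := aeval_truncExp_mul (K := K) hp hm (Commute.refl e).neg_right he he'
    rw [hg, add_neg_cancel, aeval_truncExp p 0] at h2
    have h3 : ∑ i ∈ Finset.range p, (i.factorial : K)⁻¹ • (0 : End K V) ^ i = 1 := by
      rw [Finset.sum_eq_single_of_mem 0 (Finset.mem_range.mpr hp.pos) fun i _ hi => by simp [hi]]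
      simp
    rw [h3] at h2
    ext v
    apply g.injective
    have := LinearMap.congr_fun h2 v
    simpa using this
  have h4 : aeval (LinearMap.mulLeft K e) (truncExp K p) =
      LinearMap.mulLeft K (aeval e (truncExp K p)) := by
    ext1 u
    simp [aeval_truncExp, LinearMap.pow_mulLeft, Finset.sum_mul]
  have h5 : aeval (LinearMap.mulRight K (-e)) (truncExp K p) =
      LinearMap.mulRight K (aeval (-e) (truncExp K p)) := by
    ext1 u
    simp [aeval_truncExp, LinearMap.pow_mulRight, Finset.mul_sum]
  have h6 : LieAlgebra.ad K (End K V) e = LinearMap.mulLeft K e + LinearMap.mulRight K (-e) := by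
    ext1 u
    simp [Ring.lie_def, sub_eq_add_neg]
  rw [h6, ← aeval_truncExp_mul hp hm (LinearMap.commute_mulLeft_right e (-e))
    (by rw [LinearMap.pow_mulLeft, he, LinearMap.mulLeft_zero_eq_zero])
    (by rw [LinearMap.pow_mulRight, he', LinearMap.mulRight_zero_eq_zero]), h4, h5, hg, h1]
  rfl

/-- A space stable under the stabilizer of `U` is stable under the unipotent automorphisms which
preserve `U`. -/
theorem conjEnd_mem_of_unipotent [FiniteDimensional K V] {p m : ℕ} [CharP K p] (hp : p.Prime)
    (hm : 2 * m ≤ p + 1) {W : I → Submodule K V} {U U' : Submodule K (End K V)}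
    (hU' : ∀ x ∈ lieStabilizer W U, ∀ u ∈ U', ⁅x, u⁆ ∈ U') {g : V ≃ₗ[K] V}
    (hg : ((g : V →ₗ[K] V) - 1 : End K V) ^ m = 0) (hgW : ∀ i, ∀ v ∈ W i, g v ∈ W i)
    (hgU : ∀ u ∈ U, conjEnd g u ∈ U) {u : End K V} (hu : u ∈ U') : conjEnd g u ∈ U' := by
  set N : End K V := (g : V →ₗ[K] V) - 1 with hN
  obtain ⟨q, ⟨q', rfl⟩, hq⟩ := exists_comp_right_inverse (eval_zero_truncExp (K := K) hp.pos)
    (eval_zero_derivative_truncExp hp.one_lt) m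
  set e : End K V := aeval N (X * q') with he'
  have he : e ^ m = 0 := by
    rw [he', ← map_pow, mul_pow, map_mul, map_pow, aeval_X, hg, zero_mul]
  have hE : aeval e (truncExp K p) = (g : V →ₗ[K] V) := by
    obtain ⟨w, hw⟩ := hq
    have h1 := congrArg (aeval N) hw
    rw [map_sub, aeval_comp, map_mul _ (X ^ m), map_pow, aeval_X, hg, zero_mul, sub_eq_zero] at h1
    rw [he', h1, map_add, map_one, aeval_X, hN, add_sub_cancel]
  have hT := aeval_ad_truncExp hp hm he hE
  set D := LieAlgebra.ad K (End K V) e with hD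
  obtain ⟨r, hr⟩ : IsNilpotent D := LieAlgebra.ad_nilpotent_of_nilpotent (R := K) ⟨m, he⟩
  set T := aeval D (truncExp K p) with hT'
  obtain ⟨L, w, hL⟩ := exists_comp_left_inverse (E := truncExp K p - 1)
    (by rw [eval_sub, eval_one, eval_zero_truncExp hp.pos, sub_self])
    (by rw [derivative_sub, derivative_one, sub_zero, eval_zero_derivative_truncExp hp.one_lt]) r
  have hDT : D = aeval (T - 1) L := by
    have h1 := congrArg (aeval D) hL
    rw [map_sub, aeval_comp, map_mul, map_pow, aeval_X, hr, zero_mul, sub_eq_zero, map_sub,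
      map_one] at h1
    exact h1.symm
  have hmem : e ∈ lieStabilizer W U := by
    rw [mem_lieStabilizer_iff_ad]
    refine ⟨fun i => mem_invtSubmodule_of_mem_adjoin (aeval_mem_adjoin_singleton K N)
      fun v hv => sub_mem (hgW i v hv) hv, ?_⟩
    rw [← hD, hDT]
    refine mem_invtSubmodule_of_mem_adjoin (aeval_mem_adjoin_singleton K _) fun v hv => ?_
    refine sub_mem ?_ hv
    rw [hT]
    exact hgU v hv
  rw [← hT]
  exact mem_invtSubmodule_of_mem_adjoin (aeval_mem_adjoin_singleton K D)
    (U := U') (fun v hv => hU' e hmem v hv) hu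

theorem pow_finrank_eq_zero_of_isNilpotent [FiniteDimensional K V] {f : End K V}
    (hf : IsNilpotent f) : f ^ finrank K V = 0 := by
  have h := f.aeval_self_charpoly
  rwa [hf.charpoly_eq_X_pow_finrank, map_pow, aeval_X] at h

/-- An automorphism of order a power of the characteristic is unipotent of bounded exponent. -/
theorem sub_one_pow_eq_zero_of_pow_eq_one [FiniteDimensional K V] {p m j : ℕ} [CharP K p]
    (hp : p.Prime) {W : I → Submodule K V} (hW' : iSup W = ⊤) (hdim : ∀ i, finrank K (W i) ≤ m)
    {g : V ≃ₗ[K] V} (hg : g ^ p ^ j = 1) (hgW : ∀ i, ∀ v ∈ W i, g v ∈ W i) :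
    ((g : V →ₗ[K] V) - 1 : End K V) ^ m = 0 := by
  have := Fact.mk hp
  set N : End K V := (g : V →ₗ[K] V) - 1 with hN
  have hnil : N ^ p ^ j = 0 := by
    have h1 : (X - 1 : K[X]) ^ p ^ j = X ^ p ^ j - 1 := by rw [sub_pow_char_pow, one_pow]
    have h2 := congrArg (aeval ((g : V →ₗ[K] V) : End K V)) h1
    simp only [map_sub, map_pow, aeval_X, map_one] at h2
    rw [hN, h2, sub_eq_zero]
    ext v
    have h3 := LinearEquiv.congr_fun hg v
    rw [LinearEquiv.coe_pow] at h3
    rw [Module.End.pow_apply]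
    exact h3
  have hNW : ∀ i, ∀ v ∈ W i, N v ∈ W i := fun i v hv => sub_mem (hgW i v hv) hv
  rw [← LinearMap.ker_eq_top, ← top_le_iff, ← hW', iSup_le_iff]
  intro i v hv
  have h4 : IsNilpotent (N.restrict (hNW i)) := ⟨p ^ j, by
    rw [Module.End.pow_restrict]
    ext w
    simp [hnil]⟩
  have h5 := pow_eq_zero_of_le (hdim i) (pow_finrank_eq_zero_of_isNilpotent h4)
  rw [Module.End.pow_restrict] at h5
  exact congrArg Subtype.val (LinearMap.congr_fun h5 ⟨v, hv⟩)

/-- Over an algebraically closed field, an `H`-stable space of endomorphisms has a complement which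
is stable under the elements of `H` of order a power of the characteristic. -/
theorem exists_isCompl_conjEnd_of_pow_eq_one [IsAlgClosed K] [FiniteDimensional K V] [Finite I]
    {p : ℕ} [CharP K p] (hp : p.Prime) (hp2 : 2 < p) {W : I → Submodule K V}
    (hW : iSupIndep W) (hW' : iSup W = ⊤) (hdim : ∀ i, finrank K (W i) ≤ (p + 1) / 2)
    {H : Subgroup (V ≃ₗ[K] V)} (hH : ∀ i, ∀ h ∈ H, ∀ v ∈ W i, h v ∈ W i)
    (hirr : ∀ i, ∀ Z ≤ W i, (∀ h ∈ H, ∀ v ∈ Z, h v ∈ Z) → Z = ⊥ ∨ Z = W i)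
    {U : Submodule K (End K V)} (hU : ∀ h ∈ H, ∀ u ∈ U, conjEnd h u ∈ U) :
    ∃ U' : Submodule K (End K V), IsCompl U U' ∧
      ∀ h ∈ H, ∀ j : ℕ, h ^ p ^ j = 1 → ∀ u ∈ U', conjEnd h u ∈ U' := by
  obtain ⟨U', hU', hc⟩ := exists_isCompl_of_irreducible hp2 hW hW'
    (fun i => by have := hdim i; omega) hH hirr hU
  exact ⟨U', hc, fun h hh j hj u hu => conjEnd_mem_of_unipotent hp (by omega) hU'
    (sub_one_pow_eq_zero_of_pow_eq_one hp hW' hdim hj fun i => hH i h hh) (fun i => hH i h hh)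
    (hU h hh) hu⟩

end Unipotent

section Averaging

/-- Averaging over the cosets of a Sylow subgroup: a stable subspace with a projection commuting
with the elements of order a power of the characteristic has a stable complement. -/
theorem Representation.exists_isCompl_of_commute_pow_eq_one {k G M : Type} [Field k] [Group G]
    [Finite G] [AddCommGroup M] [Module k M] (ρ : Representation k G M) {p : ℕ} [CharP k p]
    (hp : p.Prime) {U : Submodule k M} (hU : ∀ g, ∀ u ∈ U, ρ g u ∈ U) {π : M →ₗ[k] M}
    (hπU : ∀ x, π x ∈ U) (hπ : ∀ u ∈ U, π u = u)
    (hcomm : ∀ g : G, ∀ j : ℕ, g ^ p ^ j = 1 → ∀ x, π (ρ g x) = ρ g (π x)) :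
    ∃ U' : Submodule k M, (∀ g, ∀ u ∈ U', ρ g u ∈ U') ∧ IsCompl U U' := by
  have := Fact.mk hp
  have P : Sylow p G := default
  have : Fintype (G ⧸ (P : Subgroup G)) := Fintype.ofFinite _
  let f : G → M →ₗ[k] M := fun g => ρ g ∘ₗ π ∘ₗ ρ g⁻¹
  have hf : ∀ g, ∀ s ∈ P, f (g * s) = f g := by
    intro g s hs
    obtain ⟨j, hj⟩ := P.isPGroup' ⟨s, hs⟩
    have hj' : s⁻¹ ^ p ^ j = 1 := by
      rw [inv_pow, inv_eq_one]
      exact congrArg Subtype.val hj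
    ext x
    simp only [f, LinearMap.comp_apply, mul_inv_rev, map_mul, Module.End.mul_apply]
    rw [hcomm _ j hj', ρ.self_inv_apply]
  have hfm : ∀ g h x, ρ h (f g x) = f (h * g) (ρ h x) := by
    intro g h x
    simp [f]
  let F : G ⧸ (P : Subgroup G) → M →ₗ[k] M := fun q => f q.out
  have hF : ∀ g : G, F (g : G ⧸ (P : Subgroup G)) = f g := by
    intro g
    obtain ⟨s, hs⟩ := QuotientGroup.mk_out_eq_mul (P : Subgroup G) g
    change f _ = f g
    rw [hs, hf g s s.2]
  have hFm : ∀ q h x, ρ h (F q x) = F (h • q) (ρ h x) := by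
    intro q h x
    induction q using QuotientGroup.induction_on with
    | H g => rw [MulAction.Quotient.smul_coe, hF, hF, hfm, smul_eq_mul]
  have hc : (Nat.card (G ⧸ (P : Subgroup G)) : k) ≠ 0 := fun h0 =>
    P.not_dvd_index ((CharP.cast_eq_zero_iff k p _).mp h0)
  let c := (Nat.card (G ⧸ (P : Subgroup G)) : k)
  let Φ : M →ₗ[k] M := c⁻¹ • ∑ q, F q
  have hΦ : ∀ h x, ρ h (Φ x) = Φ (ρ h x) := by
    intro h x
    simp only [Φ, LinearMap.smul_apply, LinearMap.sum_apply, map_smul, map_sum, hFm]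
    exact congrArg _ (Equiv.sum_comp (MulAction.toPerm h) fun q => F q (ρ h x))
  have hΦU : ∀ x, Φ x ∈ U := by
    intro x
    simp only [Φ, LinearMap.smul_apply, LinearMap.sum_apply]
    exact U.smul_mem _ (U.sum_mem fun q _ => hU _ _ (hπU _))
  have hΦ1 : ∀ u : U, Φ.codRestrict U hΦU u = u := by
    intro u
    have h1 : ∀ q, F q u = u := fun q => by
      simp only [F, f, LinearMap.comp_apply]
      rw [hπ _ (hU _ _ u.2), ρ.self_inv_apply]
    ext
    simp only [Φ, LinearMap.codRestrict_apply, LinearMap.smul_apply, LinearMap.sum_apply, h1,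
      Finset.sum_const, Finset.card_univ, ← Nat.card_eq_fintype_card]
    rw [← Nat.cast_smul_eq_nsmul k, smul_smul, inv_mul_cancel₀ hc, one_smul]
  refine ⟨_, fun g u hu => ?_, LinearMap.isCompl_of_proj hΦ1⟩
  rw [LinearMap.ker_codRestrict, LinearMap.mem_ker] at hu ⊢
  rw [← hΦ, hu, map_zero]

end Averaging

section SimpleStable

open TensorProduct

variable {K E : Type} [Field K] [AddCommGroup E] [Module K E]

/-- The minimal nonzero `H`-stable subspaces. -/
structure IsSimpleStable (H : Subgroup (E ≃ₗ[K] E)) (Z : Submodule K E) : Prop where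
  ne_bot : Z ≠ ⊥
  apply_mem : ∀ h ∈ H, ∀ v ∈ Z, h v ∈ Z
  eq_bot_or_eq : ∀ Y ≤ Z, (∀ h ∈ H, ∀ v ∈ Y, h v ∈ Y) → Y = ⊥ ∨ Y = Z

/-- The subspaces stable under `H` form a complete sublattice. -/
def stableSublattice (H : Subgroup (E ≃ₗ[K] E)) : CompleteSublattice (Submodule K E) :=
  CompleteSublattice.mk' {Z | ∀ h ∈ H, ∀ v ∈ Z, h v ∈ Z}
    (fun s hs h hh => by
      change sSup s ≤ (sSup s).comap (h : E →ₗ[K] E)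
      exact sSup_le fun Z hZ v hv => Submodule.mem_sSup_of_mem hZ (hs hZ h hh v hv))
    fun s hs h hh v hv => by
      rw [Submodule.mem_sInf] at hv ⊢
      exact fun Z hZ => hs hZ h hh v (hv Z hZ)

theorem exists_isSimpleStable_le [FiniteDimensional K E] {H : Subgroup (E ≃ₗ[K] E)}
    {Y : Submodule K E} (hY : Y ≠ ⊥) (hYH : ∀ h ∈ H, ∀ v ∈ Y, h v ∈ Y) :
    ∃ Z ≤ Y, IsSimpleStable H Z := by
  obtain ⟨Z, ⟨h1, h2, h3⟩, hmin⟩ := (wellFounded_lt (α := Submodule K E)).has_min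
    {Z | Z ≤ Y ∧ Z ≠ ⊥ ∧ ∀ h ∈ H, ∀ v ∈ Z, h v ∈ Z} ⟨Y, le_rfl, hY, hYH⟩
  refine ⟨Z, h1, h2, h3, fun X hX hXH => or_iff_not_imp_left.mpr fun hX0 => ?_⟩
  exact eq_of_le_of_not_lt hX (hmin X ⟨hX.trans h1, hX0, hXH⟩)

theorem exists_supIndep_of_sSup_eq_top [FiniteDimensional K E] {H : Subgroup (E ≃ₗ[K] E)}
    {P : Set (Submodule K E)} (hP : ∀ Z ∈ P, IsSimpleStable H Z) (htop : sSup P = ⊤) :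
    ∃ s : Finset (Submodule K E), (s : Set (Submodule K E)) ⊆ P ∧ s.SupIndep id ∧ s.sup id = ⊤ := by
  classical
  obtain ⟨Y, ⟨s, hs, hind, rfl⟩, hmax⟩ := (wellFounded_gt (α := Submodule K E)).has_min
    {Y | ∃ s : Finset (Submodule K E), (s : Set (Submodule K E)) ⊆ P ∧ s.SupIndep id ∧
      s.sup id = Y} ⟨_, ∅, by simp, Finset.supIndep_empty _, rfl⟩
  refine ⟨s, hs, hind, ?_⟩
  rw [← top_le_iff, ← htop, sSup_le_iff]
  intro Z hZ
  by_contra hZs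
  have h1 : ∀ h ∈ H, ∀ v ∈ s.sup id, h v ∈ s.sup id := by
    have : s.sup id ∈ stableSublattice H := by
      rw [Finset.sup_id_eq_sSup]
      exact CompleteSublattice.sSupClosed' _ fun Z hZ => (hP Z (hs hZ)).apply_mem
    exact this
  have h2 : Disjoint Z (s.sup id) := by
    rw [disjoint_iff]
    refine ((hP Z hZ).eq_bot_or_eq (Z ⊓ s.sup id) inf_le_left fun h hh v hv =>
      ⟨(hP Z hZ).apply_mem h hh v hv.1, h1 h hh v hv.2⟩).resolve_right fun h => ?_
    exact hZs (inf_eq_left.mp h)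
  refine hmax _ ⟨insert Z s, ?_, hind.insert h2, rfl⟩ ?_
  · rw [Finset.coe_insert, Set.insert_subset_iff]
    exact ⟨hZ, hs⟩
  · rw [Finset.sup_insert]
    exact right_lt_sup.mpr hZs

end SimpleStable

section BaseChange

open TensorProduct

variable {k V : Type} [Field k] [AddCommGroup V] [Module k V] (K : Type) [Field K] [Algebra k K]

/-- The group of automorphisms deduced by extension of scalars. -/
noncomputable def baseChangeGroup (H : Subgroup (V ≃ₗ[k] V)) :
    Subgroup (K ⊗[k] V ≃ₗ[K] K ⊗[k] V) :=
  H.map { toFun := fun h => h.baseChange k K V V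
          map_one' := LinearEquiv.baseChange_one k K V
          map_mul' := LinearEquiv.baseChange_mul k K V }

variable {K}

/-- The action of the Galois group on the coefficients. -/
noncomputable def galTensor (V : Type) [AddCommGroup V] [Module k V] (σ : K ≃ₐ[k] K) :
    K ⊗[k] V ≃ₗ[k] K ⊗[k] V :=
  TensorProduct.congr σ.toLinearEquiv (LinearEquiv.refl k V)

theorem galTensor_tmul (σ : K ≃ₐ[k] K) (c : K) (v : V) : galTensor V σ (c ⊗ₜ v) = σ c ⊗ₜ v := rfl

theorem galTensor_smul (σ : K ≃ₐ[k] K) (c : K) (x : K ⊗[k] V) :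
    galTensor V σ (c • x) = σ c • galTensor V σ x := by
  induction x using TensorProduct.induction_on with
  | zero => simp
  | tmul a v => simp [smul_tmul', galTensor_tmul]
  | add x y hx hy => simp [hx, hy]

theorem galTensor_baseChange (σ : K ≃ₐ[k] K) (h : V ≃ₗ[k] V) (x : K ⊗[k] V) :
    galTensor V σ (h.baseChange k K V V x) = h.baseChange k K V V (galTensor V σ x) := by
  induction x using TensorProduct.induction_on with
  | zero => simp
  | tmul a v => simp [galTensor_tmul]
  | add x y hx hy => simp [hx, hy]

theorem galTensor_symm_galTensor (σ : K ≃ₐ[k] K) (x : K ⊗[k] V) :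
    galTensor V σ.symm (galTensor V σ x) = x := by
  induction x using TensorProduct.induction_on with
  | zero => simp
  | tmul a v => simp [galTensor_tmul]
  | add x y hx hy => simp [hx, hy]

theorem repr_galTensor {J : Type} (b : Basis J k V) (σ : K ≃ₐ[k] K) (x : K ⊗[k] V) (j : J) :
    (b.baseChange K).repr (galTensor V σ x) j = σ ((b.baseChange K).repr x j) := by
  induction x using TensorProduct.induction_on with
  | zero => simp
  | tmul a v => simp [galTensor_tmul]
  | add x y hx hy => simp [hx, hy]

/-- The inverse image of a subspace under the Galois action. -/
noncomputable def galComap (σ : K ≃ₐ[k] K) (Z : Submodule K (K ⊗[k] V)) :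
    Submodule K (K ⊗[k] V) where
  carrier := {x | galTensor V σ x ∈ Z}
  add_mem' := fun hx hy => by
    rw [Set.mem_ofPred_eq, map_add]
    exact add_mem hx hy
  zero_mem' := by
    rw [Set.mem_ofPred_eq, map_zero]
    exact zero_mem _
  smul_mem' := fun c x hx => by
    rw [Set.mem_ofPred_eq, galTensor_smul]
    exact Z.smul_mem _ hx

theorem galComap_mono (σ : K ≃ₐ[k] K) {Y Z : Submodule K (K ⊗[k] V)} (h : Y ≤ Z) :
    galComap σ Y ≤ galComap σ Z :=
  fun _ hx => h hx

theorem galComap_symm_galComap (σ : K ≃ₐ[k] K) (Z : Submodule K (K ⊗[k] V)) :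
    galComap σ.symm (galComap σ Z) = Z := by
  ext x
  change galTensor V σ (galTensor V σ.symm x) ∈ Z ↔ _
  rw [show galTensor V σ (galTensor V σ.symm x) = x from galTensor_symm_galTensor σ.symm x]

theorem galComap_bot (σ : K ≃ₐ[k] K) : galComap σ (⊥ : Submodule K (K ⊗[k] V)) = ⊥ := by
  ext x
  change galTensor V σ x = 0 ↔ x = 0
  exact (galTensor V σ).map_eq_zero_iff

theorem galComap_stable (σ : K ≃ₐ[k] K) {H : Subgroup (V ≃ₗ[k] V)} {Z : Submodule K (K ⊗[k] V)}
    (hZ : ∀ g ∈ baseChangeGroup K H, ∀ v ∈ Z, g v ∈ Z) :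
    ∀ g ∈ baseChangeGroup K H, ∀ v ∈ galComap σ Z, g v ∈ galComap σ Z := by
  rintro _ ⟨h, hh, rfl⟩ v hv
  change galTensor V σ (h.baseChange k K V V v) ∈ Z
  rw [galTensor_baseChange]
  exact hZ _ ⟨h, hh, rfl⟩ _ hv

theorem IsSimpleStable.galComap (σ : K ≃ₐ[k] K) {H : Subgroup (V ≃ₗ[k] V)}
    {Z : Submodule K (K ⊗[k] V)} (hZ : IsSimpleStable (baseChangeGroup K H) Z) :
    IsSimpleStable (baseChangeGroup K H) (galComap σ Z) := by
  refine ⟨fun h => hZ.ne_bot ?_, galComap_stable σ hZ.apply_mem, fun Y hY hYH => ?_⟩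
  · rw [← galComap_symm_galComap σ Z, h, galComap_bot]
  · have h1 := galComap_mono σ.symm hY
    rw [galComap_symm_galComap] at h1
    have h2 : _root_.galComap σ (_root_.galComap σ.symm Y) = Y := galComap_symm_galComap σ.symm Y
    rcases hZ.eq_bot_or_eq _ h1 (galComap_stable σ.symm hYH) with h | h
    · left
      rw [← h2, h, galComap_bot]
    · right
      rw [← h2, h]

theorem galComap_baseChange (σ : K ≃ₐ[k] K) (W : Submodule k V) :
    W.baseChange K ≤ galComap σ (W.baseChange K) := by
  rw [Submodule.baseChange_eq_span, Submodule.span_le]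
  rintro _ ⟨v, hv, rfl⟩
  change galTensor V σ (1 ⊗ₜ v) ∈ Submodule.span K _
  rw [galTensor_tmul, map_one σ]
  exact Submodule.subset_span ⟨v, hv, rfl⟩

/-- Galois descent: a nonzero Galois stable subspace contains a nonzero rational vector. -/
theorem exists_one_tmul_mem_of_le_galComap [IsGalois k K] {S : Submodule K (K ⊗[k] V)}
    (hS : S ≠ ⊥) (hσ : ∀ σ : K ≃ₐ[k] K, S ≤ galComap σ S) :
    ∃ v : V, v ≠ 0 ∧ (1 : K) ⊗ₜ[k] v ∈ S := by
  let b := Basis.ofVectorSpace k V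
  let b' := b.baseChange K
  suffices ∀ n, ∀ x ∈ S, x ≠ 0 → (b'.repr x).support.card = n →
      ∃ v : V, v ≠ 0 ∧ (1 : K) ⊗ₜ[k] v ∈ S by
    obtain ⟨x, hx, hx0⟩ := S.exists_mem_ne_zero_of_ne_bot hS
    exact this _ x hx hx0 rfl
  intro n
  induction n using Nat.strong_induction_on with
  | _ n ih =>
    intro x hx hx0 hn
    obtain ⟨i, hi⟩ : ∃ i, b'.repr x i ≠ 0 := by
      by_contra! h
      exact hx0 (b'.repr.map_eq_zero_iff.mp (Finsupp.ext h))
    set c := b'.repr x i with hc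
    set y := c⁻¹ • x with hy
    have hyS : y ∈ S := S.smul_mem _ hx
    have hyr : ∀ j, b'.repr y j = c⁻¹ * b'.repr x j := fun j => by simp [hy]
    have hyi : b'.repr y i = 1 := by rw [hyr, ← hc, inv_mul_cancel₀ hi]
    by_cases hfix : ∀ σ : K ≃ₐ[k] K, galTensor V σ y = y
    · have h1 : ∀ j, ∃ a : k, algebraMap k K a = b'.repr y j := fun j =>
        (InfiniteGalois.mem_range_algebraMap_iff_fixed _).mpr fun σ => by
          rw [← repr_galTensor b, hfix]
      choose a ha using h1
      let v : V := ∑ j ∈ (b'.repr y).support, a j • b j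
      have hv : (1 : K) ⊗ₜ[k] v = y := by
        conv_rhs => rw [← b'.linearCombination_repr y]
        rw [Finsupp.linearCombination_apply, Finsupp.sum, TensorProduct.tmul_sum]
        refine Finset.sum_congr rfl fun j _ => ?_
        rw [TensorProduct.tmul_smul, ← ha, algebraMap_smul]
        exact congrArg _ (b.baseChange_apply K j).symm
      refine ⟨v, fun h0 => ?_, hv ▸ hyS⟩
      rw [h0, TensorProduct.tmul_zero] at hv
      rw [← hv] at hyi
      simp at hyi
    · push Not at hfix
      obtain ⟨σ, hσy⟩ := hfix
      refine ih _ ?_ (galTensor V σ y - y) (sub_mem (hσ σ hyS) hyS) (sub_ne_zero.mpr hσy) rfl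
      rw [← hn]
      refine Finset.card_lt_card (Finset.ssubset_iff_of_subset ?_ |>.mpr ⟨i, ?_, ?_⟩)
      · intro j hj
        rw [Finsupp.mem_support_iff] at hj ⊢
        intro h0
        apply hj
        rw [map_sub, Finsupp.sub_apply, repr_galTensor, hyr, h0]
        simp
      · rwa [Finsupp.mem_support_iff]
      · rw [Finsupp.notMem_support_iff, map_sub, Finsupp.sub_apply, repr_galTensor, hyi, map_one,
          sub_self]

end BaseChange

section Descent

open TensorProduct

variable {k V K : Type} [Field k] [AddCommGroup V] [Module k V] [Field K] [Algebra k K]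

/-- The map `a ⊗ v ↦ l a • v`. -/
noncomputable def coeffMap (V : Type) [AddCommGroup V] [Module k V] (l : K →ₗ[k] k) :
    K ⊗[k] V →ₗ[k] V :=
  (TensorProduct.lid k V).toLinearMap ∘ₗ l.rTensor V

theorem coeffMap_tmul (l : K →ₗ[k] k) (a : K) (v : V) : coeffMap V l (a ⊗ₜ v) = l a • v := rfl

theorem coeffMap_baseChange (l : K →ₗ[k] k) (f : V →ₗ[k] V) (x : K ⊗[k] V) :
    coeffMap V l (f.baseChange K x) = f (coeffMap V l x) := by
  induction x using TensorProduct.induction_on with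
  | zero => simp
  | tmul a v => simp [coeffMap_tmul]
  | add x y hx hy => simp [hx, hy]

theorem coeffMap_mem (l : K →ₗ[k] k) {W : Submodule k V} {x : K ⊗[k] V}
    (hx : x ∈ W.baseChange K) : coeffMap V l x ∈ W := by
  obtain ⟨y, rfl⟩ := Submodule.toBaseChange_surjective' K W hx
  induction y using TensorProduct.induction_on with
  | zero => simp
  | tmul a v =>
    rw [Submodule.coe_toBaseChange_tmul, coeffMap_tmul]
    exact W.smul_mem _ v.2
  | add x y h1 h2 =>
    rw [map_add, Submodule.coe_add, map_add]
    exact W.add_mem (h1 (Submodule.coe_mem _)) (h2 (Submodule.coe_mem _))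

theorem exists_linearMap_one_eq_one (k K : Type) [Field k] [Field K] [Algebra k K] :
    ∃ l : K →ₗ[k] k, l 1 = 1 := by
  obtain ⟨l, hl⟩ := (Algebra.linearMap k K).exists_leftInverse_of_injective
    (LinearMap.ker_eq_bot.mpr (algebraMap k K).injective)
  refine ⟨l, ?_⟩
  have := LinearMap.congr_fun hl 1
  simpa using this

theorem mem_of_one_tmul_mem_baseChange {W : Submodule k V} {v : V}
    (hv : (1 : K) ⊗ₜ[k] v ∈ W.baseChange K) : v ∈ W := by
  obtain ⟨l, hl⟩ := exists_linearMap_one_eq_one k K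
  have := coeffMap_mem l hv
  rwa [coeffMap_tmul, hl, one_smul] at this

theorem finrank_baseChange_le [FiniteDimensional k V] (W : Submodule k V) :
    finrank K (W.baseChange K) ≤ finrank k W := by
  rw [← finrank_baseChange (R := K) (S := k) (M' := W)]
  exact LinearMap.finrank_le_finrank_of_surjective (Submodule.toBaseChange_surjective K W)

/-- The rational vectors of a subspace of `K ⊗ V`. -/
noncomputable def rationalPart (S : Submodule K (K ⊗[k] V)) : Submodule k V :=
  (S.restrictScalars k).comap (TensorProduct.mk k K V 1)

theorem baseChange_le_iff_le_rationalPart {W : Submodule k V} {S : Submodule K (K ⊗[k] V)} :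
    W.baseChange K ≤ S ↔ W ≤ rationalPart S := by
  rw [Submodule.baseChange_eq_span, Submodule.span_le]
  exact Set.image_subset_iff

theorem baseChangeGroup_baseChange_stable {H : Subgroup (V ≃ₗ[k] V)} {W : Submodule k V}
    (hW : ∀ h ∈ H, ∀ v ∈ W, h v ∈ W) :
    ∀ g ∈ baseChangeGroup K H, ∀ v ∈ W.baseChange K, g v ∈ W.baseChange K := by
  rintro _ ⟨h, hh, rfl⟩
  change W.baseChange K ≤
    (W.baseChange K).comap (h.baseChange k K V V : K ⊗[k] V →ₗ[K] K ⊗[k] V)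
  rw [baseChange_le_iff_le_rationalPart]
  intro v hv
  change h.baseChange k K V V (1 ⊗ₜ v) ∈ W.baseChange K
  rw [LinearEquiv.baseChange_tmul]
  exact Submodule.tmul_mem_baseChange_of_mem _ (hW h hh v hv)

/-- A simple module over `k` becomes a sum of simple modules after a Galois extension. -/
theorem baseChange_le_sSup_isSimpleStable [FiniteDimensional k V] [IsGalois k K]
    {H : Subgroup (V ≃ₗ[k] V)} {W : Submodule k V} (hW : IsSimpleStable H W) :
    W.baseChange K ≤
      sSup {Z | IsSimpleStable (baseChangeGroup K H) Z ∧ Z ≤ W.baseChange K} := by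
  set S := sSup {Z | IsSimpleStable (baseChangeGroup K H) Z ∧ Z ≤ W.baseChange K} with hS
  have hstab := baseChangeGroup_baseChange_stable (K := K) hW.apply_mem
  have h0 : W.baseChange K ≠ ⊥ := by
    obtain ⟨v, hv, hv0⟩ := W.exists_mem_ne_zero_of_ne_bot hW.ne_bot
    intro h
    have h1 : (1 : K) ⊗ₜ[k] v ∈ (⊥ : Submodule k V).baseChange K := by
      rw [Submodule.baseChange_bot, ← h]
      exact Submodule.tmul_mem_baseChange_of_mem _ hv
    exact hv0 ((Submodule.mem_bot k).mp (mem_of_one_tmul_mem_baseChange h1))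
  have hS0 : S ≠ ⊥ := by
    obtain ⟨Z, hZ, hZs⟩ := exists_isSimpleStable_le h0 hstab
    exact fun h => hZs.ne_bot (le_bot_iff.mp (h ▸ le_sSup ⟨hZs, hZ⟩))
  have hSW : S ≤ W.baseChange K := sSup_le fun Z hZ => hZ.2
  have hσ : ∀ σ : K ≃ₐ[k] K, S ≤ galComap σ S := by
    intro σ
    refine sSup_le fun Z hZ => ?_
    rw [show Z = galComap σ (galComap σ.symm Z) from (galComap_symm_galComap σ.symm Z).symm]
    refine galComap_mono σ (le_sSup ⟨hZ.1.galComap σ.symm, ?_⟩)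
    have h1 := galComap_mono σ.symm (hZ.2.trans (galComap_baseChange σ W))
    rwa [galComap_symm_galComap] at h1
  obtain ⟨v, hv0, hv⟩ := exists_one_tmul_mem_of_le_galComap hS0 hσ
  rw [baseChange_le_iff_le_rationalPart]
  have hSs : ∀ g ∈ baseChangeGroup K H, ∀ x ∈ S, g x ∈ S := by
    have : S ∈ stableSublattice (baseChangeGroup K H) :=
      CompleteSublattice.sSupClosed' _ fun Z hZ => hZ.1.apply_mem
    exact this
  have hRW : rationalPart S ≤ W := fun w hw => mem_of_one_tmul_mem_baseChange (hSW hw)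
  refine ((hW.eq_bot_or_eq (rationalPart S) hRW fun h hh w hw => ?_).resolve_left
    fun h => hv0 ?_).ge
  · have := hSs _ ⟨h, hh, rfl⟩ _ hw
    exact this
  · have : v ∈ rationalPart S := hv
    rwa [h, Submodule.mem_bot] at this

theorem exists_supIndep_baseChange [FiniteDimensional k V] [IsGalois k K] {ι : Type}
    {H : Subgroup (V ≃ₗ[k] V)} {W : ι → Submodule k V} (hW : ∀ i, IsSimpleStable H (W i))
    (htop : iSup W = ⊤) {d : ℕ} (hd : ∀ i, finrank k (W i) ≤ d) :
    ∃ s : Finset (Submodule K (K ⊗[k] V)),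
      (∀ Z ∈ s, IsSimpleStable (baseChangeGroup K H) Z ∧ finrank K Z ≤ d) ∧ s.SupIndep id ∧
        s.sup id = ⊤ := by
  let P : Set (Submodule K (K ⊗[k] V)) :=
    {Z | IsSimpleStable (baseChangeGroup K H) Z ∧ ∃ i, Z ≤ (W i).baseChange K}
  have hP : sSup P = ⊤ := by
    rw [← top_le_iff, ← Submodule.baseChange_top, baseChange_le_iff_le_rationalPart, ← htop]
    refine iSup_le fun i => ?_
    rw [← baseChange_le_iff_le_rationalPart]
    exact (baseChange_le_sSup_isSimpleStable (hW i)).trans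
      (sSup_le_sSup fun Z hZ => ⟨hZ.1, i, hZ.2⟩)
  obtain ⟨s, hs, h1, h2⟩ := exists_supIndep_of_sSup_eq_top (fun Z hZ => hZ.1) hP
  refine ⟨s, fun Z hZ => ⟨(hs hZ).1, ?_⟩, h1, h2⟩
  obtain ⟨i, hi⟩ := (hs hZ).2
  exact (Submodule.finrank_mono hi).trans ((finrank_baseChange_le _).trans (hd i))

end Descent

section Conjugation

open TensorProduct

variable {k V : Type} [Field k] [AddCommGroup V] [Module k V]

/-- A projection commutes with the endomorphisms which preserve its image and its kernel. -/
theorem exists_projection_of_isCompl {U U' : Submodule k V} (hc : IsCompl U U') :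
    ∃ P : V →ₗ[k] V, (∀ x, P x ∈ U) ∧ (∀ u ∈ U, P u = u) ∧ ∀ T : V →ₗ[k] V,
      (∀ u ∈ U, T u ∈ U) → (∀ u ∈ U', T u ∈ U') → ∀ x, P (T x) = T (P x) := by
  refine ⟨U.projection U' hc, Submodule.projection_apply_mem hc,
    fun u hu => Submodule.projection_apply_of_mem_left hc hu, fun T hU hU' x => ?_⟩
  conv_lhs => rw [← Submodule.projection_add_projection_eq_self hc x, map_add, map_add]
  rw [Submodule.projection_apply_of_mem_left hc (hU _ (Submodule.projection_apply_mem hc x)),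
    (Submodule.projection_apply_eq_zero_iff hc).mpr
      (hU' _ (Submodule.projection_apply_mem hc.symm x)), add_zero]

/-- The conjugation representation on endomorphisms. -/
def conjRep (k V : Type) [Field k] [AddCommGroup V] [Module k V] :
    Representation k (V ≃ₗ[k] V) (End k V) where
  toFun h :=
    { toFun := conjEnd h
      map_add' := fun A B => by
        ext v
        simp [conjEnd_apply]
      map_smul' := fun c A => by
        ext v
        simp [conjEnd_apply] }
  map_one' := rfl
  map_mul' _ _ := rfl

theorem conjEnd_baseChange {K : Type} [Field K] [Algebra k K] (h : V ≃ₗ[k] V) (A : End k V) :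
    conjEnd (h.baseChange k K V V) (A.baseChange K) = (conjEnd h A).baseChange K := by
  ext v
  simp [conjEnd_apply]

/-- The map `T ↦ (v ↦ l (T (1 ⊗ v)))` on endomorphisms. -/
noncomputable def coeffEnd {K : Type} [Field K] [Algebra k K] (l : K →ₗ[k] k)
    (T : End K (K ⊗[k] V)) : End k V :=
  coeffMap V l ∘ₗ T.restrictScalars k ∘ₗ TensorProduct.mk k K V 1

theorem coeffEnd_apply {K : Type} [Field K] [Algebra k K] (l : K →ₗ[k] k)
    (T : End K (K ⊗[k] V)) (v : V) : coeffEnd l T v = coeffMap V l (T (1 ⊗ₜ v)) := rfl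

theorem coeffEnd_zero {K : Type} [Field K] [Algebra k K] (l : K →ₗ[k] k) :
    coeffEnd l (0 : End K (K ⊗[k] V)) = 0 := by
  ext v
  simp [coeffEnd_apply]

theorem coeffEnd_add {K : Type} [Field K] [Algebra k K] (l : K →ₗ[k] k)
    (S T : End K (K ⊗[k] V)) : coeffEnd l (S + T) = coeffEnd l S + coeffEnd l T := by
  ext v
  simp [coeffEnd_apply]

theorem coeffEnd_smul {K : Type} [Field K] [Algebra k K] (l : K →ₗ[k] k) (c : k)
    (T : End K (K ⊗[k] V)) : coeffEnd l (c • T) = c • coeffEnd l T := by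
  ext v
  simp [coeffEnd_apply]

theorem coeffEnd_conjEnd {K : Type} [Field K] [Algebra k K] (l : K →ₗ[k] k) (h : V ≃ₗ[k] V)
    (T : End K (K ⊗[k] V)) :
    coeffEnd l (conjEnd (h.baseChange k K V V) T) = conjEnd h (coeffEnd l T) := by
  ext v
  rw [coeffEnd_apply, conjEnd_apply, conjEnd_apply, coeffEnd_apply,
    LinearEquiv.baseChange_symm_tmul]
  exact coeffMap_baseChange l (h : V →ₗ[k] V) _

/-- If `V` is a sum of simple modules of small dimension, every stable space of endomorphisms is
the image of a projection which commutes with the elements of order a power of the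
characteristic. -/
theorem exists_projection_conjEnd [Finite k] [FiniteDimensional k V] {p : ℕ} [CharP k p]
    (hp : p.Prime) (hp2 : 2 < p) {ι : Type} {H : Subgroup (V ≃ₗ[k] V)} {W : ι → Submodule k V}
    (hW : ∀ i, IsSimpleStable H (W i)) (htop : iSup W = ⊤)
    (hd : ∀ i, finrank k (W i) ≤ (p + 1) / 2) {U : Submodule k (End k V)}
    (hU : ∀ h ∈ H, ∀ u ∈ U, conjEnd h u ∈ U) :
    ∃ π : End k V →ₗ[k] End k V, (∀ x, π x ∈ U) ∧ (∀ u ∈ U, π u = u) ∧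
      ∀ h ∈ H, ∀ j : ℕ, h ^ p ^ j = 1 → ∀ x, π (conjEnd h x) = conjEnd h (π x) := by
  let K := AlgebraicClosure k
  have : CharP K p := charP_of_injective_algebraMap (algebraMap k K).injective p
  obtain ⟨s, hs, hind, hsup⟩ := exists_supIndep_baseChange (K := K) hW htop hd
  let UK : Submodule K (End K (K ⊗[k] V)) :=
    Submodule.span K (LinearMap.baseChange K '' (U : Set (End k V)))
  have hUK : ∀ g ∈ baseChangeGroup K H, ∀ u ∈ UK, conjEnd g u ∈ UK := by
    rintro _ ⟨h, hh, rfl⟩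
    change UK ≤ UK.comap (conjRep K (K ⊗[k] V) (h.baseChange k K V V))
    rw [Submodule.span_le]
    rintro _ ⟨u, hu, rfl⟩
    refine Submodule.subset_span ⟨conjEnd h u, hU h hh u hu, ?_⟩
    exact (conjEnd_baseChange h u).symm
  obtain ⟨U', hc, hU'⟩ := exists_isCompl_conjEnd_of_pow_eq_one (I := s) (W := fun Z => Z.1) hp hp2
    (iSupIndep_comp_coe_iff_supIndep.mpr hind)
    (by rw [← hsup, Finset.sup_id_eq_sSup, sSup_eq_iSup']; rfl)
    (fun Z => (hs Z Z.2).2) (fun Z => (hs Z Z.2).1.apply_mem)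
    (fun Z => (hs Z Z.2).1.eq_bot_or_eq) hUK
  obtain ⟨l, hl⟩ := exists_linearMap_one_eq_one k K
  have hlb : ∀ (c : K) (u : End k V), coeffEnd l (c • u.baseChange K) = l c • u := by
    intro c u
    ext v
    rw [coeffEnd_apply, LinearMap.smul_apply, LinearMap.baseChange_tmul, smul_tmul', coeffMap_tmul,
      smul_eq_mul, mul_one, LinearMap.smul_apply]
  have hC : ∀ T ∈ UK, coeffEnd l T ∈ U := by
    intro T hT
    induction hT using Submodule.closure_induction with
    | zero =>
      rw [coeffEnd_zero]
      exact U.zero_mem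
    | add x y _ _ hx hy =>
      rw [coeffEnd_add]
      exact U.add_mem hx hy
    | smul_mem c x hx =>
      obtain ⟨u, hu, rfl⟩ := hx
      rw [hlb]
      exact U.smul_mem _ hu
  obtain ⟨P, hP1, hP2, hP3⟩ :=
    exists_projection_of_isCompl (k := K) (V := End K (K ⊗[k] V)) hc
  let π : End k V →ₗ[k] End k V :=
    { toFun := fun x => coeffEnd l (P (x.baseChange K))
      map_add' := fun x y => by rw [LinearMap.baseChange_add, map_add, coeffEnd_add]
      map_smul' := fun c x => by
        rw [LinearMap.baseChange_smul, ← algebraMap_smul K c (x.baseChange K), map_smul,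
          algebraMap_smul, coeffEnd_smul, RingHom.id_apply] }
  have hπ : ∀ x, π x = coeffEnd l (P (x.baseChange K)) := fun x => rfl
  refine ⟨π, fun x => hC _ (hP1 _), fun u hu => ?_, fun h hh j hj x => ?_⟩
  · rw [hπ, hP2 _ (Submodule.subset_span ⟨u, hu, rfl⟩)]
    have := hlb 1 u
    rwa [one_smul, hl, one_smul] at this
  · have hg : h.baseChange k K V V ∈ baseChangeGroup K H := ⟨h, hh, rfl⟩
    have hgj : (h.baseChange k K V V) ^ p ^ j = 1 := by
      rw [← LinearEquiv.baseChange_pow, hj, LinearEquiv.baseChange_one]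
    rw [hπ, hπ, ← conjEnd_baseChange, ← coeffEnd_conjEnd]
    exact congrArg _ (hP3 (conjRep K (K ⊗[k] V) (h.baseChange k K V V)) (hUK _ hg)
      (hU' _ hg j hgj) _)

/-- An element of order a power of the characteristic acts trivially on a sum of stable lines. -/
theorem eq_one_of_pow_eq_one_of_finrank_le_one [FiniteDimensional k V] {p j : ℕ} [CharP k p]
    (hp : p.Prime) {ι : Type} {W : ι → Submodule k V} (htop : iSup W = ⊤)
    (hd : ∀ i, finrank k (W i) ≤ 1) {h : V ≃ₗ[k] V} (hhW : ∀ i, ∀ v ∈ W i, h v ∈ W i)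
    (hj : h ^ p ^ j = 1) : h = 1 := by
  have h1 := sub_one_pow_eq_zero_of_pow_eq_one hp htop hd hj hhW
  rw [pow_one, sub_eq_zero] at h1
  ext v
  exact LinearMap.congr_fun h1 v

/-- The space of endomorphisms is a semisimple module. -/
theorem exists_isCompl_conjEnd [Finite k] [FiniteDimensional k V] {p : ℕ} [CharP k p]
    (hp : p.Prime) {H : Subgroup (V ≃ₗ[k] V)}
    (hyp : ¬ p ∣ Nat.card H ∨ ∃ (ι : Type) (W : ι → Submodule k V),
      (∀ i, IsSimpleStable H (W i)) ∧ (∀ i, finrank k (W i) ≤ (p + 1) / 2) ∧ iSup W = ⊤)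
    {U : Submodule k (End k V)} (hU : ∀ h ∈ H, ∀ u ∈ U, conjEnd h u ∈ U) :
    ∃ U' : Submodule k (End k V), (∀ h ∈ H, ∀ u ∈ U', conjEnd h u ∈ U') ∧ IsCompl U U' := by
  have : Finite V := Module.finite_of_finite k
  have : Finite (V ≃ₗ[k] V) := DFunLike.finite _
  suffices ∃ π : End k V →ₗ[k] End k V, (∀ x, π x ∈ U) ∧ (∀ u ∈ U, π u = u) ∧
      ∀ h ∈ H, ∀ j : ℕ, h ^ p ^ j = 1 → ∀ x, π (conjEnd h x) = conjEnd h (π x) by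
    obtain ⟨π, h1, h2, h3⟩ := this
    obtain ⟨U', h4, h5⟩ := Representation.exists_isCompl_of_commute_pow_eq_one
      ((conjRep k V).comp H.subtype) hp (fun g => hU g g.2) h1 h2
      fun g j hj => h3 g g.2 j (congrArg Subtype.val hj)
    exact ⟨U', fun h hh => h4 ⟨h, hh⟩, h5⟩
  have htriv : (∀ h ∈ H, ∀ j : ℕ, h ^ p ^ j = 1 → h = 1) →
      ∃ π : End k V →ₗ[k] End k V, (∀ x, π x ∈ U) ∧ (∀ u ∈ U, π u = u) ∧
        ∀ h ∈ H, ∀ j : ℕ, h ^ p ^ j = 1 → ∀ x, π (conjEnd h x) = conjEnd h (π x) := by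
    intro h1
    obtain ⟨U', hU'⟩ := U.exists_isCompl
    refine ⟨U.projection U' hU', Submodule.projection_apply_mem hU',
      fun u hu => Submodule.projection_apply_of_mem_left hU' hu, fun h hh j hj x => ?_⟩
    rw [h1 h hh j hj]
    rfl
  rcases hyp with hyp | ⟨ι, W, hW, hd, htop⟩
  · refine htriv fun h hh j hj => ?_
    have h1 : orderOf h ∣ Nat.card H := by
      rw [← Subgroup.orderOf_mk h hh]
      exact orderOf_dvd_natCard _
    have h2 : (p ^ j).Coprime (Nat.card H) :=
      Nat.Coprime.pow_left j ((Nat.Prime.coprime_iff_not_dvd hp).mpr hyp)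
    exact orderOf_eq_one_iff.mp (Nat.eq_one_of_dvd_coprimes h2 (orderOf_dvd_of_pow_eq_one hj) h1)
  · rcases hp.two_le.lt_or_eq with hp2 | rfl
    · exact exists_projection_conjEnd hp hp2 hW htop hd hU
    · exact htriv fun h hh j hj => eq_one_of_pow_eq_one_of_finrank_le_one hp htop hd
        (fun i => (hW i).apply_mem h hh) hj

end Conjugation

section AdditiveSubgroups

variable {M : Type*} [AddCommGroup M]

/-- In a finite group which is the only stable subgroup containing all the minimal nonzero ones,
every stable subgroup has a stable complement. -/
theorem AddSubgroup.exists_isCompl_of_forall_minimal_le [Finite M] (P : AddSubgroup M → Prop)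
    (hsup : ∀ A B, P A → P B → P (A ⊔ B)) (hinf : ∀ A B, P A → P B → P (A ⊓ B)) (hbot : P ⊥)
    (hgen : ∀ S, P S → (∀ Z, Minimal (fun Y => P Y ∧ Y ≠ ⊥) Z → Z ≤ S) → S = ⊤)
    {W : AddSubgroup M} (hW : P W) : ∃ W', P W' ∧ IsCompl W W' := by
  have : Finite (AddSubgroup M) := Finite.of_injective _ SetLike.coe_injective
  obtain ⟨W', h⟩ := Set.Finite.exists_maximal (Set.toFinite {Y | P Y ∧ Disjoint W Y})
    ⟨⊥, hbot, disjoint_bot_right⟩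
  obtain ⟨⟨hW', hd⟩, hmax⟩ := h
  refine ⟨W', hW', hd, codisjoint_iff.mpr (hgen _ (hsup _ _ hW hW') fun Z hZ => ?_)⟩
  by_contra hle
  have hZd : Disjoint (W ⊔ W') Z := by
    rw [disjoint_iff]
    by_contra hne
    exact hle ((hZ.2 ⟨hinf _ _ (hsup _ _ hW hW') hZ.1.1, hne⟩ inf_le_right).trans inf_le_left)
  exact hle ((le_sup_right.trans (hmax ⟨hsup _ _ hW' hZ.1.1,
    hd.disjoint_sup_right_of_disjoint_sup_left hZd⟩ le_sup_left)).trans le_sup_right)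

end AdditiveSubgroups

section Conjugation

variable {k V : Type} [Field k] [AddCommGroup V] [Module k V]

/-- Stability of an additive group of endomorphisms under conjugation by a group. -/
def IsConjStable (H : Subgroup (V ≃ₗ[k] V)) (Y : AddSubgroup (End k V)) : Prop :=
  ∀ h ∈ H, ∀ A ∈ Y, conjEnd h A ∈ Y

theorem isConjStable_iff {H : Subgroup (V ≃ₗ[k] V)} {Y : AddSubgroup (End k V)} :
    IsConjStable H Y ↔ ∀ h ∈ H, Y ≤ Y.comap (conjRep k V h).toAddMonoidHom := Iff.rfl

theorem IsConjStable.sup {H : Subgroup (V ≃ₗ[k] V)} {A B : AddSubgroup (End k V)}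
    (hA : IsConjStable H A) (hB : IsConjStable H B) : IsConjStable H (A ⊔ B) :=
  isConjStable_iff.mpr fun h hh => sup_le
    ((isConjStable_iff.mp hA h hh).trans (AddSubgroup.comap_mono le_sup_left))
    ((isConjStable_iff.mp hB h hh).trans (AddSubgroup.comap_mono le_sup_right))

theorem IsConjStable.inf {H : Subgroup (V ≃ₗ[k] V)} {A B : AddSubgroup (End k V)}
    (hA : IsConjStable H A) (hB : IsConjStable H B) : IsConjStable H (A ⊓ B) :=
  fun h hh x hx => ⟨hA h hh x hx.1, hB h hh x hx.2⟩

theorem IsConjStable.bot (H : Subgroup (V ≃ₗ[k] V)) : IsConjStable H ⊥ := by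
  intro h hh x hx
  rw [AddSubgroup.mem_bot] at hx ⊢
  rw [hx]
  exact map_zero (conjRep k V h)

theorem IsConjStable.comap_smul {H : Subgroup (V ≃ₗ[k] V)} {A : AddSubgroup (End k V)}
    (hA : IsConjStable H A) (c : k) :
    IsConjStable H (A.comap (DistribSMul.toAddMonoidHom (End k V) c)) := by
  intro h hh x hx
  change c • conjRep k V h x ∈ A
  rw [← map_smul]
  exact hA h hh _ hx

theorem IsConjStable.sSup {H : Subgroup (V ≃ₗ[k] V)} {s : Set (AddSubgroup (End k V))}
    (hs : ∀ A ∈ s, IsConjStable H A) : IsConjStable H (sSup s) :=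
  isConjStable_iff.mpr fun h hh => sSup_le fun A hA =>
    (isConjStable_iff.mp (hs A hA) h hh).trans (AddSubgroup.comap_mono (le_sSup hA))

/-- Scaling preserves minimality among nonzero stable additive groups. -/
theorem minimal_isConjStable_comap_smul {H : Subgroup (V ≃ₗ[k] V)} {Z : AddSubgroup (End k V)}
    (hZ : Minimal (fun Y => IsConjStable H Y ∧ Y ≠ ⊥) Z) {c : k} (hc : c ≠ 0) :
    Minimal (fun Y => IsConjStable H Y ∧ Y ≠ ⊥)
      (Z.comap (DistribSMul.toAddMonoidHom (End k V) c)) := by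
  have key : ∀ (a : k) (_ : a ≠ 0) (Y : AddSubgroup (End k V)), Y ≠ ⊥ →
      Y.comap (DistribSMul.toAddMonoidHom (End k V) a) ≠ ⊥ := by
    intro a ha Y hY h
    refine hY ((AddSubgroup.eq_bot_iff_forall _).mpr fun x hx => ?_)
    have h1 : a⁻¹ • x ∈ Y.comap (DistribSMul.toAddMonoidHom (End k V) a) := by
      change a • a⁻¹ • x ∈ Y
      rwa [smul_inv_smul₀ ha]
    rw [h, AddSubgroup.mem_bot] at h1
    rw [← smul_inv_smul₀ ha x, h1, smul_zero]
  refine ⟨⟨hZ.1.1.comap_smul c, key c hc Z hZ.1.2⟩, fun Y hY hle x hx => ?_⟩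
  have h1 := hZ.2 (y := Y.comap (DistribSMul.toAddMonoidHom (End k V) c⁻¹))
    ⟨hY.1.comap_smul c⁻¹, key _ (inv_ne_zero hc) Y hY.2⟩ fun y hy => by
      have h2 : c • c⁻¹ • y ∈ Z := hle hy
      rwa [smul_inv_smul₀ hc] at h2
  have h3 : c⁻¹ • c • x ∈ Y := h1 hx
  rwa [inv_smul_smul₀ hc] at h3

/-- If the space of endomorphisms is semisimple, it is semisimple over the prime field. -/
theorem exists_isCompl_addSubgroup [Finite k] [FiniteDimensional k V] {H : Subgroup (V ≃ₗ[k] V)}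
    (hss : ∀ U : Submodule k (End k V), (∀ h ∈ H, ∀ u ∈ U, conjEnd h u ∈ U) →
      ∃ U' : Submodule k (End k V), (∀ h ∈ H, ∀ u ∈ U', conjEnd h u ∈ U') ∧ IsCompl U U')
    {W : AddSubgroup (End k V)} (hW : IsConjStable H W) :
    ∃ W', IsConjStable H W' ∧ IsCompl W W' := by
  have : Finite (End k V) := Module.finite_of_finite k
  have : Finite (AddSubgroup (End k V)) := Finite.of_injective _ SetLike.coe_injective
  refine AddSubgroup.exists_isCompl_of_forall_minimal_le (IsConjStable H) (fun _ _ => .sup)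
    (fun _ _ => .inf) (.bot H) (fun T hT hmin => ?_) hW
  let s : Set (AddSubgroup (End k V)) := {Z | Minimal (fun Y => IsConjStable H Y ∧ Y ≠ ⊥) Z}
  let S : Submodule k (End k V) :=
    { sSup s with
      smul_mem' := by
        intro c x hx
        rcases eq_or_ne c 0 with rfl | hc
        · rw [zero_smul]
          exact (sSup s).zero_mem
        · have h1 : sSup s ≤ (sSup s).comap (DistribSMul.toAddMonoidHom (End k V) c) := by
            refine sSup_le fun Z hZ y hy => ?_
            refine le_sSup (show _ ∈ s from minimal_isConjStable_comap_smul hZ (inv_ne_zero hc)) ?_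
            change c⁻¹ • c • y ∈ Z
            rwa [inv_smul_smul₀ hc]
          exact h1 hx }
  obtain ⟨S', hS', hc⟩ := hss S (IsConjStable.sSup (s := s) fun A hA => hA.1.1)
  have hbot : S' = ⊥ := by
    by_contra hne
    have hne' : S'.toAddSubgroup ≠ ⊥ := fun h =>
      hne (Submodule.toAddSubgroup_injective (h.trans Submodule.bot_toAddSubgroup.symm))
    obtain ⟨Z, hZle, hZ⟩ := Set.Finite.exists_le_minimal
      (Set.toFinite {Y | IsConjStable H Y ∧ Y ≠ ⊥})
      (show S'.toAddSubgroup ∈ _ from ⟨hS', hne'⟩)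
    refine hZ.1.2 ((AddSubgroup.eq_bot_iff_forall _).mpr fun x hx => ?_)
    have h1 : x ∈ S := le_sSup (show Z ∈ s from hZ) hx
    exact Submodule.disjoint_def.mp hc.disjoint x h1 (hZle hx)
  have htop : S = ⊤ := by
    have := hc.sup_eq_top
    rwa [hbot, sup_bot_eq] at this
  refine (AddSubgroup.eq_top_iff' _).mpr fun x => ?_
  have h1 : x ∈ S := htop ▸ Submodule.mem_top
  exact sSup_le (s := s) hmin h1

/-- Additive maps extend by zero from a direct summand. -/
theorem AddSubgroup.exists_extension_of_isCompl {M N : Type*} [AddCommGroup M] [AddCommGroup N]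
    {W W' : AddSubgroup M} (hc : IsCompl W W') (f : W →+ N) :
    ∃ F : M →+ N, (∀ A : W, F A = f A) ∧ ∀ A ∈ W', F A = 0 := by
  have hc' : IsCompl (AddSubgroup.toIntSubmodule W) (AddSubgroup.toIntSubmodule W') :=
    (AddSubgroup.toIntSubmodule (M := M)).isCompl hc
  refine ⟨(LinearMap.ofIsCompl hc' f.toIntLinearMap 0).toAddMonoidHom, fun A => ?_, fun A hA => ?_⟩
  · exact LinearMap.ofIsCompl_apply_left hc' (φ := f.toIntLinearMap) (ψ := 0) A
  · exact LinearMap.ofIsCompl_apply_right hc' (φ := f.toIntLinearMap) (ψ := 0) ⟨A, hA⟩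

end Conjugation

/-- Let `k` be a finite field of characteristic `p`, `V` a finite-dimensional
`k`-vector space and `H ≤ GL(V)`.  Assume (a) `p ∤ #H`, or (b) `V` is a direct sum of simple
`k[H]`-modules of `k`-dimension at most `(p+1)/2`.  Then:
(1) `End_k(V)` with the conjugation action is a semisimple `k[H]`-module (every `H`-stable
`k`-subspace has an `H`-stable complement);
(2) `End_k(V)` is a semisimple `𝔽_p[H]`-module (every `H`-stable additive subgroup has an
`H`-stable complement; note an `𝔽_p`-submodule is just an additive subgroup);
(3) every `𝔽_p[H]`-submodule `W ⊆ End_k(V)` is a direct summand;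
(4) if `Hom_{𝔽_p}(End_k(V), V)^H = 0` then `Hom_{𝔽_p}(W, V)^H = 0` for every `𝔽_p[H]`-submodule
`W ⊆ End_k(V)` (an `𝔽_p`-linear map between vector spaces over `𝔽_p` is the same as an
additive map). -/
theorem stmt3 {k V : Type} [Field k] [Fintype k] [AddCommGroup V] [Module k V]
    [FiniteDimensional k V]
    (p : ℕ) (hp : p.Prime) [CharP k p]
    (H : Subgroup (V ≃ₗ[k] V))
    (hyp : (¬ (p ∣ Nat.card H)) ∨
      ∃ (ι : Type) (W : ι → Submodule k V),
        (∀ i, ∀ h : H, ∀ v ∈ W i, (h : V ≃ₗ[k] V) v ∈ W i) ∧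
        (∀ i, W i ≠ ⊥) ∧
        (∀ i, ∀ U : Submodule k V, U ≤ W i →
          (∀ h : H, ∀ v ∈ U, (h : V ≃ₗ[k] V) v ∈ U) → U = ⊥ ∨ U = W i) ∧
        (∀ i, Module.finrank k (W i) ≤ (p + 1) / 2) ∧
        iSupIndep W ∧ iSup W = ⊤) :
    -- (1)
    (∀ U : Submodule k (Module.End k V),
      (∀ h : H, ∀ A ∈ U, conjEnd (h : V ≃ₗ[k] V) A ∈ U) →
      ∃ U' : Submodule k (Module.End k V),
        (∀ h : H, ∀ A ∈ U', conjEnd (h : V ≃ₗ[k] V) A ∈ U') ∧ IsCompl U U') ∧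
    -- (2)
    (∀ W : AddSubgroup (Module.End k V),
      (∀ h : H, ∀ A ∈ W, conjEnd (h : V ≃ₗ[k] V) A ∈ W) →
      ∃ W' : AddSubgroup (Module.End k V),
        (∀ h : H, ∀ A ∈ W', conjEnd (h : V ≃ₗ[k] V) A ∈ W') ∧ IsCompl W W') ∧
    -- (3)
    (∀ W : AddSubgroup (Module.End k V),
      (∀ h : H, ∀ A ∈ W, conjEnd (h : V ≃ₗ[k] V) A ∈ W) →
      ∃ W' : AddSubgroup (Module.End k V),
        (∀ h : H, ∀ A ∈ W', conjEnd (h : V ≃ₗ[k] V) A ∈ W') ∧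
        W ⊔ W' = ⊤ ∧ W ⊓ W' = ⊥) ∧
    -- (4)
    ((∀ f : Module.End k V → V,
        (∀ A B : Module.End k V, f (A + B) = f A + f B) →
        (∀ (h : H) (A : Module.End k V),
          f (conjEnd (h : V ≃ₗ[k] V) A) = (h : V ≃ₗ[k] V) (f A)) →
        ∀ A, f A = 0) →
      ∀ W : AddSubgroup (Module.End k V),
        (∀ h : H, ∀ A ∈ W, conjEnd (h : V ≃ₗ[k] V) A ∈ W) →
        ∀ f : W → V,
          (∀ A B : W, f (A + B) = f A + f B) →
          (∀ (h : H) (A B : W),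
            (B : Module.End k V) = conjEnd (h : V ≃ₗ[k] V) (A : Module.End k V) →
            f B = (h : V ≃ₗ[k] V) (f A)) →
          ∀ A : W, f A = 0) := by
  have hss : ∀ U : Submodule k (Module.End k V), (∀ h ∈ H, ∀ u ∈ U, conjEnd h u ∈ U) →
      ∃ U' : Submodule k (Module.End k V),
        (∀ h ∈ H, ∀ u ∈ U', conjEnd h u ∈ U') ∧ IsCompl U U' := by
    refine fun U hU => exists_isCompl_conjEnd hp (hyp.imp_right ?_) hU
    rintro ⟨ι, W, hst, hne, hmin, hd, -, htop⟩
    exact ⟨ι, W, fun i => ⟨hne i, fun h hh => hst i ⟨h, hh⟩,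
      fun U hU hU' => hmin i U hU fun h => hU' h h.2⟩, hd, htop⟩
  have hadd : ∀ W : AddSubgroup (Module.End k V),
      (∀ h : H, ∀ A ∈ W, conjEnd (h : V ≃ₗ[k] V) A ∈ W) →
      ∃ W' : AddSubgroup (Module.End k V),
        (∀ h : H, ∀ A ∈ W', conjEnd (h : V ≃ₗ[k] V) A ∈ W') ∧ IsCompl W W' := by
    intro W hW
    obtain ⟨W', hW', hc⟩ := exists_isCompl_addSubgroup hss (W := W) fun h hh => hW ⟨h, hh⟩
    exact ⟨W', fun h => hW' h h.2, hc⟩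
  refine ⟨fun U hU => ?_, hadd, fun W hW => ?_, fun hhom W hW f hf hfH A => ?_⟩
  · obtain ⟨U', hU', hc⟩ := hss U fun h hh => hU ⟨h, hh⟩
    exact ⟨U', fun h => hU' h h.2, hc⟩
  · obtain ⟨W', hW', hc⟩ := hadd W hW
    exact ⟨W', hW', hc.sup_eq_top, hc.inf_eq_bot⟩
  · obtain ⟨W', hW', hc⟩ := hadd W hW
    obtain ⟨F, hF, hF'⟩ := AddSubgroup.exists_extension_of_isCompl hc (AddMonoidHom.mk' f hf)
    rw [← AddMonoidHom.mk'_apply f hf, ← hF]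
    refine hhom F (map_add F) (fun h B => ?_) A
    obtain ⟨x, hx, y, hy, rfl⟩ := AddSubgroup.mem_sup.mp
      (hc.sup_eq_top ▸ AddSubgroup.mem_top B : B ∈ W ⊔ W')
    have h1 : conjEnd (h : V ≃ₗ[k] V) (x + y) = conjEnd h x + conjEnd h y :=
      map_add (conjRep k V h) x y
    rw [h1, map_add, map_add, hF' y hy, hF' _ (hW' h y hy), add_zero, add_zero,
      hF ⟨_, hW h x hx⟩, hF ⟨x, hx⟩]
    exact hfH h ⟨x, hx⟩ ⟨_, hW h x hx⟩ rfl
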